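/- Let s ∈ (0,1) be irrational with R^n(s) < 1/2 for all integers n ≥ 0, so that every tile of Δ_s is a box or a diamond. Let γ ⊆ X_s⁰ be a compact arc connecting a point contained in a box tile of Δ_s to a point contained in a diamond tile of Δ_s. Then γ contains a point of the limit set Λ̂_s. -/

import Mathlib

noncomputable section

open Set Topology Filter

/-- The parallelogram `X_s = F₁(s)`, centered at the origin and spanned by the
vectors `(2,0)` and `(2s,2s)`. -/
def F1 (s : ℝ) : Set (ℝ × ℝ) :=
  {p | ∃ a b : ℝ, a ∈ Icc (-(1:ℝ)/2) (1/2) ∧ b ∈ Icc (-(1:ℝ)/2) (1/2) ∧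
    p = (2 * a + 2 * s * b, 2 * s * b)}

/-- Rotation by `π/2` about the origin. -/
def rotQ (p : ℝ × ℝ) : ℝ × ℝ := (-p.2, p.1)

/-- `F₂(s)`, the image of `F₁(s)` under rotation by `π/2` about the origin. -/
def F2 (s : ℝ) : Set (ℝ × ℝ) := rotQ '' F1 s

/-- The lattice `L₁` generated by `(0,2)` and `(2s,2s)`. -/
def L1 (s : ℝ) : Set (ℝ × ℝ) :=
  {v | ∃ m n : ℤ, v = (2 * s * n, 2 * m + 2 * s * n)}

/-- The lattice `L₂` generated by `(2,0)` and `(2s,−2s)`. -/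
def L2 (s : ℝ) : Set (ℝ × ℝ) :=
  {v | ∃ m n : ℤ, v = (2 * m + 2 * s * n, -(2 * s * n))}

/-- `F_j` indexed by `Fin 2` (index `0` is `F₁`, index `1` is `F₂`). -/
def FF (s : ℝ) : Fin 2 → Set (ℝ × ℝ) := fun j => if j = 0 then F1 s else F2 s

/-- `L_j` indexed by `Fin 2` (index `0` is `L₁`, index `1` is `L₂`). -/
def LL (s : ℝ) : Fin 2 → Set (ℝ × ℝ) := fun j => if j = 0 then L1 s else L2 s

/-- One application of the map `f′`, as a relation: `StepRel s p q` holds iff `p ∈ F_j`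
for some `j`, there is a unique `v ∈ L_{3−j}` with `p + v ∈ F_{3−j}`, and `q = p + v`
(i.e. `q − p ∈ L_{3−j}` and `q ∈ F_{3−j}`).  `f′` is undefined where the translation
is not unique. -/
def StepRel (s : ℝ) (p q : ℝ × ℝ) : Prop :=
  ∃ j : Fin 2, p ∈ FF s j ∧ (∃! v, v ∈ LL s (j + 1) ∧ p + v ∈ FF s (j + 1)) ∧
    q - p ∈ LL s (j + 1) ∧ q ∈ FF s (j + 1)

/-- The octagonal PET map `f_s = (f′)²`, as a relation. -/
def MapRel (s : ℝ) (p q : ℝ × ℝ) : Prop := ∃ r, StepRel s p r ∧ StepRel s r q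

/-- `n`-fold iteration of the (partially defined) map `f_s`, as a relation. -/
def IterRel (s : ℝ) : ℕ → ℝ × ℝ → ℝ × ℝ → Prop
  | 0, p, q => p = q
  | n + 1, p, q => ∃ r, IterRel s n p r ∧ MapRel s r q

/-- A convex polygon: the convex hull of a finite set of points, with nonempty interior. -/
def IsConvexPolygon (P : Set (ℝ × ℝ)) : Prop :=
  (∃ V : Finset (ℝ × ℝ), P = convexHull ℝ (V : Set (ℝ × ℝ))) ∧ (interior P).Nonempty

/-- A periodic tile of `(X_s, f_s)`: a maximal convex polygon in `X_s` on whose interior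
`f_s` and all its iterates are defined and periodic. -/
def IsPeriodicTile (s : ℝ) (P : Set (ℝ × ℝ)) : Prop :=
  IsConvexPolygon P ∧ P ⊆ F1 s ∧
    (∃ n, 0 < n ∧ ∀ p ∈ interior P, IterRel s n p p) ∧
    ∀ Q, IsConvexPolygon Q → Q ⊆ F1 s →
      (∃ n, 0 < n ∧ ∀ p ∈ interior Q, IterRel s n p p) → P ⊆ Q → P = Q

/-- The tiling `Δ_s`: the collection of all periodic tiles. -/
def tiles (s : ℝ) : Set (Set (ℝ × ℝ)) := {P | IsPeriodicTile s P}

/-- The limit set `Λ̂_s`: points of `X_s` every neighborhood of which meets infinitely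
many tiles of `Δ_s`. -/
def limitSet (s : ℝ) : Set (ℝ × ℝ) :=
  {p | p ∈ F1 s ∧ ∀ U ∈ 𝓝 p, {P ∈ tiles s | (U ∩ P).Nonempty}.Infinite}

/-- The renormalization map `R`. -/
def Rmap (x : ℝ) : ℝ :=
  if x < 1 / 2 then 1 / (2 * x) - (⌊1 / (2 * x)⌋ : ℤ) else 1 - x

/-- The central tiles of `Δ_s`: for `s > 1/2` the single octagon `F₁ ∩ F₂`; for
`s ≤ 1/2` the squares of the grid generated by the square `F₁ ∩ F₂` that lie in `X_s`. -/
def centralTiles (s : ℝ) : Set (Set (ℝ × ℝ)) :=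
  if 1 / 2 < s then {F1 s ∩ F2 s}
  else {T | (∃ m n : ℤ,
        T = (fun p : ℝ × ℝ => (p.1 + 2 * s * m, p.2 + 2 * s * n)) '' (F1 s ∩ F2 s)) ∧
      T ⊆ F1 s}

/-- The portion of a set `S ⊆ X_s` lying to the left of the central tiles of `Δ_s`
(the closure of the set of points of `S` lying strictly to the left of every point of
every central tile). -/
def leftPart (s : ℝ) (S : Set (ℝ × ℝ)) : Set (ℝ × ℝ) :=
  closure {p ∈ S | ∀ T ∈ centralTiles s, ∀ q ∈ T, p.1 < q.1}

/-- `X_s⁰`, the left half of `X_s`. -/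
def Xzero (s : ℝ) : Set (ℝ × ℝ) := leftPart s (F1 s)

/-- `S_s = Λ̂_s ∩ X_s⁰`, the left half of the limit set. -/
def leftLimitSet (s : ℝ) : Set (ℝ × ℝ) := limitSet s ∩ Xzero s

/-- Dot product in the plane. -/
def dot2 (v w : ℝ × ℝ) : ℝ := v.1 * w.1 + v.2 * w.2

/-- Cross product (signed area form) in the plane. -/
def cross2 (v w : ℝ × ℝ) : ℝ := v.1 * w.2 - v.2 * w.1

/-- The Euclidean distance on `ℝ × ℝ`. -/
def eudist (p q : ℝ × ℝ) : ℝ := Real.sqrt ((p.1 - q.1) ^ 2 + (p.2 - q.2) ^ 2)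

/-- A (solid) square in the plane. -/
def IsSquareSet (P : Set (ℝ × ℝ)) : Prop :=
  ∃ p v w : ℝ × ℝ, dot2 v w = 0 ∧ dot2 v v = dot2 w w ∧ v ≠ 0 ∧
    P = {q | ∃ a b : ℝ, a ∈ Icc (0:ℝ) 1 ∧ b ∈ Icc (0:ℝ) 1 ∧ q = p + a • v + b • w}

/-- Rotation by `π/4` about the origin. -/
def rot45 (v : ℝ × ℝ) : ℝ × ℝ :=
  ((v.1 - v.2) / Real.sqrt 2, (v.1 + v.2) / Real.sqrt 2)

/-- A (solid) semi-regular octagon: a convex octagon whose interior angles all equal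
`3π/4` (so consecutive edge directions differ by rotation by `π/4`) and whose side
lengths alternate between two values `a` and `b`. -/
def IsSemiregularOctagon (P : Set (ℝ × ℝ)) : Prop :=
  ∃ (p u : ℝ × ℝ) (a b : ℝ), dot2 u u = 1 ∧ 0 < a ∧ 0 < b ∧
    P = convexHull ℝ (Set.range fun k : Fin 8 =>
      p + ∑ i ∈ Finset.range k.1, (if Even i then a else b) • rot45^[i] u)

/-- A box: a square with sides parallel to the coordinate axes. -/
def IsBox (P : Set (ℝ × ℝ)) : Prop :=
  ∃ (p : ℝ × ℝ) (c : ℝ), 0 < c ∧ P = Icc p (p + (c, c))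

/-- A diamond: a square whose sides have slope `±1`. -/
def IsDiamond (P : Set (ℝ × ℝ)) : Prop :=
  ∃ (p : ℝ × ℝ) (c : ℝ), 0 < c ∧
    P = convexHull ℝ {p + (c, 0), p - (c, 0), p + (0, c), p - (0, c)}

/-- The horizontal fundamental line of symmetry `H : y = 0`. -/
def lineH : Set (ℝ × ℝ) := {p | p.2 = 0}

/-- The vertical fundamental line of symmetry `V : x = −1`. -/
def lineV : Set (ℝ × ℝ) := {p | p.1 = -1}

/-- The fundamental line of symmetry `D_s`, of slope `−1` through `(−s,−s)`. -/
def lineD (s : ℝ) : Set (ℝ × ℝ) := {p | p.1 + p.2 = -2 * s}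

/-- The fundamental line of symmetry `E_s`: for `s ≤ 1/2` the line of slope `−1`
through `(−3s,−3s)`, for `s > 1/2` the line of slope `1` through `(−s,−s)`. -/
def lineE (s : ℝ) : Set (ℝ × ℝ) :=
  if s ≤ 1 / 2 then {p | p.1 + p.2 = -6 * s} else {p | p.2 = p.1}



/-! ### Iteration of relations -/

/-- `n`-fold iteration of a relation. -/
def relIter {α : Type*} (R : α → α → Prop) : ℕ → α → α → Prop
  | 0, p, q => p = q
  | n + 1, p, q => ∃ r, relIter R n p r ∧ R r q

/-- A point is immortal when it lies in a set each of whose points has a successor in the set. -/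
def Immortal {α : Type*} (R : α → α → Prop) (p : α) : Prop :=
  ∃ S : Set α, p ∈ S ∧ ∀ x ∈ S, ∃ y ∈ S, R x y

/-- Periodic with period at most `K`. -/
def PeriodicWithin {α : Type*} (R : α → α → Prop) (K : ℕ) (p : α) : Prop :=
  ∃ n, 0 < n ∧ n ≤ K ∧ relIter R n p p

section Relations

variable {α β : Type*} {R : α → α → Prop} {R' : β → β → Prop}

theorem relIter_one {p q : α} : relIter R 1 p q ↔ R p q := by
  simp [relIter]

theorem relIter_add {m n : ℕ} {p q : α} :
    relIter R (m + n) p q ↔ ∃ r, relIter R m p r ∧ relIter R n r q := by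
  induction n generalizing q with
  | zero => simp [relIter]
  | succ n ih =>
    constructor
    · rintro ⟨r, hr, hq⟩
      obtain ⟨x, hx, hxr⟩ := ih.1 hr
      exact ⟨x, hx, r, hxr, hq⟩
    · rintro ⟨x, hx, r, hxr, hq⟩
      exact ⟨r, ih.2 ⟨x, hx, hxr⟩, hq⟩

theorem relIter_head {n : ℕ} {p q : α} :
    relIter R (n + 1) p q ↔ ∃ r, R p r ∧ relIter R n r q := by
  rw [add_comm, relIter_add]
  simp [relIter_one]

theorem relIter_inj (hR : ∀ a b c, R a c → R b c → a = b) {n : ℕ} {a b c : α}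
    (ha : relIter R n a c) (hb : relIter R n b c) : a = b := by
  induction n generalizing c with
  | zero => exact ha.trans hb.symm
  | succ n ih =>
    obtain ⟨r, hr, h1⟩ := ha
    obtain ⟨r', hr', h2⟩ := hb
    obtain rfl := hR _ _ _ h1 h2
    exact ih hr hr'

theorem relIter_mul {n : ℕ} {p : α} (h : relIter R n p p) (m : ℕ) : relIter R (n * m) p p := by
  induction m with
  | zero => rfl
  | succ m ih => exact relIter_add.2 ⟨p, ih, h⟩

theorem Immortal.step {p : α} (h : Immortal R p) : ∃ q, R p q ∧ Immortal R q := by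
  obtain ⟨S, hp, hS⟩ := h
  obtain ⟨q, hq, hpq⟩ := hS p hp
  exact ⟨q, hpq, S, hq, hS⟩

theorem relIter_rotate {n : ℕ} {p q : α} (hpq : R p q) (h : relIter R n q p) :
    relIter R (n + 1) q q := ⟨p, h, hpq⟩

theorem PeriodicWithin.exists_succ {K : ℕ} {p : α} (h : PeriodicWithin R K p) :
    ∃ q, R p q ∧ PeriodicWithin R K q := by
  obtain ⟨n, hn, hK, h⟩ := h
  obtain ⟨m, rfl⟩ := Nat.exists_eq_succ_of_ne_zero hn.ne'
  obtain ⟨q, hpq, hq⟩ := relIter_head.1 h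
  exact ⟨q, hpq, m + 1, hn, hK, relIter_rotate hpq hq⟩

theorem PeriodicWithin.exists_pred {K : ℕ} {p : α} (h : PeriodicWithin R K p) :
    ∃ q, R q p := by
  obtain ⟨n, hn, hK, h⟩ := h
  obtain ⟨m, rfl⟩ := Nat.exists_eq_succ_of_ne_zero hn.ne'
  obtain ⟨q, -, hq⟩ := h
  exact ⟨q, hq⟩

theorem PeriodicWithin.immortal {K : ℕ} {p : α} (h : PeriodicWithin R K p) : Immortal R p :=
  ⟨{x | PeriodicWithin R K x}, h, fun _ hx => by
    obtain ⟨y, hxy, hy⟩ := hx.exists_succ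
    exact ⟨y, hy, hxy⟩⟩

theorem PeriodicWithin.of_relIter (hR : ∀ a b c, R a c → R b c → a = b) {K m : ℕ} {x y : α}
    (hxy : relIter R m x y) (h : PeriodicWithin R K y) : PeriodicWithin R K x := by
  obtain ⟨n, hn, hK, h⟩ := h
  obtain ⟨z, hxz, hzy⟩ := relIter_add.1 (add_comm m n ▸ relIter_add.2 ⟨y, hxy, h⟩)
  obtain rfl := relIter_inj hR hzy hxy
  exact ⟨n, hn, hK, hxz⟩

theorem PeriodicWithin.factorial {K : ℕ} {p : α} (h : PeriodicWithin R K p) :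
    relIter R K.factorial p p := by
  obtain ⟨n, hn, hK, h⟩ := h
  obtain ⟨m, hm⟩ := Nat.dvd_factorial hn hK
  exact hm ▸ relIter_mul h m

/-- If every step upstairs is a bounded number of steps downstairs, periodicity descends. -/
theorem PeriodicWithin.map {φ : α → β} {N : ℕ}
    (hstep : ∀ p q, R p q → ∃ m, 0 < m ∧ m ≤ N ∧ relIter R' m (φ p) (φ q)) {K : ℕ} {p : α}
    (h : PeriodicWithin R K p) : PeriodicWithin R' (K * N) (φ p) := by
  have key : ∀ n q, relIter R n p q → ∃ m, n ≤ m ∧ m ≤ n * N ∧ relIter R' m (φ p) (φ q) := by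
    intro n
    induction n with
    | zero => rintro q rfl; exact ⟨0, le_rfl, by simp, rfl⟩
    | succ n ih =>
      rintro q ⟨r, hr, hq⟩
      obtain ⟨m, h1, h2, h3⟩ := ih r hr
      obtain ⟨m', h1', h2', h3'⟩ := hstep r q hq
      exact ⟨m + m', by omega, by rw [add_mul]; omega, relIter_add.2 ⟨_, h3, h3'⟩⟩
  obtain ⟨n, hn, hK, h⟩ := h
  obtain ⟨m, h1, h2, h3⟩ := key n p h
  exact ⟨m, by omega, h2.trans (Nat.mul_le_mul_right N hK), h3⟩

theorem Immortal.of_map {φ : α → β} {Z : Set α}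
    (hstep : ∀ p ∈ Z, Immortal R' (φ p) → ∃ q ∈ Z, R p q ∧ Immortal R' (φ q)) {p : α}
    (hp : p ∈ Z) (h : Immortal R' (φ p)) : Immortal R p :=
  ⟨{x | x ∈ Z ∧ Immortal R' (φ x)}, ⟨hp, h⟩, fun x hx => by
    obtain ⟨y, hy, hxy, hi⟩ := hstep x hx.1 hx.2
    exact ⟨y, ⟨hy, hi⟩, hxy⟩⟩

end Relations

/-! ### Square tiles of a partial dynamical system in the plane -/

/-- The sup norm (`true`, unit ball a box) or the `ℓ¹` norm (`false`, unit ball a diamond). -/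
def sqNorm : Bool → ℝ × ℝ → ℝ
  | true, p => max |p.1| |p.2|
  | false, p => |p.1| + |p.2|

/-- Squared Euclidean distance. -/
def sqDist (p q : ℝ × ℝ) : ℝ := (p.1 - q.1) ^ 2 + (p.2 - q.2) ^ 2

/-- A square, contained in `Z`, of points of bounded period, no boundary point being immortal. -/
structure SquareTile (R : ℝ × ℝ → ℝ × ℝ → Prop) (Z : Set (ℝ × ℝ)) (i : Bool) (c : ℝ × ℝ)
    (r : ℝ) : Prop where
  pos : 0 < r
  sub : ∀ p, sqNorm i (p - c) ≤ r → p ∈ Z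
  per : ∃ K, ∀ p, sqNorm i (p - c) < r → PeriodicWithin R K p
  bdry : ∀ p, sqNorm i (p - c) = r → ¬ Immortal R p

/-- Some square tile contained in `Z` comes within squared distance `ε` of `p`. -/
def NearTile (R : ℝ × ℝ → ℝ × ℝ → Prop) (Z : Set (ℝ × ℝ)) (ε : ℝ) (p : ℝ × ℝ) : Prop :=
  ∃ i c r x, SquareTile R Z i c r ∧ sqNorm i (x - c) ≤ r ∧ sqDist x p ≤ ε

/-- A similarity of the plane which permutes the two families of squares. -/
structure SquareSim (φ : ℝ × ℝ → ℝ × ℝ) (μ : ℝ) : Prop where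
  surj : Function.Surjective φ
  norm : ∀ i, ∃ j, ∃ l : ℝ, 0 < l ∧ ∀ p q, sqNorm j (φ p - φ q) = l * sqNorm i (p - q)
  dist : ∀ p q, sqDist (φ p) (φ q) = μ * sqDist p q

/-- `φ` carries the tiles of `R` contained in `Z` to tiles of `R'` contained in `Z'`. -/
structure Carries (R R' : ℝ × ℝ → ℝ × ℝ → Prop) (φ : ℝ × ℝ → ℝ × ℝ) (Z Z' : Set (ℝ × ℝ)) :
    Prop where
  maps : ∀ p ∈ Z, φ p ∈ Z'
  per : ∀ K, ∃ K', ∀ p ∈ Z, PeriodicWithin R K p → PeriodicWithin R' K' (φ p)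
  imm : ∀ p ∈ Z, Immortal R' (φ p) → Immortal R p

theorem SquareTile.map {R R' : ℝ × ℝ → ℝ × ℝ → Prop} {φ : ℝ × ℝ → ℝ × ℝ} {Z Z' : Set (ℝ × ℝ)}
    (hc : Carries R R' φ Z Z') (hs : Function.Surjective φ) {i j : Bool} {l : ℝ} (hl : 0 < l)
    (hn : ∀ p q, sqNorm j (φ p - φ q) = l * sqNorm i (p - q)) {c : ℝ × ℝ} {r : ℝ}
    (h : SquareTile R Z i c r) : SquareTile R' Z' j (φ c) (l * r) where
  pos := mul_pos hl h.pos
  sub p hp := by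
    obtain ⟨q, rfl⟩ := hs p
    rw [hn] at hp
    exact hc.maps q (h.sub q (le_of_mul_le_mul_left hp hl))
  per := by
    obtain ⟨K, hK⟩ := h.per
    obtain ⟨K', hK'⟩ := hc.per K
    refine ⟨K', fun p hp => ?_⟩
    obtain ⟨q, rfl⟩ := hs p
    rw [hn] at hp
    have hq := lt_of_mul_lt_mul_left hp hl.le
    exact hK' q (h.sub q hq.le) (hK q hq)
  bdry p hp hi := by
    obtain ⟨q, rfl⟩ := hs p
    rw [hn] at hp
    have hq := mul_left_cancel₀ hl.ne' hp
    exact h.bdry q hq (hc.imm q (h.sub q hq.le) hi)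

theorem NearTile.map {R R' : ℝ × ℝ → ℝ × ℝ → Prop} {φ : ℝ × ℝ → ℝ × ℝ} {Z Z' : Set (ℝ × ℝ)}
    {μ : ℝ} (hφ : SquareSim φ μ) (hμ : 0 ≤ μ) (hc : Carries R R' φ Z Z') {ε : ℝ} {p : ℝ × ℝ}
    (h : NearTile R Z ε p) : NearTile R' Z' (μ * ε) (φ p) := by
  obtain ⟨i, c, r, x, ht, hx, hd⟩ := h
  obtain ⟨j, l, hl, hn⟩ := hφ.norm i
  refine ⟨j, φ c, l * r, φ x, ht.map hc hφ.surj hl hn, ?_, ?_⟩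
  · rw [hn]; exact mul_le_mul_of_nonneg_left hx hl.le
  · rw [hφ.dist]; exact mul_le_mul_of_nonneg_left hd hμ

theorem NearTile.mono {R : ℝ × ℝ → ℝ × ℝ → Prop} {Z Z' : Set (ℝ × ℝ)} {ε ε' : ℝ} {p : ℝ × ℝ}
    (h : NearTile R Z ε p) (hZ : Z ⊆ Z') (hε : ε ≤ ε') : NearTile R Z' ε' p := by
  obtain ⟨i, c, r, x, ht, hx, hd⟩ := h
  exact ⟨i, c, r, x, ⟨ht.pos, fun q hq => hZ (ht.sub q hq), ht.per, ht.bdry⟩, hx, hd.trans hε⟩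

theorem SquareTile.nearTile {R : ℝ × ℝ → ℝ × ℝ → Prop} {Z : Set (ℝ × ℝ)} {i : Bool}
    {c : ℝ × ℝ} {r : ℝ} (h : SquareTile R Z i c r) {p : ℝ × ℝ} (hp : sqNorm i (p - c) ≤ r)
    {ε : ℝ} (hε : 0 ≤ ε) : NearTile R Z ε p :=
  ⟨i, c, r, p, h, hp, by simpa [sqDist] using hε⟩

/-! ### The map on the trapezoid and the map on the triangle -/

/-- The trapezoid, a normalized form of the left half of `X_s`. -/
def trap (t : ℝ) : Set (ℝ × ℝ) := {p | 0 ≤ p.1 ∧ 0 ≤ p.2 ∧ p.2 ≤ 1 ∧ p.1 + p.2 ≤ 1 + t}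

/-- A normalized form of `f′` on the left half of `X_s`. -/
def TrapRel (t : ℝ) (p q : ℝ × ℝ) : Prop :=
  (0 < p.1 ∧ 0 < p.2 ∧ p.2 < 1 ∧ p.1 - p.2 < t ∧ p.1 + p.2 < 1 + t ∧ q = (1 - p.2, p.1)) ∨
  (0 < p.2 ∧ p.2 + t < p.1 ∧ p.1 < 2 * t ∧ q = (1 + p.2, 2 * t - p.1)) ∨
  (0 < p.2 ∧ p.2 + t < p.1 ∧ 2 * t < p.1 ∧ p.1 + p.2 < 1 + t ∧ q = (p.2, 1 + 2 * t - p.1))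

/-- The triangle on which the first return map of `TrapRel` is easy to describe. -/
def tri (κ : ℝ) : Set (ℝ × ℝ) := {p | 0 ≤ p.1 ∧ p.1 ≤ p.2 ∧ p.2 ≤ κ}

/-- A first return map of `TrapRel`, in the coordinates given by `triToTrap`. -/
def TriRel (κ : ℝ) (p q : ℝ × ℝ) : Prop :=
  (1 < p.1 ∧ p.1 < p.2 ∧ p.2 < κ ∧ q = (p.1 - 1, p.2 - 1)) ∨
  (0 < p.1 ∧ p.1 < 1 ∧ p.1 < p.2 ∧ p.2 < κ ∧ 1 < p.2 + p.1 ∧ q = (κ - p.2, κ - 1 + p.1)) ∨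
  (0 < p.1 ∧ p.1 < p.2 ∧ p.2 + p.1 < 1 ∧ q = (κ - 1 + p.2, κ - p.1))

theorem TrapRel.inj {t : ℝ} (a b c : ℝ × ℝ) (ha : TrapRel t a c)
    (hb : TrapRel t b c) : a = b := by
  obtain ⟨a1, a2⟩ := a
  obtain ⟨b1, b2⟩ := b
  obtain ⟨c1, c2⟩ := c
  simp only [TrapRel, Prod.mk.injEq] at ha hb ⊢
  rcases ha with ha | ha | ha <;> rcases hb with hb | hb | hb <;> casesm* _ ∧ _ <;>
    constructor <;> linarith

theorem TriRel.inj {κ : ℝ} (a b c : ℝ × ℝ) (ha : TriRel κ a c)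
    (hb : TriRel κ b c) : a = b := by
  obtain ⟨a1, a2⟩ := a
  obtain ⟨b1, b2⟩ := b
  obtain ⟨c1, c2⟩ := c
  simp only [TriRel, Prod.mk.injEq] at ha hb ⊢
  rcases ha with ha | ha | ha <;> rcases hb with hb | hb | hb <;> casesm* _ ∧ _ <;>
    constructor <;> linarith

theorem TrapRel.image_ne {t : ℝ} (h1 : t < 1 / 2) {p q : ℝ × ℝ}
    (h : TrapRel t p q) : q.1 ≠ 1 ∧ q.1 - q.2 ≠ -t := by
  rcases h with ⟨_, _, _, _, _, rfl⟩ | ⟨_, _, _, rfl⟩ | ⟨_, _, _, _, rfl⟩ <;>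
    constructor <;> intro h <;> simp only at h <;> linarith

/-- The coordinate change from the triangle to the trapezoid. -/
def triToTrap (t : ℝ) (p : ℝ × ℝ) : ℝ × ℝ := (t * (1 + p.2 + p.1), t * (p.2 - p.1))

theorem TriRel.trapIter {t κ : ℝ} (h0 : 0 < t) (h1 : t < 1 / 2) (hκ : 2 * (t * κ) = 1)
    {p q : ℝ × ℝ} (h : TriRel κ p q) :
    ∃ m, 0 < m ∧ m ≤ 3 ∧ relIter (TrapRel t) m (triToTrap t p) (triToTrap t q) := by
  obtain ⟨E, f⟩ := p
  have hf : ∀ x, f < x → t * f < t * x := fun x hx => mul_lt_mul_of_pos_left hx h0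
  have hE : ∀ x, x < E → t * x < t * E := fun x hx => mul_lt_mul_of_pos_left hx h0
  have hE' : ∀ x, E < x → t * E < t * x := fun x hx => mul_lt_mul_of_pos_left hx h0
  have hs : ∀ x, x < f + E → t * x < t * (f + E) := fun x hx => mul_lt_mul_of_pos_left hx h0
  rcases h with ⟨a1, a2, a3, rfl⟩ | ⟨a1, a2, a3, a4, a5, rfl⟩ | ⟨a1, a2, a3, rfl⟩
  · simp only at a1 a2 a3
    have := hf _ a3; have := hE _ a1; have := hE' _ a2; have := hs 1 (by linarith)
    simp only [triToTrap]
    refine ⟨2, by norm_num, by norm_num, _, relIter_one.2 (Or.inr (Or.inr ⟨?_, ?_, ?_, ?_, rfl⟩)),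
      Or.inl ⟨?_, ?_, ?_, ?_, ?_, ?_⟩⟩ <;> simp only [Prod.mk.injEq] <;>
      first | nlinarith | (constructor <;> ring)
  · simp only at a1 a2 a3 a4 a5
    have := hf _ a4; have := hE _ a1; have := hE' _ a2; have := hE' _ a3
    have := hs 1 (by linarith)
    simp only [triToTrap]
    refine ⟨3, by norm_num, by norm_num, _,
      ⟨_, relIter_one.2 (Or.inr (Or.inr ⟨?_, ?_, ?_, ?_, rfl⟩)), Or.inl ⟨?_, ?_, ?_, ?_, ?_, rfl⟩⟩,
      Or.inl ⟨?_, ?_, ?_, ?_, ?_, ?_⟩⟩ <;> simp only [Prod.mk.injEq] <;>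
      first | nlinarith | (constructor <;> nlinarith)
  · simp only at a1 a2 a3
    have := hE _ a1; have := hE' _ a2
    have : t * (f + E) < t * 1 := mul_lt_mul_of_pos_left a3 h0
    simp only [triToTrap]
    refine ⟨1, by norm_num, by norm_num, _, rfl, Or.inr (Or.inl ⟨?_, ?_, ?_, ?_⟩)⟩ <;>
      simp only [Prod.mk.injEq] <;> first | nlinarith | (constructor <;> nlinarith)

theorem TriRel.exists_of_immortal_trap {t κ : ℝ} (h0 : 0 < t) (h1 : t < 1 / 2)
    (hκ : 2 * (t * κ) = 1) {p : ℝ × ℝ} (hp : p ∈ tri κ)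
    (h : Immortal (TrapRel t) (triToTrap t p)) :
    ∃ q ∈ tri κ, TriRel κ p q ∧ Immortal (TrapRel t) (triToTrap t q) := by
  obtain ⟨E, f⟩ := p
  obtain ⟨hE, hEf, hfκ⟩ := hp
  simp only at hE hEf hfκ
  have e0 : 0 ≤ t * E := mul_nonneg h0.le hE
  have e1 : t * E ≤ t * f := mul_le_mul_of_nonneg_left hEf h0.le
  have e2 : t * f ≤ t * κ := mul_le_mul_of_nonneg_left hfκ h0.le
  have hκ1 : 1 < κ := by nlinarith
  have inv : ∀ {x y : ℝ}, t * x < t * y → x < y := fun h => lt_of_mul_lt_mul_left h h0.le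
  simp only [triToTrap] at h
  obtain ⟨q, hq, hqi⟩ := h.step
  rcases hq with ⟨a1, a2, a3, a4, a5, rfl⟩ | ⟨a1, a2, a3, rfl⟩ | ⟨a1, a2, a3, a4, rfl⟩
  · simp only at a4; nlinarith
  · simp only at a1 a2 a3
    have c1 : E < f := inv (by nlinarith)
    have c2 : 0 < E := inv (by nlinarith)
    have c3 : f + E < 1 := inv (by nlinarith)
    refine ⟨(κ - 1 + f, κ - E), ⟨by simp only; linarith, by simp only; linarith,
      by simp only; linarith⟩, Or.inr (Or.inr ⟨c2, c1, c3, rfl⟩), ?_⟩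
    convert hqi using 1
    simp only [triToTrap, Prod.mk.injEq]
    constructor <;> nlinarith
  · simp only at a1 a2 a3 a4
    have c1 : E < f := inv (by nlinarith)
    have c2 : 0 < E := inv (by nlinarith)
    have c3 : 1 < f + E := inv (by nlinarith)
    have c4 : f < κ := inv (by nlinarith)
    obtain ⟨q, hq, hqi⟩ := hqi.step
    rcases hq with ⟨b1, b2, b3, b4, b5, rfl⟩ | ⟨b1, b2, b3, rfl⟩ | ⟨b1, b2, b3, b4, rfl⟩
    · simp only at b1 b2 b3 b4 b5 hqi
      rcases lt_or_ge 1 E with c5 | c5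
      · refine ⟨(E - 1, f - 1), ⟨by simp only; linarith, by simp only; linarith,
          by simp only; linarith⟩, Or.inl ⟨c5, c1, c4, rfl⟩, ?_⟩
        convert hqi using 1
        simp only [triToTrap, Prod.mk.injEq]
        constructor <;> ring
      have e3 : t * E ≤ t * 1 := mul_le_mul_of_nonneg_left c5 h0.le
      obtain ⟨q, hq, hqi⟩ := hqi.step
      rcases hq with ⟨d1, d2, d3, d4, d5, rfl⟩ | ⟨d1, d2, d3, rfl⟩ | ⟨d1, d2, d3, d4, rfl⟩
      · simp only at d1 d2 d3 d4 d5 hqi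
        have c6 : E < 1 := inv (by nlinarith)
        refine ⟨(κ - f, κ - 1 + E), ⟨by simp only; linarith, by simp only; linarith,
          by simp only; linarith⟩, Or.inr (Or.inl ⟨c2, c6, c1, c4, c3, rfl⟩), ?_⟩
        convert hqi using 1
        simp only [triToTrap, Prod.mk.injEq]
        constructor <;> nlinarith
      · simp only at d2; nlinarith
      · simp only at d2; nlinarith
    · simp only at b2; nlinarith
    · simp only at b2; nlinarith

theorem Carries.restrict {R R' : ℝ × ℝ → ℝ × ℝ → Prop} {φ : ℝ × ℝ → ℝ × ℝ}
    {Z Z' Z₀ Z₁ : Set (ℝ × ℝ)} (h : Carries R R' φ Z Z') (hZ : Z₀ ⊆ Z)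
    (hm : ∀ p ∈ Z₀, φ p ∈ Z₁) : Carries R R' φ Z₀ Z₁ where
  maps := hm
  per K := (h.per K).imp fun _ h' p hp => h' p (hZ hp)
  imm p hp := h.imm p (hZ hp)

theorem carries_triToTrap {t κ : ℝ} (h0 : 0 < t) (h1 : t < 1 / 2) (hκ : 2 * (t * κ) = 1) :
    Carries (TriRel κ) (TrapRel t) (triToTrap t) (tri κ) univ where
  maps _ _ := mem_univ _
  per K := ⟨K * 3, fun _ _ h => h.map fun _ _ hpq => hpq.trapIter h0 h1 hκ⟩
  imm _ hp h := Immortal.of_map (Z := tri κ)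
    (fun _ hx hi => TriRel.exists_of_immortal_trap h0 h1 hκ hx hi) hp h

/-- Rotation by `-π/2` about `(1/2, 1/2)`, an inverse branch of `TrapRel`. -/
def rotBack (p : ℝ × ℝ) : ℝ × ℝ := (p.2, 1 - p.1)

/-- The part of the trapezoid on which `rotBack` is an inverse branch of `TrapRel`. -/
def trapLow (t : ℝ) : Set (ℝ × ℝ) := {p ∈ trap t | -t ≤ p.1 - p.2 ∧ p.1 ≤ 1}

/-- The top left corner of the trapezoid. -/
def trapTop (t : ℝ) : Set (ℝ × ℝ) := {p ∈ trap t | p.1 - p.2 ≤ -t}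

/-- The tip of the trapezoid. -/
def trapTip (t : ℝ) : Set (ℝ × ℝ) := {p ∈ trap t | 1 ≤ p.1}

theorem carries_rotBack {t : ℝ} (h0 : 0 < t) (h1 : t < 1 / 2) :
    Carries (TrapRel t) (TrapRel t) rotBack (trapLow t) univ where
  maps _ _ := mem_univ _
  per K := by
    refine ⟨K, fun p hp h => h.of_relIter (TrapRel.inj) (m := 1) (relIter_one.2 ?_)⟩
    obtain ⟨u, η⟩ := p
    obtain ⟨⟨-, -, -, a4⟩, a5, a6⟩ := hp
    obtain ⟨q, hq⟩ := h.exists_pred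
    obtain ⟨n1, n2⟩ := hq.image_ne h1
    obtain ⟨q', hq', -⟩ := h.exists_succ
    simp only at a4 a5 a6 n1 n2
    have n1' := lt_of_le_of_ne a6 n1
    have n2' := lt_of_le_of_ne a5 n2.symm
    rcases hq' with ⟨b1, b2, b3, b4, b5, rfl⟩ | ⟨b1, b2, b3, rfl⟩ | ⟨b1, b2, b3, b4, rfl⟩ <;>
    · simp only at *
      refine Or.inl ⟨?_, ?_, ?_, ?_, ?_, ?_⟩ <;> simp only [rotBack, sub_sub_cancel] <;> linarith
  imm p hp h := by
    obtain ⟨u, η⟩ := p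
    obtain ⟨⟨-, -, -, a4⟩, -, -⟩ := hp
    simp only at a4
    obtain ⟨q, hq, hqi⟩ := h.step
    rcases hq with ⟨-, -, -, -, -, rfl⟩ | ⟨b1, b2, b3, rfl⟩ | ⟨b1, b2, b3, b4, rfl⟩
    · simpa [rotBack] using hqi
    · simp only [rotBack] at b2; linarith
    · simp only [rotBack] at b2; linarith

theorem abs_cases_four {a b c : ℝ} (h : |a| + |b| = c) :
    a + b = c ∨ a - b = c ∨ -a + b = c ∨ -a - b = c := by
  rcases abs_cases a with ⟨h1, -⟩ | ⟨h1, -⟩ <;> rcases abs_cases b with ⟨h2, -⟩ | ⟨h2, -⟩ <;>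
    rw [h1, h2] at h <;> simp [← h, sub_eq_add_neg]

theorem abs_add_abs_le_iff {a b c : ℝ} :
    |a| + |b| ≤ c ↔ a + b ≤ c ∧ a - b ≤ c ∧ -a + b ≤ c ∧ -a - b ≤ c := by
  constructor
  · intro h
    refine ⟨?_, ?_, ?_, ?_⟩ <;>
      linarith [le_abs_self a, neg_abs_le a, le_abs_self b, neg_abs_le b]
  · rintro ⟨h1, h2, h3, h4⟩
    rcases abs_cases a with ⟨h5, -⟩ | ⟨h5, -⟩ <;> rcases abs_cases b with ⟨h6, -⟩ | ⟨h6, -⟩ <;>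
      rw [h5, h6] <;> linarith

theorem abs_add_abs_lt_iff {a b c : ℝ} :
    |a| + |b| < c ↔ a + b < c ∧ a - b < c ∧ -a + b < c ∧ -a - b < c := by
  constructor
  · intro h
    refine ⟨?_, ?_, ?_, ?_⟩ <;>
      linarith [le_abs_self a, neg_abs_le a, le_abs_self b, neg_abs_le b]
  · rintro ⟨h1, h2, h3, h4⟩
    rcases abs_cases a with ⟨h5, -⟩ | ⟨h5, -⟩ <;> rcases abs_cases b with ⟨h6, -⟩ | ⟨h6, -⟩ <;>
      rw [h5, h6] <;> linarith

/-- The diamond fixed by the rotation branch of `TrapRel`. -/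
theorem squareTile_trapLow {t : ℝ} (h0 : 0 < t) (h1 : t < 1 / 2) :
    SquareTile (TrapRel t) (trapLow t) false (1 / 2, 1 / 2) t where
  pos := h0
  sub p hp := by
    obtain ⟨u, η⟩ := p
    simp only [sqNorm, Prod.mk_sub_mk, abs_add_abs_le_iff] at hp
    obtain ⟨h1, h2, h3, h4⟩ := hp
    refine ⟨⟨?_, ?_, ?_, ?_⟩, ?_, ?_⟩ <;> simp only <;> linarith
  per := by
    refine ⟨4, fun p hp => ⟨4, by norm_num, le_rfl, ?_⟩⟩
    obtain ⟨u, η⟩ := p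
    simp only [sqNorm, Prod.mk_sub_mk, abs_add_abs_lt_iff] at hp
    obtain ⟨h1, h2, h3, h4⟩ := hp
    refine ⟨_, ⟨_, ⟨_, ⟨_, rfl, Or.inl ⟨?_, ?_, ?_, ?_, ?_, rfl⟩⟩,
      Or.inl ⟨?_, ?_, ?_, ?_, ?_, rfl⟩⟩, Or.inl ⟨?_, ?_, ?_, ?_, ?_, rfl⟩⟩,
      Or.inl ⟨?_, ?_, ?_, ?_, ?_, ?_⟩⟩ <;> simp only [Prod.mk.injEq] <;>
      first | linarith | (constructor <;> ring)
  bdry := by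
    have dead : ∀ u η : ℝ, u - η = t → ¬ Immortal (TrapRel t) (u, η) := by
      intro u η h hi
      obtain ⟨q, hq, -⟩ := hi.step
      rcases hq with ⟨-, -, -, b4, -, -⟩ | ⟨-, b2, -, -⟩ | ⟨-, b2, -, -, -⟩ <;>
        simp only at * <;> linarith
    have step : ∀ u η : ℝ, u - η ≤ t → Immortal (TrapRel t) (u, η) →
        Immortal (TrapRel t) (1 - η, u) := by
      intro u η h hi
      obtain ⟨q, hq, hqi⟩ := hi.step
      rcases hq with ⟨-, -, -, -, -, rfl⟩ | ⟨-, b2, -, -⟩ | ⟨-, b2, -, -, -⟩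
      · exact hqi
      all_goals simp only at b2; linarith
    rintro ⟨u, η⟩ hp hi
    simp only [sqNorm, Prod.mk_sub_mk] at hp
    obtain ⟨c1, c2, c3, c4⟩ := abs_add_abs_le_iff.1 hp.le
    rcases abs_cases_four hp with h | h | h | h
    · obtain ⟨q, hq, -⟩ := hi.step
      rcases hq with ⟨-, -, -, -, b, -⟩ | ⟨b1, b2, b3, -⟩ | ⟨-, -, -, b, -⟩ <;>
        simp only at * <;> linarith
    · exact dead u η (by linarith) hi
    · exact dead (1 - u) (1 - η) (by linarith)
        (step _ _ (by linarith) (step u η (by linarith) hi))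
    · exact dead (1 - η) u (by linarith) (step u η (by linarith) hi)

/-! ### Renormalization: the map on the trapezoid inside the map on the triangle -/

/-- The copies of the trapezoid inside the triangle. -/
def trapToTri (t : ℝ) (j : ℕ) (p : ℝ × ℝ) : ℝ × ℝ := (p.2 + j, 1 + t - p.1 + j)

theorem TriRel.down {κ E f : ℝ} (hE : 0 < E) (hf : E < f) (m : ℕ) (hm : f + m < κ) :
    relIter (TriRel κ) m (E + m, f + m) (E, f) := by
  induction m with
  | zero => simp [relIter]
  | succ m ih =>
    push_cast at hm ⊢
    have hm0 : (0 : ℝ) ≤ m := m.cast_nonneg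
    refine relIter_head.2 ⟨_, Or.inl ⟨?_, ?_, ?_, rfl⟩, ?_⟩
    · simp only; linarith
    · simp only; linarith
    · simp only; linarith
    · have := ih (by linarith)
      convert this using 2 <;> ring

theorem immortal_tri_down {κ E f : ℝ} (hE : 0 ≤ E) (m : ℕ)
    (h : Immortal (TriRel κ) (E + m, f + m)) : Immortal (TriRel κ) (E, f) := by
  induction m with
  | zero => simpa using h
  | succ m ih =>
    apply ih
    have hm0 : (0 : ℝ) ≤ m := m.cast_nonneg
    obtain ⟨q, hq, hqi⟩ := h.step
    push_cast at hq
    rcases hq with ⟨-, -, -, rfl⟩ | ⟨-, b, -⟩ | ⟨-, b1, b2, -⟩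
    · convert hqi using 2 <;> ring
    · simp only at b; linarith
    · simp only at b1 b2; linarith

theorem Immortal.tri_pos {κ : ℝ} {p : ℝ × ℝ} (h : Immortal (TriRel κ) p) : 0 < p.1 := by
  obtain ⟨q, hq, -⟩ := h.step
  rcases hq with ⟨h, -⟩ | ⟨h, -⟩ | ⟨h, -⟩ <;> linarith

theorem TrapRel.triIter {t κ : ℝ} {k : ℕ} (h0 : 0 < t) (h1 : t < 1 / 2) (hk : 1 ≤ k)
    (hκ : κ = k + t) {p q : ℝ × ℝ} (h : TrapRel t p q) :
    ∃ m, 0 < m ∧ m ≤ k + 1 ∧ relIter (TriRel κ) m (trapToTri t 0 p) (trapToTri t 0 q) := by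
  subst hκ
  obtain ⟨k, rfl⟩ : ∃ k', k = k' + 1 := ⟨k - 1, by omega⟩
  obtain ⟨u, η⟩ := p
  have hk0 : (0 : ℝ) ≤ k := k.cast_nonneg
  simp only [trapToTri, Nat.cast_zero, add_zero]
  rcases h with ⟨a1, a2, a3, a4, a5, rfl⟩ | ⟨a1, a2, a3, rfl⟩ | ⟨a1, a2, a3, a4, rfl⟩ <;>
    simp only at *
  · refine ⟨k + 1, by omega, by omega, relIter_head.2 ⟨_, Or.inr (Or.inl ⟨?_, ?_, ?_, ?_, ?_, rfl⟩),
      ?_⟩⟩ <;> push_cast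
    iterate 5 linarith
    · have := TriRel.down (κ := k + 1 + t) a1 (f := t + η) (by linarith) k (by linarith)
      convert this using 2 <;> ring
  · refine ⟨k + 1 + 1, by omega, by omega, relIter_head.2 ⟨_, Or.inr (Or.inr ⟨?_, ?_, ?_, rfl⟩),
      ?_⟩⟩ <;> push_cast
    iterate 3 linarith
    · have := TriRel.down (κ := k + 1 + t) (E := 2 * t - u) (f := t - η) (by linarith)
        (by linarith) (k + 1) (by push_cast; linarith)
      push_cast at this
      convert this using 2 <;> ring
  · refine ⟨k + 1, by omega, by omega, relIter_head.2 ⟨_, Or.inr (Or.inr ⟨?_, ?_, ?_, rfl⟩),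
      ?_⟩⟩ <;> push_cast
    iterate 3 linarith
    · have := TriRel.down (κ := k + 1 + t) (E := 1 + 2 * t - u) (f := 1 + t - η) (by linarith)
        (by linarith) k (by linarith)
      convert this using 2 <;> ring

theorem TrapRel.exists_of_immortal_tri {t κ : ℝ} {k : ℕ} (h0 : 0 < t) (h1 : t < 1 / 2)
    (hk : 1 ≤ k) (hκ : κ = k + t) {p : ℝ × ℝ} (hp : p ∈ trap t)
    (h : Immortal (TriRel κ) (trapToTri t 0 p)) :
    ∃ q ∈ trap t, TrapRel t p q ∧ Immortal (TriRel κ) (trapToTri t 0 q) := by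
  subst hκ
  obtain ⟨k, rfl⟩ : ∃ k', k = k' + 1 := ⟨k - 1, by omega⟩
  obtain ⟨u, η⟩ := p
  have hk0 : (0 : ℝ) ≤ k := k.cast_nonneg
  obtain ⟨p1, p2, p3, p4⟩ := hp
  simp only [trapToTri, Nat.cast_zero, add_zero] at *
  obtain ⟨q, hq, hqi⟩ := h.step
  push_cast at hq hqi
  rcases hq with ⟨a1, -⟩ | ⟨a1, a2, a3, a4, a5, rfl⟩ | ⟨a1, a2, a3, rfl⟩ <;> simp only at *
  · linarith
  · have hi : Immortal (TriRel (k + 1 + t)) (u, t + η) := by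
      refine immortal_tri_down p1 k ?_
      convert hqi using 2 <;> ring
    have hu := hi.tri_pos
    simp only at hu
    refine ⟨(1 - η, u), ⟨?_, ?_, ?_, ?_⟩, Or.inl ⟨?_, ?_, ?_, ?_, ?_, rfl⟩, ?_⟩ <;> simp only
    iterate 9 linarith
    push_cast
    convert hi using 2
    ring
  · rcases lt_trichotomy u (2 * t) with hu | hu | hu
    · have hi : Immortal (TriRel (k + 1 + t)) (2 * t - u, t - η) := by
        refine immortal_tri_down (by linarith) (k + 1) ?_
        push_cast
        convert hqi using 2 <;> ring
      refine ⟨(1 + η, 2 * t - u), ⟨?_, ?_, ?_, ?_⟩, Or.inr (Or.inl ⟨?_, ?_, ?_, rfl⟩), ?_⟩ <;>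
        simp only
      iterate 7 linarith
      push_cast
      convert hi using 2
      ring
    · have hi : Immortal (TriRel (k + 1 + t)) (0, t - η) := by
        refine immortal_tri_down le_rfl (k + 1) ?_
        push_cast
        convert hqi using 2
        · rw [hu]; ring
        · ring
      exact absurd hi.tri_pos (lt_irrefl _)
    · have hi : Immortal (TriRel (k + 1 + t)) (1 + 2 * t - u, 1 + t - η) := by
        refine immortal_tri_down (by linarith) k ?_
        convert hqi using 2 <;> ring
      refine ⟨(η, 1 + 2 * t - u), ⟨?_, ?_, ?_, ?_⟩, Or.inr (Or.inr ⟨?_, ?_, ?_, ?_, rfl⟩), ?_⟩ <;>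
        simp only
      iterate 8 linarith
      push_cast
      exact hi

theorem carries_trapToTri {t κ : ℝ} {k : ℕ} (h0 : 0 < t) (h1 : t < 1 / 2) (hk : 1 ≤ k)
    (hκ : κ = k + t) (j : ℕ) (hj : j ≤ k) :
    Carries (TrapRel t) (TriRel κ) (trapToTri t j) {p ∈ trap t | j = k → 1 ≤ p.1} univ where
  maps _ _ := mem_univ _
  per K := by
    refine ⟨K * (k + 1), fun p hp h => ?_⟩
    have hκ1 : 1 ≤ κ := by
      have : (1 : ℝ) ≤ k := by exact_mod_cast hk
      linarith
    refine (h.map fun _ _ hpq => hpq.triIter h0 h1 hk hκ).of_relIter TriRel.inj (m := j) ?_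
    obtain ⟨q, hq⟩ := h.exists_pred
    obtain ⟨n1, -⟩ := hq.image_ne h1
    obtain ⟨q', hq', -⟩ := h.exists_succ
    obtain ⟨u, η⟩ := p
    have c : 0 < u ∧ 0 < η ∧ u + η < 1 + t := by
      rcases hq' with ⟨b1, b2, b3, b4, b5, -⟩ | ⟨b1, b2, b3, -⟩ | ⟨b1, b2, b3, b4, -⟩ <;>
        simp only at * <;> refine ⟨?_, ?_, ?_⟩ <;> linarith
    obtain ⟨c1, c2, c3⟩ := c
    have := TriRel.down (κ := κ) c2 (f := 1 + t - u) (by linarith) j (by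
      rcases hj.lt_or_eq with hj | rfl
      · have : (j : ℝ) + 1 ≤ k := by exact_mod_cast hj
        linarith
      · have := lt_of_le_of_ne (hp.2 rfl) n1.symm
        simp only at this
        linarith)
    simpa [trapToTri] using this
  imm p hp h := by
    refine Immortal.of_map (Z := trap t) (φ := trapToTri t 0)
      (fun _ hx hi => TrapRel.exists_of_immortal_tri h0 h1 hk hκ hx hi) hp.1 ?_
    simp only [trapToTri] at h ⊢
    simpa using immortal_tri_down hp.1.2.1 j h

theorem TriRel.cellIter {t κ x y : ℝ} (h0 : 0 < t) {j d e : ℕ} (hκ : κ = j + d + e + 2 + t)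
    (x0 : 0 < x) (x1 : x < 1) (y0 : 0 < y) (y1 : y < 1) :
    relIter (TriRel κ) (j + 1) (x + j, y + d + 1 + t + j)
      (1 - y + (j + e : ℕ), x + d + 1 + t + (j + e : ℕ)) := by
  subst hκ
  have hj : (0 : ℝ) ≤ j := j.cast_nonneg
  have hd : (0 : ℝ) ≤ d := d.cast_nonneg
  have he : (0 : ℝ) ≤ e := e.cast_nonneg
  refine ⟨_, TriRel.down x0 (by linarith) j (by linarith), Or.inr (Or.inl ⟨?_, ?_, ?_, ?_, ?_, ?_⟩)⟩
  · exact x0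
  · exact x1
  · simp only; linarith
  · simp only; linarith
  · simp only; linarith
  · push_cast
    simp only [Prod.mk.injEq]
    constructor <;> ring

theorem immortal_tri_cell {t κ x y : ℝ} (h0 : 0 < t) {j d e : ℕ} (hκ : κ = j + d + e + 2 + t)
    (x0 : 0 ≤ x) (x1 : x ≤ 1) (y0 : 0 ≤ y)
    (h : Immortal (TriRel κ) (x + j, y + d + 1 + t + j)) :
    0 < x ∧ x < 1 ∧
      Immortal (TriRel κ) (1 - y + (j + e : ℕ), x + d + 1 + t + (j + e : ℕ)) := by
  have hd : (0 : ℝ) ≤ d := d.cast_nonneg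
  obtain ⟨q, hq, hqi⟩ := (immortal_tri_down x0 j h).step
  rcases hq with ⟨a1, -⟩ | ⟨a1, a2, a3, a4, a5, rfl⟩ | ⟨a1, a2, a3, rfl⟩ <;> simp only at *
  · linarith
  · refine ⟨a1, a2, ?_⟩
    convert hqi using 2 <;> push_cast <;> rw [hκ] <;> ring
  · linarith

theorem squareTile_cell {t κ : ℝ} (h0 : 0 < t) {j d e : ℕ} (hκ : κ = j + d + e + 2 + t)
    {Z : Set (ℝ × ℝ)}
    (hZ : ∀ x ∈ Icc (0 : ℝ) 1, ∀ y ∈ Icc (0 : ℝ) 1, (x + j, y + d + 1 + t + j) ∈ Z) :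
    SquareTile (TriRel κ) Z true (1 / 2 + j, 1 / 2 + d + 1 + t + j) (1 / 2) where
  pos := by norm_num
  sub p hp := by
    simp only [sqNorm, Prod.fst_sub, Prod.snd_sub, sup_le_iff, abs_le] at hp
    convert hZ (p.1 - j) ⟨?_, ?_⟩ (p.2 - (d + 1 + t + j)) ⟨?_, ?_⟩ using 2
    all_goals linarith
  per := by
    have hκ1 : 1 ≤ κ := by
      rw [hκ]
      have : (0 : ℝ) ≤ j + d + e := by positivity
      linarith
    refine ⟨4 * (j + e + 1), fun p hp => ?_⟩
    obtain ⟨x, y, rfl⟩ : ∃ x y, p = (x + (j : ℝ), y + d + 1 + t + j) :=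
      ⟨p.1 - j, p.2 - (d + 1 + t + j), by ext <;> simp only <;> ring⟩
    simp only [sqNorm, Prod.fst_sub, Prod.snd_sub, sup_lt_iff, abs_lt] at hp
    obtain ⟨⟨h1, h2⟩, h3, h4⟩ := hp
    have x0 : 0 < x := by linarith
    have x1 : x < 1 := by linarith
    have y0 : 0 < y := by linarith
    have y1 : y < 1 := by linarith
    refine PeriodicWithin.of_relIter TriRel.inj (TriRel.cellIter h0 hκ x0 x1 y0 y1) ?_
    have hκ' : κ = (j + e : ℕ) + d + (0 : ℕ) + 2 + t := by rw [hκ]; push_cast; ring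
    have key : ∀ x y : ℝ, 0 < x → x < 1 → 0 < y → y < 1 →
        relIter (TriRel κ) (j + e + 1) (x + (j + e : ℕ), y + d + 1 + t + (j + e : ℕ))
          (1 - y + (j + e : ℕ), x + d + 1 + t + (j + e : ℕ)) := fun x y a1 a2 a3 a4 =>
      TriRel.cellIter h0 hκ' a1 a2 a3 a4
    refine ⟨(j + e + 1) + (j + e + 1) + (j + e + 1) + (j + e + 1), by omega, by omega, ?_⟩
    refine relIter_add.2 ⟨_, relIter_add.2 ⟨_, relIter_add.2
      ⟨_, key _ _ ?_ ?_ ?_ ?_, key _ _ ?_ ?_ ?_ ?_⟩, key _ _ ?_ ?_ ?_ ?_⟩, ?_⟩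
    any_goals linarith
    have := key (1 - (1 - x)) (1 - (1 - y)) (by linarith) (by linarith) (by linarith)
      (by linarith)
    convert this using 3 <;> ring
  bdry p hp hi := by
    obtain ⟨x, y, rfl⟩ : ∃ x y, p = (x + (j : ℝ), y + d + 1 + t + j) :=
      ⟨p.1 - j, p.2 - (d + 1 + t + j), by ext <;> simp only <;> ring⟩
    have hp' := hp.le
    simp only [sqNorm, Prod.fst_sub, Prod.snd_sub, sup_le_iff, abs_le] at hp'
    obtain ⟨⟨h1, h2⟩, h3, h4⟩ := hp'
    obtain ⟨x0, x1, hi⟩ := immortal_tri_cell h0 hκ (by linarith) (by linarith) (by linarith) hi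
    have hκ' : κ = (j + e : ℕ) + d + (0 : ℕ) + 2 + t := by rw [hκ]; push_cast; ring
    obtain ⟨y0, y1, -⟩ := immortal_tri_cell h0 hκ' (by linarith) (by linarith) x0.le hi
    refine hp.not_lt ?_
    simp only [sqNorm, Prod.fst_sub, Prod.snd_sub, sup_lt_iff, abs_lt]
    refine ⟨⟨?_, ?_⟩, ?_, ?_⟩ <;> linarith

/-! ### Density of the square tiles -/

/-- Every point of `Z` is within squared distance `ε` of a tile contained in `Z`. -/
def TileDense (R : ℝ × ℝ → ℝ × ℝ → Prop) (Z : Set (ℝ × ℝ)) (ε : ℝ) : Prop :=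
  ∀ p ∈ Z, NearTile R Z ε p

/-- `Z` contains a tile. -/
def HasTile (R : ℝ × ℝ → ℝ × ℝ → Prop) (Z : Set (ℝ × ℝ)) : Prop :=
  ∃ i c r, SquareTile R Z i c r

/-- The top corner of the triangle. -/
def triTip (κ : ℝ) : Set (ℝ × ℝ) := {p ∈ tri κ | 2 * κ - 1 ≤ p.1 + p.2}

/-- The part of the triangle adjacent to the top edge. -/
def triSide (κ : ℝ) : Set (ℝ × ℝ) := {p ∈ tri κ | κ - 1 ≤ p.2 ∧ p.1 + p.2 ≤ 2 * κ - 1}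

/-- The lower part of the triangle. -/
def triLow (κ : ℝ) : Set (ℝ × ℝ) := {p ∈ tri κ | p.2 ≤ κ - 1}

theorem HasTile.map {R R' : ℝ × ℝ → ℝ × ℝ → Prop} {φ : ℝ × ℝ → ℝ × ℝ} {Z Z' : Set (ℝ × ℝ)}
    {μ : ℝ} (h : HasTile R Z) (hφ : SquareSim φ μ) (hc : Carries R R' φ Z Z') :
    HasTile R' Z' := by
  obtain ⟨i, c, r, ht⟩ := h
  obtain ⟨j, l, hl, hn⟩ := hφ.norm i
  exact ⟨_, _, _, ht.map hc hφ.surj hl hn⟩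

theorem HasTile.tileDense {R : ℝ × ℝ → ℝ × ℝ → Prop} {Z : Set (ℝ × ℝ)} (h : HasTile R Z) {δ : ℝ}
    (hδ : ∀ p ∈ Z, ∀ q ∈ Z, sqDist p q ≤ δ) : TileDense R Z δ := by
  intro p hp
  obtain ⟨i, c, r, ht⟩ := h
  have hc : sqNorm i (c - c) ≤ r := by cases i <;> simpa [sqNorm] using ht.pos.le
  exact ⟨i, c, r, c, ht, hc, hδ c (ht.sub c hc) p hp⟩

theorem Carries.comp {R R' R'' : ℝ × ℝ → ℝ × ℝ → Prop} {φ ψ : ℝ × ℝ → ℝ × ℝ}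
    {Z Z' Z'' : Set (ℝ × ℝ)} (h' : Carries R' R'' ψ Z' Z'') (h : Carries R R' φ Z Z') :
    Carries R R'' (ψ ∘ φ) Z Z'' where
  maps p hp := h'.maps _ (h.maps p hp)
  per K := by
    obtain ⟨K', hK'⟩ := h.per K
    obtain ⟨K'', hK''⟩ := h'.per K'
    exact ⟨K'', fun p hp hpp => hK'' _ (h.maps p hp) (hK' p hp hpp)⟩
  imm p hp hi := h.imm p hp (h'.imm _ (h.maps p hp) hi)

theorem SquareSim.comp {φ ψ : ℝ × ℝ → ℝ × ℝ} {μ ν : ℝ} (h' : SquareSim ψ ν)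
    (h : SquareSim φ μ) : SquareSim (ψ ∘ φ) (ν * μ) where
  surj := h'.surj.comp h.surj
  norm i := by
    obtain ⟨j, l, hl, hn⟩ := h.norm i
    obtain ⟨j', l', hl', hn'⟩ := h'.norm j
    exact ⟨j', l' * l, mul_pos hl' hl, fun p q => by
      simp only [Function.comp_apply, hn', hn, mul_assoc]⟩
  dist p q := by simp only [Function.comp_apply, h'.dist, h.dist, mul_assoc]

theorem squareSim_rotBack : SquareSim rotBack 1 where
  surj p := ⟨(1 - p.2, p.1), by simp [rotBack]⟩
  norm i := by
    refine ⟨i, 1, one_pos, fun p q => ?_⟩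
    have h : |1 - p.1 - (1 - q.1)| = |p.1 - q.1| := by rw [← abs_neg]; congr 1; ring
    cases i <;> simp only [sqNorm, rotBack, Prod.mk_sub_mk, Prod.fst_sub, Prod.snd_sub, h, one_mul]
    · exact add_comm _ _
    · exact max_comm _ _
  dist p q := by simp only [sqDist, rotBack]; ring

theorem squareSim_trapToTri (t : ℝ) (j : ℕ) : SquareSim (trapToTri t j) 1 where
  surj p := ⟨(1 + t + j - p.2, p.1 - j), by ext <;> simp only [trapToTri] <;> ring⟩
  norm i := by
    refine ⟨i, 1, one_pos, fun p q => ?_⟩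
    have h : |1 + t - p.1 - (1 + t - q.1)| = |p.1 - q.1| := by
      rw [← abs_neg]; congr 1; ring
    cases i <;> simp only [sqNorm, trapToTri, Prod.mk_sub_mk, Prod.fst_sub, Prod.snd_sub, h,
      one_mul, add_sub_add_right_eq_sub]
    · exact add_comm _ _
    · exact max_comm _ _
  dist p q := by simp only [sqDist, trapToTri]; ring

theorem abs_add_abs_eq_max (a b : ℝ) : |a| + |b| = max |a + b| |a - b| := by
  apply le_antisymm
  · rcases le_total 0 a with ha | ha <;> rcases le_total 0 b with hb | hb
    · exact le_max_of_le_left (by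
        rw [abs_of_nonneg ha, abs_of_nonneg hb]; exact le_abs_self _)
    · exact le_max_of_le_right (by
        rw [abs_of_nonneg ha, abs_of_nonpos hb]
        exact le_of_eq_of_le (by ring) (le_abs_self _))
    · exact le_max_of_le_right (by
        rw [abs_of_nonpos ha, abs_of_nonneg hb]
        exact le_of_eq_of_le (by ring) (neg_le_abs _))
    · exact le_max_of_le_left (by
        rw [abs_of_nonpos ha, abs_of_nonpos hb]
        exact le_of_eq_of_le (by ring) (neg_le_abs _))
  · exact max_le (abs_add_le a b) (abs_sub a b)

theorem squareSim_triToTrap {t : ℝ} (h0 : 0 < t) : SquareSim (triToTrap t) (2 * t ^ 2) where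
  surj p := by
    refine ⟨(((p.1 - p.2) / t - 1) / 2, ((p.1 + p.2) / t - 1) / 2), ?_⟩
    ext <;> simp only [triToTrap] <;> field_simp <;> ring
  norm i := by
    have e1 : ∀ p q : ℝ × ℝ, (triToTrap t p - triToTrap t q) =
        (t * ((p.2 - q.2) + (p.1 - q.1)), t * ((p.2 - q.2) - (p.1 - q.1))) := fun p q => by
      ext <;> simp only [triToTrap, Prod.fst_sub, Prod.snd_sub] <;> ring
    cases i
    · refine ⟨true, t, h0, fun p q => ?_⟩
      simp only [sqNorm, e1, abs_mul, abs_of_pos h0, Prod.fst_sub, Prod.snd_sub]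
      rw [add_comm |p.1 - q.1|, abs_add_abs_eq_max, mul_max_of_nonneg _ _ h0.le]
    · refine ⟨false, 2 * t, by positivity, fun p q => ?_⟩
      simp only [sqNorm, e1, abs_mul, abs_of_pos h0, Prod.fst_sub, Prod.snd_sub]
      have e2 : ∀ a : ℝ, 2 * |a| = |2 * a| := fun a => by rw [abs_mul, abs_two]
      rw [← mul_add, abs_add_abs_eq_max, mul_comm 2 t, mul_assoc]
      congr 1
      rw [mul_max_of_nonneg _ _ zero_le_two, max_comm (2 * |p.1 - q.1|), e2, e2]
      ring_nf
  dist p q := by simp only [sqDist, triToTrap]; ring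

section TriPieces

variable {t κ : ℝ} (h0 : 0 < t) (h1 : t < 1 / 2) (hκ : 2 * (t * κ) = 1)

include h0 h1 hκ

theorem carries_triTip : Carries (TriRel κ) (TrapRel t) (triToTrap t) (triTip κ) (trapTip t) := by
  refine (carries_triToTrap h0 h1 hκ).restrict (fun p hp => hp.1) ?_
  rintro ⟨E, f⟩ ⟨⟨a1, a2, a3⟩, a4⟩
  simp only at *
  have b1 := mul_nonneg h0.le a1
  have b2 := mul_le_mul_of_nonneg_left a2 h0.le
  have b3 := mul_le_mul_of_nonneg_left a3 h0.le
  have b4 := mul_le_mul_of_nonneg_left a4 h0.le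
  refine ⟨⟨?_, ?_, ?_, ?_⟩, ?_⟩ <;> simp only [triToTrap] <;> linarith

theorem carries_triSide_trapLow :
    Carries (TriRel κ) (TrapRel t) (triToTrap t) (triSide κ) (trapLow t) := by
  refine (carries_triToTrap h0 h1 hκ).restrict (fun p hp => hp.1) ?_
  rintro ⟨E, f⟩ ⟨⟨a1, a2, a3⟩, a4, a5⟩
  simp only at *
  have b1 := mul_nonneg h0.le a1
  have b2 := mul_le_mul_of_nonneg_left a2 h0.le
  have b3 := mul_le_mul_of_nonneg_left a3 h0.le
  have b4 := mul_le_mul_of_nonneg_left a5 h0.le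
  refine ⟨⟨?_, ?_, ?_, ?_⟩, ?_, ?_⟩ <;> simp only [triToTrap] <;> linarith

theorem carries_triLow_trapLow :
    Carries (TriRel κ) (TrapRel t) (triToTrap t) (triLow κ) (trapLow t) := by
  refine (carries_triToTrap h0 h1 hκ).restrict (fun p hp => hp.1) ?_
  rintro ⟨E, f⟩ ⟨⟨a1, a2, a3⟩, a4⟩
  simp only at *
  have b1 := mul_nonneg h0.le a1
  have b2 := mul_le_mul_of_nonneg_left a2 h0.le
  have b4 := mul_le_mul_of_nonneg_left a4 h0.le
  refine ⟨⟨?_, ?_, ?_, ?_⟩, ?_, ?_⟩ <;> simp only [triToTrap] <;> linarith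

theorem carries_triSide_rot : Carries (TriRel κ) (TrapRel t) (rotBack ∘ triToTrap t)
    (triSide κ) (trapLow t) := by
  refine ((carries_rotBack h0 h1).comp (carries_triSide_trapLow h0 h1 hκ)).restrict le_rfl ?_
  rintro ⟨E, f⟩ ⟨⟨a1, a2, a3⟩, a4, a5⟩
  simp only at *
  have b1 := mul_nonneg h0.le a1
  have b2 := mul_le_mul_of_nonneg_left a2 h0.le
  have b3 := mul_le_mul_of_nonneg_left a3 h0.le
  have b4 := mul_le_mul_of_nonneg_left a4 h0.le
  have b5 := mul_le_mul_of_nonneg_left a5 h0.le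
  refine ⟨⟨?_, ?_, ?_, ?_⟩, ?_, ?_⟩ <;> simp only [triToTrap, rotBack, Function.comp] <;> linarith

theorem carries_triLow_rot : Carries (TriRel κ) (TrapRel t) (rotBack ∘ triToTrap t)
    (triLow κ) (trapTop t) := by
  refine ((carries_rotBack h0 h1).comp (carries_triLow_trapLow h0 h1 hκ)).restrict le_rfl ?_
  rintro ⟨E, f⟩ ⟨⟨a1, a2, a3⟩, a4⟩
  simp only at *
  have b1 := mul_nonneg h0.le a1
  have b2 := mul_le_mul_of_nonneg_left a2 h0.le
  have b4 := mul_le_mul_of_nonneg_left a4 h0.le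
  refine ⟨⟨?_, ?_, ?_, ?_⟩, ?_⟩ <;> simp only [triToTrap, rotBack, Function.comp] <;> linarith

theorem carries_triSide_rot_rot : Carries (TriRel κ) (TrapRel t)
    (rotBack ∘ rotBack ∘ triToTrap t) (triSide κ) (trapTop t) := by
  refine ((carries_rotBack h0 h1).comp (carries_triSide_rot h0 h1 hκ)).restrict le_rfl ?_
  rintro ⟨E, f⟩ ⟨⟨a1, a2, a3⟩, a4, a5⟩
  simp only at *
  have b1 := mul_nonneg h0.le a1
  have b2 := mul_le_mul_of_nonneg_left a2 h0.le
  have b3 := mul_le_mul_of_nonneg_left a3 h0.le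
  have b4 := mul_le_mul_of_nonneg_left a4 h0.le
  have b5 := mul_le_mul_of_nonneg_left a5 h0.le
  refine ⟨⟨?_, ?_, ?_, ?_⟩, ?_⟩ <;> simp only [triToTrap, rotBack, Function.comp] <;> linarith

/-- Density in the triangle gives density in the trapezoid. -/
theorem tileDense_trap {ε : ℝ} (hε : 0 ≤ ε) (hTip : TileDense (TriRel κ) (triTip κ) ε)
    (hSide : TileDense (TriRel κ) (triSide κ) ε) (hLow : TileDense (TriRel κ) (triLow κ) ε) :
    TileDense (TrapRel t) (trapTip t) (2 * t ^ 2 * ε) ∧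
    TileDense (TrapRel t) (trapLow t) (2 * t ^ 2 * ε) ∧
    TileDense (TrapRel t) (trapTop t) (2 * t ^ 2 * ε) := by
  have hθ := squareSim_triToTrap h0
  have hμ : (0 : ℝ) ≤ 2 * t ^ 2 := by positivity
  have hρ := squareSim_rotBack.comp hθ
  have hρρ := squareSim_rotBack.comp hρ
  simp only [one_mul] at hρ hρρ
  have pre : ∀ u η : ℝ, 0 ≤ η → t ≤ u - η → u + η ≤ 1 + t →
      ∃ p ∈ tri κ, triToTrap t p = (u, η) ∧ 2 * (t * p.1) = u - η - t ∧
        2 * (t * p.2) = u + η - t := by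
    intro u η a1 a2 a3
    have c1 : t * ((u - η - t) / (2 * t)) = (u - η - t) / 2 := by field_simp
    have c2 : t * ((u + η - t) / (2 * t)) = (u + η - t) / 2 := by field_simp
    have inv : ∀ {x y : ℝ}, t * x ≤ t * y → x ≤ y := fun h => le_of_mul_le_mul_left h h0
    refine ⟨((u - η - t) / (2 * t), (u + η - t) / (2 * t)), ⟨?_, ?_, ?_⟩, ?_, ?_, ?_⟩
    · exact inv (by simp only [c1]; linarith)
    · exact inv (by simp only [c1, c2]; linarith)
    · exact inv (by simp only [c2]; linarith)
    · simp only [triToTrap, mul_add, mul_sub, c1, c2, Prod.mk.injEq]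
      constructor <;> ring
    · simp only [c1]; ring
    · simp only [c2]; ring
  have inv : ∀ {x y : ℝ}, t * x ≤ t * y → x ≤ y := fun h => le_of_mul_le_mul_left h h0
  refine ⟨?_, ?_, ?_⟩
  · rintro ⟨u, η⟩ ⟨⟨a1, a2, a3, a4⟩, a5⟩
    simp only at *
    obtain ⟨p, hp, he, e1, e2⟩ := pre u η a2 (by linarith) a4
    rw [← he]
    exact (hTip p ⟨hp, inv (by linarith)⟩).map hθ hμ (carries_triTip h0 h1 hκ)
  · rintro ⟨u, η⟩ ⟨⟨a1, a2, a3, a4⟩, a5, a6⟩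
    simp only at *
    rcases le_total t (u - η) with a7 | a7
    · obtain ⟨p, hp, he, e1, e2⟩ := pre u η a2 a7 a4
      rw [← he]
      rcases le_total (κ - 1) p.2 with h | h
      · exact (hSide p ⟨hp, h, inv (by linarith)⟩).map hθ hμ (carries_triSide_trapLow h0 h1 hκ)
      · exact (hLow p ⟨hp, h⟩).map hθ hμ (carries_triLow_trapLow h0 h1 hκ)
    · rcases le_total (1 - t) (u + η) with a8 | a8
      · refine (squareTile_trapLow h0 h1).nearTile ?_ (mul_nonneg hμ hε)
        simp only [sqNorm, Prod.mk_sub_mk, abs_add_abs_le_iff]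
        refine ⟨?_, ?_, ?_, ?_⟩ <;> linarith
      · obtain ⟨p, hp, he, e1, e2⟩ := pre (1 - η) u a1 (by linarith) (by linarith)
        have he' : (rotBack ∘ triToTrap t) p = (u, η) := by simp [he, rotBack]
        rw [← he']
        exact (hSide p ⟨hp, inv (by linarith), inv (by linarith)⟩).map hρ hμ
          (carries_triSide_rot h0 h1 hκ)
  · rintro ⟨u, η⟩ ⟨⟨a1, a2, a3, a4⟩, a5⟩
    simp only at *
    rcases le_total (1 - t) (u + η) with a8 | a8
    · obtain ⟨p, hp, he, e1, e2⟩ := pre (1 - u) (1 - η) (by linarith) (by linarith) (by linarith)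
      have he' : (rotBack ∘ rotBack ∘ triToTrap t) p = (u, η) := by simp [he, rotBack]
      rw [← he']
      exact (hSide p ⟨hp, inv (by linarith), inv (by linarith)⟩).map hρρ hμ
        (carries_triSide_rot_rot h0 h1 hκ)
    · obtain ⟨p, hp, he, e1, e2⟩ := pre (1 - η) u a1 (by linarith) (by linarith)
      have he' : (rotBack ∘ triToTrap t) p = (u, η) := by simp [he, rotBack]
      rw [← he']
      exact (hLow p ⟨hp, inv (by linarith)⟩).map hρ hμ (carries_triLow_rot h0 h1 hκ)

end TriPieces

section TrapPieces

variable {t κ : ℝ} {k : ℕ} (h0 : 0 < t) (h1 : t < 1 / 2) (hk : 1 ≤ k) (hκ : κ = k + t)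

include h0 h1 hk hκ

theorem carries_trapTip_triTip :
    Carries (TrapRel t) (TriRel κ) (trapToTri t k) (trapTip t) (triTip κ) := by
  refine (carries_trapToTri h0 h1 hk hκ k le_rfl).restrict (fun p hp => ⟨hp.1, fun _ => hp.2⟩) ?_
  rintro ⟨u, η⟩ ⟨⟨a1, a2, a3, a4⟩, a5⟩
  have hk' : (1 : ℝ) ≤ k := by exact_mod_cast hk
  simp only at *
  refine ⟨⟨?_, ?_, ?_⟩, ?_⟩ <;> simp only [trapToTri] <;> linarith

theorem carries_trap_pred (Z Z' : Set (ℝ × ℝ)) (hZ : Z ⊆ trap t)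
    (hm : ∀ u η : ℝ, (u, η) ∈ Z → (η + (κ - t - 1), κ - u) ∈ Z') :
    Carries (TrapRel t) (TriRel κ) (trapToTri t (k - 1)) Z Z' := by
  refine (carries_trapToTri h0 h1 hk hκ (k - 1) (by omega)).restrict
    (fun p hp => ⟨hZ hp, fun h => by omega⟩) ?_
  rintro ⟨u, η⟩ hp
  have := hm u η hp
  have hc : ((k - 1 : ℕ) : ℝ) = κ - t - 1 := by rw [Nat.cast_sub hk, hκ]; push_cast; ring
  convert this using 1
  simp only [trapToTri, hc, Prod.mk.injEq, true_and]
  ring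

theorem carries_trapTop_triTip :
    Carries (TrapRel t) (TriRel κ) (trapToTri t (k - 1)) (trapTop t) (triTip κ) := by
  refine carries_trap_pred h0 h1 hk hκ _ _ (fun p hp => hp.1) ?_
  rintro u η ⟨⟨a1, a2, a3, a4⟩, a5⟩
  have hk' : (1 : ℝ) ≤ k := by exact_mod_cast hk
  simp only at *
  refine ⟨⟨?_, ?_, ?_⟩, ?_⟩ <;> simp only <;> linarith

theorem carries_trapLow_triSide :
    Carries (TrapRel t) (TriRel κ) (trapToTri t (k - 1)) (trapLow t) (triSide κ) := by
  refine carries_trap_pred h0 h1 hk hκ _ _ (fun p hp => hp.1) ?_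
  rintro u η ⟨⟨a1, a2, a3, a4⟩, a5, a6⟩
  have hk' : (1 : ℝ) ≤ k := by exact_mod_cast hk
  simp only at *
  refine ⟨⟨?_, ?_, ?_⟩, ?_, ?_⟩ <;> simp only <;> linarith

theorem carries_trapTip_triLow :
    Carries (TrapRel t) (TriRel κ) (trapToTri t (k - 1)) (trapTip t) (triLow κ) := by
  refine carries_trap_pred h0 h1 hk hκ _ _ (fun p hp => hp.1) ?_
  rintro u η ⟨⟨a1, a2, a3, a4⟩, a5⟩
  have hk' : (1 : ℝ) ≤ k := by exact_mod_cast hk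
  simp only at *
  refine ⟨⟨?_, ?_, ?_⟩, ?_⟩ <;> simp only <;> linarith

theorem carries_trap_triLow {j : ℕ} (hj : j + 2 ≤ k) :
    Carries (TrapRel t) (TriRel κ) (trapToTri t j) (trap t) (triLow κ) := by
  refine (carries_trapToTri h0 h1 hk hκ j (by omega)).restrict
    (fun p hp => ⟨hp, fun h => by omega⟩) ?_
  rintro ⟨u, η⟩ ⟨a1, a2, a3, a4⟩
  have hj' : (j : ℝ) + 2 ≤ k := by exact_mod_cast hj
  have hj0 : (0 : ℝ) ≤ j := j.cast_nonneg
  simp only at *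
  refine ⟨⟨?_, ?_, ?_⟩, ?_⟩ <;> simp only [trapToTri] <;> linarith

omit h1 hk in
theorem nearTile_cell {j d e : ℕ} {Z : Set (ℝ × ℝ)} (hde : k = j + d + e + 2) {E f ε : ℝ}
    (hε : 0 ≤ ε) (hE : (j : ℝ) ≤ E) (hE' : E ≤ j + 1) (hf : j + d + 1 + t ≤ f)
    (hf' : f ≤ j + d + 2 + t)
    (hZ : ∀ x ∈ Icc (0 : ℝ) 1, ∀ y ∈ Icc (0 : ℝ) 1, (x + j, y + d + 1 + t + j) ∈ Z) :
    NearTile (TriRel κ) Z ε (E, f) := by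
  refine (squareTile_cell (j := j) (d := d) (e := e) h0 ?_ hZ).nearTile ?_ hε
  · rw [hκ, hde]; push_cast; ring
  · simp only [sqNorm, Prod.fst_sub, Prod.snd_sub, sup_le_iff, abs_le]
    refine ⟨⟨?_, ?_⟩, ?_, ?_⟩ <;> linarith

/-- Density in the smaller trapezoid gives density in the triangle. -/
theorem tileDense_tri {ε : ℝ} (hε : 0 ≤ ε) (hTip : TileDense (TrapRel t) (trapTip t) ε)
    (hLow : TileDense (TrapRel t) (trapLow t) ε) (hTop : TileDense (TrapRel t) (trapTop t) ε) :
    TileDense (TriRel κ) (triTip κ) ε ∧ TileDense (TriRel κ) (triSide κ) ε ∧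
      TileDense (TriRel κ) (triLow κ) ε := by
  have hφ := fun j => squareSim_trapToTri t j
  have hk' : (1 : ℝ) ≤ k := by exact_mod_cast hk
  have hc : ((k - 1 : ℕ) : ℝ) = k - 1 := by rw [Nat.cast_sub hk]; simp
  have hmap : ∀ {j : ℕ} {Z Z' : Set (ℝ × ℝ)}, TileDense (TrapRel t) Z ε →
      Carries (TrapRel t) (TriRel κ) (trapToTri t j) Z Z' → ∀ E f : ℝ,
      (1 + t + j - f, E - j) ∈ Z → NearTile (TriRel κ) Z' ε (E, f) := by
    intro j Z Z' hd hC E f hm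
    have := (hd _ hm).map (hφ j) zero_le_one hC
    rw [one_mul] at this
    convert this using 1
    simp only [trapToTri, Prod.mk.injEq]
    constructor <;> ring
  have hfloor : ∀ E : ℝ, 0 ≤ E → ((⌊E⌋₊ : ℕ) : ℝ) ≤ E ∧ E < ⌊E⌋₊ + 1 := fun E hE =>
    ⟨Nat.floor_le hE, Nat.lt_floor_add_one E⟩
  refine ⟨?_, ?_, ?_⟩
  · rintro ⟨E, f⟩ ⟨⟨a1, a2, a3⟩, a4⟩
    simp only at *
    rcases le_total E k with h | h
    · refine hmap hTop (carries_trapTop_triTip h0 h1 hk hκ) E f ⟨⟨?_, ?_, ?_, ?_⟩, ?_⟩ <;>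
        simp only [hc] <;> linarith
    · refine hmap hTip (carries_trapTip_triTip h0 h1 hk hκ) E f ⟨⟨?_, ?_, ?_, ?_⟩, ?_⟩ <;>
        simp only <;> linarith
  · rintro ⟨E, f⟩ ⟨⟨a1, a2, a3⟩, a4, a5⟩
    simp only at *
    rcases lt_or_ge E (k - 1) with h | h
    · obtain ⟨f1, f2⟩ := hfloor E a1
      set j := ⌊E⌋₊ with hj
      have hjk : j + 1 < k := by
        have : (j : ℝ) + 1 < k := by linarith
        exact_mod_cast this
      obtain ⟨d, hd⟩ : ∃ d, k = j + d + 2 := ⟨k - j - 2, by omega⟩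
      have hd' : (k : ℝ) = j + d + 2 := by exact_mod_cast hd
      have hd0 : (0 : ℝ) ≤ d := d.cast_nonneg
      have hj0 : (0 : ℝ) ≤ j := j.cast_nonneg
      refine nearTile_cell (e := 0) h0 hκ hd hε f1 f2.le (by linarith) (by linarith) ?_
      rintro x ⟨x0, x1⟩ y ⟨y0, y1⟩
      refine ⟨⟨?_, ?_, ?_⟩, ?_, ?_⟩ <;> simp only <;> linarith
    · refine hmap hLow (carries_trapLow_triSide h0 h1 hk hκ) E f ⟨⟨?_, ?_, ?_, ?_⟩, ?_, ?_⟩ <;>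
        simp only [hc] <;> linarith
  · rintro ⟨E, f⟩ ⟨⟨a1, a2, a3⟩, a4⟩
    simp only at *
    obtain ⟨f1, f2⟩ := hfloor E a1
    set j := ⌊E⌋₊ with hj
    have hj0 : (0 : ℝ) ≤ j := j.cast_nonneg
    rcases le_or_gt f (j + 1 + t) with h | h
    · rcases le_or_gt (k - 1 : ℝ) E with h' | h'
      · refine hmap hTip (carries_trapTip_triLow h0 h1 hk hκ) E f ⟨⟨?_, ?_, ?_, ?_⟩, ?_⟩ <;>
          simp only [hc] <;> linarith
      · have hjk : j + 2 ≤ k := by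
          have : (j : ℝ) + 1 < k := by linarith
          have : j + 1 < k := by exact_mod_cast this
          omega
        have htrap : TileDense (TrapRel t) (trap t) ε := by
          intro p hp
          rcases le_total p.1 1 with h2 | h2
          · rcases le_total (-t) (p.1 - p.2) with h3 | h3
            · exact (hLow p ⟨hp, h3, h2⟩).mono (fun q hq => hq.1) le_rfl
            · exact (hTop p ⟨hp, h3⟩).mono (fun q hq => hq.1) le_rfl
          · exact (hTip p ⟨hp, h2⟩).mono (fun q hq => hq.1) le_rfl
        refine hmap htrap (carries_trap_triLow h0 h1 hk hκ hjk) E f ⟨?_, ?_, ?_, ?_⟩ <;>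
          simp only <;> linarith
    · have hx : 0 < f - t - j - 1 := by linarith
      set c := ⌈f - t - j - 1⌉₊ with hc'
      have c1 : f - t - j - 1 ≤ c := Nat.le_ceil _
      have c2 : (c : ℝ) < f - t - j - 1 + 1 := Nat.ceil_lt_add_one hx.le
      have c3 : 0 < c := Nat.ceil_pos.2 hx
      have c4 : c + j + 1 < k := by
        have : (c : ℝ) + j + 1 < k := by linarith
        exact_mod_cast this
      obtain ⟨d, hd⟩ : ∃ d, c = d + 1 := ⟨c - 1, by omega⟩
      obtain ⟨e, he⟩ : ∃ e, k = j + d + e + 3 := ⟨k - j - d - 3, by omega⟩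
      have he' : (k : ℝ) = j + d + e + 3 := by exact_mod_cast he
      have hd0 : (0 : ℝ) ≤ d := d.cast_nonneg
      have he0 : (0 : ℝ) ≤ e := e.cast_nonneg
      rw [hd] at c1 c2
      push_cast at c1 c2
      refine nearTile_cell (e := e + 1) h0 hκ (by omega) hε f1 f2.le (by linarith)
        (by linarith) ?_
      rintro x ⟨x0, x1⟩ y ⟨y0, y1⟩
      refine ⟨⟨?_, ?_, ?_⟩, ?_⟩ <;> simp only <;> linarith

end TrapPieces

/-- All iterates of `Rmap` at `t` are positive and smaller than `1/2`. -/
def GoodParam (t : ℝ) : Prop := ∀ n : ℕ, 0 < Rmap^[n] t ∧ Rmap^[n] t < 1 / 2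

theorem GoodParam.bounds {t : ℝ} (h : GoodParam t) : 0 < t ∧ t < 1 / 2 := h 0

theorem GoodParam.next {t : ℝ} (h : GoodParam t) : GoodParam (Rmap t) := fun n => by
  have := h (n + 1)
  rwa [Function.iterate_succ_apply] at this

theorem exists_eq_nat_add_Rmap {t κ : ℝ} (h0 : 0 < t) (h1 : t < 1 / 2) (hκ : 2 * (t * κ) = 1) :
    ∃ k : ℕ, 1 ≤ k ∧ κ = k + Rmap t := by
  have e : κ = 1 / (2 * t) := by field_simp; linarith
  have hκ1 : 1 < κ := by nlinarith
  have hz : 1 ≤ ⌊κ⌋ := Int.le_floor.2 (by exact_mod_cast hκ1.le)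
  refine ⟨⌊κ⌋.toNat, by omega, ?_⟩
  have : ((⌊κ⌋.toNat : ℕ) : ℝ) = (⌊κ⌋ : ℝ) := by
    have : ((⌊κ⌋.toNat : ℕ) : ℤ) = ⌊κ⌋ := Int.toNat_of_nonneg (by omega)
    exact_mod_cast this
  rw [this, Rmap, if_pos h1, ← e]
  ring

theorem exists_recip {t : ℝ} (h0 : 0 < t) : ∃ κ : ℝ, 2 * (t * κ) = 1 :=
  ⟨1 / (2 * t), by field_simp⟩

theorem hasTile_tri {t κ : ℝ} (ht : GoodParam t) (hκ : 2 * (t * κ) = 1) :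
    HasTile (TriRel κ) (triTip κ) ∧ HasTile (TriRel κ) (triSide κ) ∧
      HasTile (TriRel κ) (triLow κ) := by
  have side : ∀ t κ : ℝ, GoodParam t → 2 * (t * κ) = 1 → HasTile (TriRel κ) (triSide κ) := by
    intro t κ ht hκ
    obtain ⟨k, hk, e⟩ := exists_eq_nat_add_Rmap ht.bounds.1 ht.bounds.2 hκ
    have h := ht.next.bounds
    exact HasTile.map ⟨_, _, _, squareTile_trapLow h.1 h.2⟩ (squareSim_trapToTri _ _)
      (carries_trapLow_triSide h.1 h.2 hk e)
  have tip : ∀ t κ : ℝ, GoodParam t → 2 * (t * κ) = 1 → HasTile (TriRel κ) (triTip κ) := by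
    intro t κ ht hκ
    obtain ⟨k, hk, e⟩ := exists_eq_nat_add_Rmap ht.bounds.1 ht.bounds.2 hκ
    have h := ht.next.bounds
    obtain ⟨κ', hκ'⟩ := exists_recip h.1
    have h3 := (side _ _ ht.next hκ').map
      (squareSim_rotBack.comp (squareSim_rotBack.comp (squareSim_triToTrap h.1)))
      (carries_triSide_rot_rot h.1 h.2 hκ')
    exact h3.map (squareSim_trapToTri _ _) (carries_trapTop_triTip h.1 h.2 hk e)
  refine ⟨tip t κ ht hκ, side t κ ht hκ, ?_⟩
  obtain ⟨k, hk, e⟩ := exists_eq_nat_add_Rmap ht.bounds.1 ht.bounds.2 hκ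
  have h := ht.next.bounds
  obtain ⟨κ', hκ'⟩ := exists_recip h.1
  have h3 := (tip _ _ ht.next hκ').map (squareSim_triToTrap h.1) (carries_triTip h.1 h.2 hκ')
  exact h3.map (squareSim_trapToTri _ _) (carries_trapTip_triLow h.1 h.2 hk e)

theorem sqDist_le_of_mem_tri {κ : ℝ} {p q : ℝ × ℝ} (hp : p ∈ tri κ) (hq : q ∈ tri κ) :
    sqDist p q ≤ 2 * κ ^ 2 := by
  obtain ⟨a1, a2, a3⟩ := hp
  obtain ⟨b1, b2, b3⟩ := hq
  have h1 : (p.1 - q.1) ^ 2 ≤ κ ^ 2 := sq_le_sq' (by linarith) (by linarith)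
  have h2 : (p.2 - q.2) ^ 2 ≤ κ ^ 2 := sq_le_sq' (by linarith) (by linarith)
  simp only [sqDist]
  linarith

theorem tileDense_tri_pow (n : ℕ) : ∀ t κ : ℝ, GoodParam t → 2 * (t * κ) = 1 →
    TileDense (TriRel κ) (triTip κ) (2 * κ ^ 2 / 2 ^ n) ∧
      TileDense (TriRel κ) (triSide κ) (2 * κ ^ 2 / 2 ^ n) ∧
      TileDense (TriRel κ) (triLow κ) (2 * κ ^ 2 / 2 ^ n) := by
  induction n with
  | zero =>
    intro t κ ht hκ
    obtain ⟨h1, h2, h3⟩ := hasTile_tri ht hκ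
    simp only [pow_zero, div_one]
    exact ⟨h1.tileDense fun p hp q hq => sqDist_le_of_mem_tri hp.1 hq.1,
      h2.tileDense fun p hp q hq => sqDist_le_of_mem_tri hp.1 hq.1,
      h3.tileDense fun p hp q hq => sqDist_le_of_mem_tri hp.1 hq.1⟩
  | succ n ih =>
    intro t κ ht hκ
    obtain ⟨k, hk, e⟩ := exists_eq_nat_add_Rmap ht.bounds.1 ht.bounds.2 hκ
    have h := ht.next.bounds
    obtain ⟨κ', hκ'⟩ := exists_recip h.1
    obtain ⟨a1, a2, a3⟩ := ih _ κ' ht.next hκ'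
    obtain ⟨b1, b2, b3⟩ := tileDense_trap h.1 h.2 hκ' (by positivity) a1 a2 a3
    have hp : (0 : ℝ) < 2 ^ n := by positivity
    have hε : 2 * Rmap t ^ 2 * (2 * κ' ^ 2 / 2 ^ n) = 1 / 2 ^ n := by
      have : 2 * Rmap t ^ 2 * (2 * κ' ^ 2 / 2 ^ n) =
        (2 * (Rmap t * κ')) ^ 2 / 2 ^ n := by ring
      rw [this, hκ', one_pow]
    have hle : 1 / 2 ^ n ≤ 2 * κ ^ 2 / 2 ^ (n + 1) := by
      have hκ1 : 1 ≤ κ := by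
        have : (1 : ℝ) ≤ k := by exact_mod_cast hk
        linarith [h.1]
      have : 2 * κ ^ 2 / 2 ^ (n + 1) = κ ^ 2 / 2 ^ n := by
        rw [pow_succ' (2 : ℝ) n, mul_div_mul_left _ _ two_ne_zero]
      rw [this]
      exact div_le_div_of_nonneg_right (one_le_pow₀ hκ1) hp.le
    obtain ⟨c1, c2, c3⟩ := tileDense_tri h.1 h.2 hk e (by rw [hε]; positivity) b1 b2 b3
    rw [hε] at c1 c2 c3
    exact ⟨fun p hp => (c1 p hp).mono le_rfl hle, fun p hp => (c2 p hp).mono le_rfl hle,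
      fun p hp => (c3 p hp).mono le_rfl hle⟩

/-- The square tiles are dense in the trapezoid. -/
theorem GoodParam.tileDense {t : ℝ} (ht : GoodParam t) {ε : ℝ} (hε : 0 < ε) :
    TileDense (TrapRel t) (trap t) ε := by
  have h := ht.bounds
  obtain ⟨κ, hκ⟩ := exists_recip h.1
  obtain ⟨n, hn⟩ := exists_pow_lt_of_lt_one hε (show (1 / 2 : ℝ) < 1 by norm_num)
  obtain ⟨a1, a2, a3⟩ := tileDense_tri_pow n t κ ht hκ
  obtain ⟨b1, b2, b3⟩ := tileDense_trap h.1 h.2 hκ (by positivity) a1 a2 a3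
  have hle : 2 * t ^ 2 * (2 * κ ^ 2 / 2 ^ n) ≤ ε := by
    have : 2 * t ^ 2 * (2 * κ ^ 2 / 2 ^ n) =
        (2 * (t * κ)) ^ 2 * (1 / 2) ^ n := by
      rw [one_div, inv_pow]; ring
    rw [this]
    rw [hκ]
    linarith
  intro p hp
  rcases le_total p.1 1 with h2 | h2
  · rcases le_total (-t) (p.1 - p.2) with h3 | h3
    · exact (b2 p ⟨hp, h3, h2⟩).mono (fun q hq => hq.1) hle
    · exact (b3 p ⟨hp, h3⟩).mono (fun q hq => hq.1) hle
  · exact (b1 p ⟨hp, h2⟩).mono (fun q hq => hq.1) hle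

/-! ### From the trapezoid to the left half of `X_s` -/

/-- The interior of `F₁(s)`. -/
def octInt (s : ℝ) : Set (ℝ × ℝ) :=
  {p | -s < p.2 ∧ p.2 < s ∧ -1 < p.1 - p.2 ∧ p.1 - p.2 < 1}

/-- The map `f′` on the interior of `X_s`, followed by a rotation from `F₂` back to `F₁`. -/
def HalfRel (s : ℝ) (p g : ℝ × ℝ) : Prop :=
  p ∈ octInt s ∧ g ∈ octInt s ∧
    ∃ a b : ℤ, p.1 + g.2 = 2 * a + 2 * s * b ∧ g.1 - p.2 = 2 * s * b

theorem neg_mem_octInt {s : ℝ} {p : ℝ × ℝ} (h : p ∈ octInt s) : -p ∈ octInt s := by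
  obtain ⟨h1, h2, h3, h4⟩ := h
  refine ⟨?_, ?_, ?_, ?_⟩ <;> simp only [Prod.fst_neg, Prod.snd_neg] <;> linarith

theorem HalfRel.neg {s : ℝ} {p g : ℝ × ℝ} (h : HalfRel s p g) : HalfRel s (-p) (-g) := by
  obtain ⟨hp, hg, a, b, h1, h2⟩ := h
  refine ⟨neg_mem_octInt hp, neg_mem_octInt hg, -a, -b, ?_, ?_⟩ <;>
    simp only [Prod.fst_neg, Prod.snd_neg] <;> push_cast <;> linarith

theorem relIter_halfRel_neg {s : ℝ} {n : ℕ} {p g : ℝ × ℝ} (h : relIter (HalfRel s) n p g) :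
    relIter (HalfRel s) n (-p) (-g) := by
  induction n generalizing g with
  | zero => exact congrArg Neg.neg h
  | succ n ih =>
    obtain ⟨r, hr, h⟩ := h
    exact ⟨-r, ih hr, h.neg⟩

theorem Immortal.neg {s : ℝ} {p : ℝ × ℝ} (h : Immortal (HalfRel s) p) :
    Immortal (HalfRel s) (-p) := by
  obtain ⟨S, hp, hS⟩ := h
  refine ⟨{x | -x ∈ S}, by simpa using hp, fun x hx => ?_⟩
  obtain ⟨y, hy, hxy⟩ := hS _ hx
  exact ⟨-y, by simpa using hy, by simpa using hxy.neg⟩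

/-- The similarity from the trapezoid onto the left end of `X_s`. -/
def trapToOct (s : ℝ) (k : ℕ) (p : ℝ × ℝ) : ℝ × ℝ :=
  (2 * s * (-p.1 - k + 1 / 2), 2 * s * (p.2 - 1 / 2))

theorem squareSim_trapToOct {s : ℝ} (h0 : 0 < s) (k : ℕ) :
    SquareSim (trapToOct s k) ((2 * s) ^ 2) where
  surj p := ⟨(-(p.1 / (2 * s)) - k + 1 / 2, p.2 / (2 * s) + 1 / 2), by
    ext <;> simp only [trapToOct] <;> field_simp <;> ring⟩
  norm i := by
    have h2 : 0 < 2 * s := by linarith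
    have e1 : ∀ p q : ℝ × ℝ, |2 * s * (-p.1 - k + 1 / 2) - 2 * s * (-q.1 - k + 1 / 2)| =
        2 * s * |p.1 - q.1| := fun p q => by
      rw [← abs_of_pos h2, ← abs_mul, abs_of_pos h2, ← abs_neg]; congr 1; ring
    have e2 : ∀ p q : ℝ × ℝ, |2 * s * (p.2 - 1 / 2) - 2 * s * (q.2 - 1 / 2)| =
        2 * s * |p.2 - q.2| := fun p q => by
      rw [← abs_of_pos h2, ← abs_mul, abs_of_pos h2]; congr 1; ring
    refine ⟨i, 2 * s, h2, fun p q => ?_⟩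
    cases i
    · simp only [sqNorm, trapToOct, Prod.mk_sub_mk, Prod.fst_sub, Prod.snd_sub, e1, e2]; ring
    · simp only [sqNorm, trapToOct, Prod.mk_sub_mk, Prod.fst_sub, Prod.snd_sub, e1, e2,
        mul_max_of_nonneg _ _ h2.le]
  dist p q := by simp only [sqDist, trapToOct]; ring

section TrapToOct

variable {s t : ℝ} {k : ℕ} (hs : 0 < s) (hk : 1 ≤ k) (h0 : 0 < t) (h1 : t < 1 / 2)
  (hst : 2 * (s * (k + t)) = 1)

include hst in
theorem trapToOct_mem_octInt_iff (hs : 0 < s) (p : ℝ × ℝ) : trapToOct s k p ∈ octInt s ↔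
    0 < p.2 ∧ p.2 < 1 ∧ 1 - 2 * k - t < p.1 + p.2 ∧ p.1 + p.2 < 1 + t := by
  have key : ∀ {A B x y : ℝ}, A = 2 * s * x → B = 2 * s * y → (A < B ↔ x < y) := by
    rintro _ _ x y rfl rfl
    exact mul_lt_mul_iff_right₀ (by linarith)
  have e1 : 0 < p.2 ↔ -s < 2 * s * (p.2 - 1 / 2) := by
    rw [key (x := -1 / 2) (by ring) rfl]; constructor <;> intro <;> linarith
  have e2 : p.2 < 1 ↔ 2 * s * (p.2 - 1 / 2) < s := by
    rw [key (y := 1 / 2) rfl (by ring)]; constructor <;> intro <;> linarith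
  have e3 : p.1 + p.2 < 1 + t ↔
      -1 < 2 * s * (-p.1 - k + 1 / 2) - 2 * s * (p.2 - 1 / 2) := by
    rw [key (x := -(k + t)) (by linarith) (mul_sub _ _ _).symm]
    constructor <;> intro <;> linarith
  have e4 : 1 - 2 * k - t < p.1 + p.2 ↔
      2 * s * (-p.1 - k + 1 / 2) - 2 * s * (p.2 - 1 / 2) < 1 := by
    rw [key (y := k + t) (mul_sub _ _ _).symm (by linarith)]
    constructor <;> intro <;> linarith
  simp only [octInt, trapToOct, mem_ofPred_eq, ← e1, ← e2, ← e3, ← e4]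
  tauto

include hs hk h0 h1 hst

theorem TrapRel.halfRel {p q : ℝ × ℝ} (h : TrapRel t p q) :
    HalfRel s (trapToOct s k p) (trapToOct s k q) ∨
      HalfRel s (trapToOct s k p) (-trapToOct s k q) := by
  have hk' : (1 : ℝ) ≤ k := by exact_mod_cast hk
  obtain ⟨u, η⟩ := p
  have mem := trapToOct_mem_octInt_iff hst hs
  rcases h with ⟨a1, a2, a3, a4, a5, rfl⟩ | ⟨a1, a2, a3, rfl⟩ | ⟨a1, a2, a3, a4, rfl⟩ <;>
    simp only at *
  · left
    refine ⟨(mem _).2 ⟨?_, ?_, ?_, ?_⟩, (mem _).2 ⟨?_, ?_, ?_, ?_⟩, 0, -k, ?_, ?_⟩ <;>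
      simp only [trapToOct] <;> push_cast <;> linarith
  · right
    refine ⟨(mem _).2 ⟨?_, ?_, ?_, ?_⟩, neg_mem_octInt ((mem _).2 ⟨?_, ?_, ?_, ?_⟩), -1, k + 1,
      ?_, ?_⟩ <;>
      simp only [trapToOct, Prod.fst_neg, Prod.snd_neg] <;> push_cast <;> linarith
  · right
    refine ⟨(mem _).2 ⟨?_, ?_, ?_, ?_⟩, neg_mem_octInt ((mem _).2 ⟨?_, ?_, ?_, ?_⟩), -1, k,
      ?_, ?_⟩ <;>
      simp only [trapToOct, Prod.fst_neg, Prod.snd_neg] <;> push_cast <;> linarith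

theorem TrapRel.exists_of_immortal_oct {p : ℝ × ℝ} (hp : p ∈ trap t)
    (h : Immortal (HalfRel s) (trapToOct s k p)) :
    ∃ q ∈ trap t, TrapRel t p q ∧ Immortal (HalfRel s) (trapToOct s k q) := by
  have hk' : (1 : ℝ) ≤ k := by exact_mod_cast hk
  obtain ⟨g, ⟨hp', hg, a, b, e1, e2⟩, hi⟩ := h.step
  obtain ⟨g, rfl⟩ := (squareSim_trapToOct hs k).surj g
  obtain ⟨u, η⟩ := p
  obtain ⟨u', η'⟩ := g
  obtain ⟨p1, p2, p3, p4⟩ := (trapToOct_mem_octInt_iff hst hs _).1 hp'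
  obtain ⟨g1, g2, g3, g4⟩ := (trapToOct_mem_octInt_iff hst hs _).1 hg
  obtain ⟨q1, -, -, -⟩ := hp
  simp only [trapToOct] at *
  have hne : (2 * s) ≠ 0 := by positivity
  replace e1 : η' = u + k + b + 2 * a * (k + t) := by
    apply mul_left_cancel₀ hne
    linear_combination e1 - 2 * a * hst
  replace e2 : u' = 1 - k - η - b := by
    apply mul_left_cancel₀ hne
    linear_combination -e2
  have hsplit : a = 0 ∨ a = -1 := by
    by_contra hc
    rcases (show a ≤ -2 ∨ 1 ≤ a by omega) with ha | ha
    · have : (a : ℝ) ≤ -2 := by exact_mod_cast ha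
      nlinarith
    · have : (1 : ℝ) ≤ a := by exact_mod_cast ha
      nlinarith
  rcases hsplit with rfl | rfl
  · have hb : b = -k := by
      have b1 : (-k - 2 : ℝ) < b := by push_cast at e1; linarith
      have b2 : (b : ℝ) < -k + 1 := by push_cast at e1; linarith
      have b3 : -(k : ℤ) - 2 < b := by exact_mod_cast b1
      have b4 : b < -(k : ℤ) + 1 := by exact_mod_cast b2
      by_contra hne
      obtain rfl : b = -k - 1 := by omega
      push_cast at e1 e2
      linarith
    subst hb
    push_cast at e1 e2
    obtain rfl : η' = u := by linarith
    obtain rfl : u' = 1 - η := by linarith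
    refine ⟨_, ⟨?_, ?_, ?_, ?_⟩, Or.inl ⟨?_, ?_, ?_, ?_, ?_, rfl⟩, hi⟩ <;> simp only <;> linarith
  · have hb : b = k ∨ b = k + 1 := by
      have b1 : (k - 1 : ℝ) < b := by push_cast at e1; linarith
      have b2 : (b : ℝ) < k + 2 := by push_cast at e1; linarith
      have b3 : (k : ℤ) - 1 < b := by exact_mod_cast b1
      have b4 : b < (k : ℤ) + 2 := by exact_mod_cast b2
      omega
    rcases hb with rfl | rfl
    · push_cast at e1 e2
      refine ⟨(η, 1 + 2 * t - u), ⟨?_, ?_, ?_, ?_⟩, Or.inr (Or.inr ⟨?_, ?_, ?_, ?_, rfl⟩), ?_⟩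
      all_goals try (simp only; linarith)
      convert hi.neg using 1
      ext <;> simp only [Prod.fst_neg, Prod.snd_neg, e1, e2] <;> ring
    · push_cast at e1 e2
      refine ⟨(1 + η, 2 * t - u), ⟨?_, ?_, ?_, ?_⟩, Or.inr (Or.inl ⟨?_, ?_, ?_, rfl⟩), ?_⟩
      all_goals try (simp only; linarith)
      convert hi.neg using 1
      ext <;> simp only [Prod.fst_neg, Prod.snd_neg, e1, e2] <;> ring

theorem TrapRel.halfIter {n : ℕ} {p q : ℝ × ℝ} (h : relIter (TrapRel t) n p q) :
    relIter (HalfRel s) n (trapToOct s k p) (trapToOct s k q) ∨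
      relIter (HalfRel s) n (trapToOct s k p) (-trapToOct s k q) := by
  induction n generalizing q with
  | zero => exact Or.inl (congrArg _ h)
  | succ n ih =>
    obtain ⟨r, hr, h⟩ := h
    rcases ih hr with hr | hr <;> rcases h.halfRel hs hk h0 h1 hst with h | h
    · exact Or.inl ⟨_, hr, h⟩
    · exact Or.inr ⟨_, hr, h⟩
    · exact Or.inr ⟨_, hr, h.neg⟩
    · exact Or.inl ⟨_, hr, by simpa using h.neg⟩

theorem carries_trapToOct :
    Carries (TrapRel t) (HalfRel s) (trapToOct s k) (trap t) univ where
  maps _ _ := mem_univ _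
  per K := ⟨K * 2, fun p _ h => by
    obtain ⟨n, hn, hK, h⟩ := h
    refine ⟨n * 2, by omega, by omega, ?_⟩
    rw [mul_two]
    rcases TrapRel.halfIter hs hk h0 h1 hst h with h | h
    · exact relIter_add.2 ⟨_, h, h⟩
    · exact relIter_add.2 ⟨_, h, by simpa using relIter_halfRel_neg h⟩⟩
  imm p hp h := Immortal.of_map (Z := trap t)
    (fun _ hx hi => TrapRel.exists_of_immortal_oct hs hk h0 h1 hst hx hi) hp h

end TrapToOct

theorem mem_F1_iff {s : ℝ} (hs : 0 < s) {p : ℝ × ℝ} :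
    p ∈ F1 s ↔ -s ≤ p.2 ∧ p.2 ≤ s ∧ -1 ≤ p.1 - p.2 ∧ p.1 - p.2 ≤ 1 := by
  constructor
  · rintro ⟨a, b, ⟨a1, a2⟩, ⟨b1, b2⟩, rfl⟩
    refine ⟨?_, ?_, ?_, ?_⟩ <;> simp only <;> nlinarith
  · rintro ⟨h1, h2, h3, h4⟩
    refine ⟨(p.1 - p.2) / 2, p.2 / (2 * s), ⟨by linarith, by linarith⟩, ⟨?_, ?_⟩, ?_⟩
    · rw [le_div_iff₀ (by linarith)]; linarith
    · rw [div_le_iff₀ (by linarith)]; linarith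
    · ext <;> simp only <;> field_simp
      ring

/-- The part of `X_s` to the left of `F₁ ∩ F₂`. -/
def leftOct (s : ℝ) : Set (ℝ × ℝ) := {p ∈ F1 s | p.1 ≤ -s}

section LeftOct

variable {s t : ℝ} {k : ℕ} (hs : 0 < s) (h0 : 0 < t) (hst : 2 * (s * (k + t)) = 1)

include hs h0 hst

theorem halfIter_central {m : ℤ} (hm : -(k : ℤ) < m) (hm' : m ≤ 0) {x y : ℝ} (x1 : -s < x)
    (x2 : x < s) (y1 : -s < y) (y2 : y < s) :
    relIter (HalfRel s) 4 (2 * s * m + x, y) (2 * s * m + x, y) := by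
  have hm1 : (m : ℝ) ≤ 0 := by exact_mod_cast hm'
  have hm2 : (-k + 1 : ℝ) ≤ m := by exact_mod_cast (show -(k : ℤ) + 1 ≤ m by omega)
  have hsm1 : s * m ≤ s * 0 := mul_le_mul_of_nonneg_left hm1 hs.le
  have hsm2 : s * (-k + 1) ≤ s * m := mul_le_mul_of_nonneg_left hm2 hs.le
  have hsk : s * 1 ≤ s * k :=
    mul_le_mul_of_nonneg_left (by exact_mod_cast (show 1 ≤ k by omega)) hs.le
  have hst' : 0 < s * t := mul_pos hs h0
  have key : ∀ x y : ℝ, -s < x → x < s → -s < y → y < s →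
      HalfRel s (2 * s * m + x, y) (2 * s * m + y, -x) := by
    intro x y h1 h2 h3 h4
    refine ⟨⟨?_, ?_, ?_, ?_⟩, ⟨?_, ?_, ?_, ?_⟩, 0, m, ?_, ?_⟩ <;> push_cast <;> linarith
  have k1 := key x y x1 x2 y1 y2
  have k2 := key y (-x) y1 y2 (by linarith) (by linarith)
  have k3 := key (-x) (-y) (by linarith) (by linarith) (by linarith) (by linarith)
  have k4 := key (-y) x (by linarith) (by linarith) x1 x2
  rw [neg_neg] at k3 k4
  exact ⟨_, ⟨_, ⟨_, ⟨_, rfl, k1⟩, k2⟩, k3⟩, k4⟩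

theorem squareTile_central {m : ℤ} (hm : -(k : ℤ) < m) (hm' : m < 0) :
    SquareTile (HalfRel s) (leftOct s) true (2 * s * m, 0) s := by
  have hm1 : (m : ℝ) ≤ -1 := by exact_mod_cast (show m ≤ -1 by omega)
  have hm2 : (-k + 1 : ℝ) ≤ m := by exact_mod_cast (show -(k : ℤ) + 1 ≤ m by omega)
  have hsm1 : s * m ≤ s * -1 := mul_le_mul_of_nonneg_left hm1 hs.le
  have hsm2 : s * (-k + 1) ≤ s * m := mul_le_mul_of_nonneg_left hm2 hs.le
  have hsk : 0 < s * t := mul_pos hs h0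
  refine ⟨hs, fun p hp => ?_, ⟨4, fun p hp => ?_⟩, fun p hp hi => ?_⟩
  · simp only [sqNorm, Prod.fst_sub, Prod.snd_sub, max_le_iff, abs_le] at hp
    obtain ⟨⟨a1, a2⟩, a3, a4⟩ := hp
    refine ⟨(mem_F1_iff hs).2 ⟨?_, ?_, ?_, ?_⟩, ?_⟩ <;> linarith
  · simp only [sqNorm, Prod.fst_sub, Prod.snd_sub, max_lt_iff, abs_lt] at hp
    obtain ⟨⟨a1, a2⟩, a3, a4⟩ := hp
    refine ⟨4, by norm_num, le_rfl, ?_⟩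
    have h := halfIter_central hs h0 hst hm hm'.le (x := p.1 - 2 * s * m) (y := p.2) a1 a2
      (by linarith) (by linarith)
    rwa [add_sub_cancel] at h
  · obtain ⟨q, ⟨⟨b1, b2, b3, b4⟩, ⟨c1, c2, c3, c4⟩, a, b, e1, e2⟩, -⟩ := hi.step
    simp only [sqNorm, Prod.fst_sub, Prod.snd_sub, sub_zero] at hp
    have hlt : |p.2| < s := abs_lt.2 ⟨b1, b2⟩
    have hx : |p.1 - 2 * s * m| = s := by
      rcases max_choice |p.1 - 2 * s * m| |p.2| with h | h <;> rw [h] at hp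
      · exact hp
      · exact absurd hp hlt.ne
    have hodd : ∃ n : ℤ, p.1 = (2 * n + 1) * s := by
      rcases (abs_eq hs.le).1 hx with h | h
      · exact ⟨m, by linarith⟩
      · exact ⟨m - 1, by push_cast; linarith⟩
    obtain ⟨x1, x2⟩ := abs_le.1 hx.le
    have ha : a = 0 := by
      have i1 : (-1 : ℝ) < a := by linarith
      have i2 : (a : ℝ) < 1 := by linarith
      have i3 : -1 < a := by exact_mod_cast i1
      have i4 : a < 1 := by exact_mod_cast i2
      omega
    subst ha
    obtain ⟨n, hn⟩ := hodd
    have i1 : -s < s * (2 * b - 2 * n - 1) := by push_cast at e1; linarith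
    have i2 : s * (2 * b - 2 * n - 1) < s := by push_cast at e1; linarith
    have j1 : (-1 : ℝ) < 2 * b - 2 * n - 1 := by nlinarith
    have j2 : (2 * b - 2 * n - 1 : ℝ) < 1 := by nlinarith
    have k1 : -1 < 2 * b - 2 * n - 1 := by exact_mod_cast j1
    have k2 : 2 * b - 2 * n - 1 < 1 := by exact_mod_cast j2
    omega

theorem carries_trapToOct_leftOct (hk : 1 ≤ k) (h1 : t < 1 / 2) :
    Carries (TrapRel t) (HalfRel s) (trapToOct s k) (trap t) (leftOct s) := by
  have hk' : (1 : ℝ) ≤ k := by exact_mod_cast hk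
  refine (carries_trapToOct hs hk h0 h1 hst).restrict le_rfl ?_
  rintro ⟨u, η⟩ ⟨a1, a2, a3, a4⟩
  simp only at a1 a2 a3 a4
  have b1 := mul_nonneg hs.le a1
  have b2 := mul_nonneg hs.le a2
  have b3 := mul_le_mul_of_nonneg_left a3 hs.le
  have b4 := mul_le_mul_of_nonneg_left a4 hs.le
  have b5 := mul_le_mul_of_nonneg_left hk' hs.le
  refine ⟨(mem_F1_iff hs).2 ⟨?_, ?_, ?_, ?_⟩, ?_⟩ <;> simp only [trapToOct] <;> linarith

theorem tileDense_leftOct (hk : 1 ≤ k) (ht : GoodParam t) {ε : ℝ} (hε : 0 < ε) :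
    TileDense (HalfRel s) (leftOct s) ε := by
  intro p hp
  have h2s : 0 < 2 * s := by linarith
  obtain ⟨hF, hps⟩ := hp
  obtain ⟨f1, f2, f3, f4⟩ := (mem_F1_iff hs).1 hF
  have hk' : (1 : ℝ) ≤ k := by exact_mod_cast hk
  by_cases hx : p.1 ≤ 2 * s * (-k + 1 / 2)
  · obtain ⟨q, rfl⟩ := (squareSim_trapToOct hs k).surj p
    have le : ∀ x y : ℝ, 2 * s * x ≤ 2 * s * y → x ≤ y := fun x y h =>
      le_of_mul_le_mul_left h h2s
    simp only [trapToOct] at *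
    have hq : q ∈ trap t := by
      refine ⟨?_, ?_, ?_, ?_⟩
      · linarith [le _ _ hx]
      · linarith [le (-1 / 2) (q.2 - 1 / 2) (by linarith)]
      · linarith [le (q.2 - 1 / 2) (1 / 2) (by linarith)]
      · linarith [le (-(k + t)) (-q.1 - k + 1 / 2 - (q.2 - 1 / 2)) (by linarith)]
    have hc := carries_trapToOct_leftOct hs h0 hst hk ht.bounds.2
    have h4 : 0 < (2 * s) ^ 2 := by positivity
    refine ((ht.tileDense (div_pos hε h4) q hq).map (squareSim_trapToOct hs k) h4.le hc).mono
      le_rfl (le_of_eq (by field_simp))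
  · have hm1 := Int.le_ceil (p.1 / (2 * s) - 1 / 2)
    have hm2 := Int.ceil_lt_add_one (p.1 / (2 * s) - 1 / 2)
    set m := ⌈p.1 / (2 * s) - 1 / 2⌉
    have e : p.1 = 2 * s * (p.1 / (2 * s)) := by field_simp
    set x := p.1 / (2 * s)
    have c1 := mul_le_mul_of_nonneg_left hm1 hs.le
    have c2 := mul_lt_mul_of_pos_left hm2 hs
    have d1 : (-k : ℝ) < m := lt_of_mul_lt_mul_left (a := 2 * s) (by linarith) h2s.le
    have d2 : (m : ℝ) < 0 := lt_of_mul_lt_mul_left (a := 2 * s) (by linarith) h2s.le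
    refine (squareTile_central hs h0 hst (m := m) (by exact_mod_cast d1)
      (by exact_mod_cast d2)).nearTile ?_ hε.le
    simp only [sqNorm, Prod.fst_sub, Prod.snd_sub, sub_zero, max_le_iff, abs_le]
    refine ⟨⟨?_, ?_⟩, ?_, ?_⟩ <;> linarith

end LeftOct

/-! ### Iterates of `f_s` and iterates of the rotated half step -/

theorem mem_F2_iff {s : ℝ} (h0 : 0 < s) {p : ℝ × ℝ} :
    p ∈ F2 s ↔ -s ≤ p.1 ∧ p.1 ≤ s ∧ -1 ≤ p.1 + p.2 ∧ p.1 + p.2 ≤ 1 := by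
  constructor
  · rintro ⟨g, hg, rfl⟩
    obtain ⟨h1, h2, h3, h4⟩ := (mem_F1_iff h0).1 hg
    refine ⟨?_, ?_, ?_, ?_⟩ <;> simp only [rotQ] <;> linarith
  · rintro ⟨h1, h2, h3, h4⟩
    refine ⟨(p.2, -p.1), (mem_F1_iff h0).2 ⟨?_, ?_, ?_, ?_⟩, by simp [rotQ]⟩ <;>
      simp only <;> linarith

theorem octInt_subset_F1 {s : ℝ} (h0 : 0 < s) : octInt s ⊆ F1 s := fun _ hp =>
  (mem_F1_iff h0).2 ⟨hp.1.le, hp.2.1.le, hp.2.2.1.le, hp.2.2.2.le⟩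

theorem iterRel_iff {s : ℝ} {n : ℕ} {p q : ℝ × ℝ} : IterRel s n p q ↔ relIter (MapRel s) n p q := by
  induction n generalizing q with
  | zero => rfl
  | succ n ih => simp only [IterRel, relIter, ih]

theorem int_eq_zero_of_abs_lt {m : ℤ} {a : ℝ} (ha : 0 < a) (h1 : -a < a * m) (h2 : a * m < a) :
    m = 0 := by
  have e1 : (-1 : ℝ) < m := by nlinarith
  have e2 : (m : ℝ) < 1 := by nlinarith
  have e3 : -1 < m := by exact_mod_cast e1
  have e4 : m < 1 := by exact_mod_cast e2
  omega

theorem exists_int_translate {s : ℝ} (h0 : 0 < s) (x : ℝ) :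
    ∃ n : ℤ, -s ≤ x + 2 * s * n ∧ x + 2 * s * n ≤ s := by
  have h2 : 0 < 2 * s := by linarith
  have e : 2 * s * (x / (2 * s)) = x := by field_simp
  have h := abs_le.1 (abs_sub_round (x / (2 * s)))
  refine ⟨-round (x / (2 * s)), ?_, ?_⟩ <;> push_cast <;> nlinarith

theorem StepRel.eq_of_mem {s : ℝ} {p q : ℝ × ℝ} (h1 : p ∈ F1 s) (h2 : p ∈ F2 s) (h : StepRel s p q) :
    q = p := by
  obtain ⟨j, -, ⟨v, -, hv⟩, hq, hq'⟩ := h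
  have e1 := hv (q - p) ⟨hq, by simpa using hq'⟩
  have e2 := hv 0 ⟨?_, ?_⟩
  · exact sub_eq_zero.1 (e1.trans e2.symm)
  · fin_cases j
    · exact ⟨0, 0, by simp; rfl⟩
    · exact ⟨0, 0, by simp; rfl⟩
  · rw [add_zero]
    fin_cases j
    · exact h2
    · exact h1

theorem eq_of_relIter_mapRel {s : ℝ} {p q : ℝ × ℝ} (h1 : p ∈ F1 s) (h2 : p ∈ F2 s) {n : ℕ}
    (h : relIter (MapRel s) n p q) : q = p := by
  induction n generalizing q with
  | zero => exact Eq.symm h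
  | succ n ih =>
    obtain ⟨r, hr, x, hx, hq⟩ := h
    obtain rfl := ih hr
    obtain rfl := hx.eq_of_mem h1 h2
    exact hq.eq_of_mem h1 h2

section Steps

variable {s : ℝ} (h0 : 0 < s)

include h0

theorem stepRel_of_mem_F1 {p r : ℝ × ℝ} (hp : p ∈ F1 s) (hr1 : -s < r.1) (hr2 : r.1 < s)
    (hr3 : -1 < r.1 + r.2) (hr4 : r.1 + r.2 < 1) (hv : r - p ∈ L2 s) : StepRel s p r := by
  have hr : r ∈ F2 s := (mem_F2_iff h0).2 ⟨hr1.le, hr2.le, hr3.le, hr4.le⟩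
  refine ⟨0, hp, ⟨r - p, ⟨hv, by simpa [FF] using hr⟩, ?_⟩, hv, hr⟩
  rintro v ⟨⟨m, n, hmn⟩, hpv⟩
  obtain ⟨m', n', hmn'⟩ := hv
  obtain ⟨c1, c2, c3, c4⟩ := (mem_F2_iff h0).1 (show p + v ∈ F2 s from hpv)
  subst hmn
  have e1 := congrArg Prod.fst hmn'
  have e2 := congrArg Prod.snd hmn'
  simp only [Prod.fst_sub, Prod.snd_sub, Prod.fst_add, Prod.snd_add] at *
  have hm : m - m' = 0 :=
    int_eq_zero_of_abs_lt two_pos (by push_cast; linarith) (by push_cast; linarith)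
  obtain rfl : m = m' := by omega
  have hn : n - n' = 0 := int_eq_zero_of_abs_lt (a := 2 * s) (by linarith)
    (by push_cast; linarith) (by push_cast; linarith)
  obtain rfl : n = n' := by omega
  exact hmn'.symm

theorem stepRel_of_mem_F2 {p r : ℝ × ℝ} (hp : p ∈ F2 s) (hr : r ∈ octInt s)
    (hv : r - p ∈ L1 s) : StepRel s p r := by
  refine ⟨1, hp, ⟨r - p, ⟨hv, by simpa [FF] using octInt_subset_F1 h0 hr⟩, ?_⟩, hv,
    octInt_subset_F1 h0 hr⟩
  rintro v ⟨⟨m, n, hmn⟩, hpv⟩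
  obtain ⟨m', n', hmn'⟩ := hv
  obtain ⟨c1, c2, c3, c4⟩ := (mem_F1_iff h0).1 (show p + v ∈ F1 s from hpv)
  obtain ⟨hr1, hr2, hr3, hr4⟩ := hr
  subst hmn
  have e1 := congrArg Prod.fst hmn'
  have e2 := congrArg Prod.snd hmn'
  simp only [Prod.fst_sub, Prod.snd_sub, Prod.fst_add, Prod.snd_add] at *
  have hm : m - m' = 0 :=
    int_eq_zero_of_abs_lt two_pos (by push_cast; linarith) (by push_cast; linarith)
  obtain rfl : m = m' := by omega
  have hn : n - n' = 0 := int_eq_zero_of_abs_lt (a := 2 * s) (by linarith)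
    (by push_cast; linarith) (by push_cast; linarith)
  obtain rfl : n = n' := by omega
  exact hmn'.symm

theorem HalfRel.mapRel {p g q : ℝ × ℝ} (h : HalfRel s p g) (h' : HalfRel s g q) :
    MapRel s p (-q) := by
  obtain ⟨hp, hg, a, b, e1, e2⟩ := h
  obtain ⟨-, hq, a', b', e1', e2'⟩ := h'
  refine ⟨rotQ g, stepRel_of_mem_F1 h0 (octInt_subset_F1 h0 hp) ?_ ?_ ?_ ?_ ⟨-a, -b, ?_⟩,
    stepRel_of_mem_F2 h0 ⟨g, octInt_subset_F1 h0 hg, rfl⟩ (neg_mem_octInt hq) ⟨-a', -b', ?_⟩⟩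
  iterate 4
    obtain ⟨g1, g2, g3, g4⟩ := hg
    simp only [rotQ]
    linarith
  all_goals
    ext <;> simp only [rotQ, Prod.fst_sub, Prod.snd_sub, Prod.fst_neg, Prod.snd_neg] <;>
      push_cast <;> linarith

theorem iterRel_of_relIter_halfRel {n : ℕ} {p : ℝ × ℝ} (h : relIter (HalfRel s) n p p) :
    IterRel s (2 * n) p p := by
  have key : ∀ m q, relIter (HalfRel s) (4 * m) p q → relIter (MapRel s) (2 * m) p q := by
    intro m
    induction m with
    | zero => exact fun q h => h
    | succ m ih =>
      rintro q ⟨r3, ⟨r2, ⟨r1, ⟨r0, h0', h1⟩, h2⟩, h3⟩, h4⟩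
      exact ⟨-r2, ⟨r0, ih _ h0', h1.mapRel h0 h2⟩, by simpa using h3.neg.mapRel h0 h4.neg⟩
  rw [iterRel_iff]
  refine key n p ?_
  rw [mul_comm]
  exact relIter_mul h 4

theorem iterRel_of_abs_le {p : ℝ × ℝ} (hp : p ∈ octInt s) (hs : s < 1 / 2) (h1 : -s ≤ p.1)
    (h2 : p.1 ≤ s) (n : ℕ) : IterRel s n p p := by
  have hstep : StepRel s p p := stepRel_of_mem_F2 h0 ((mem_F2_iff h0).2
    ⟨h1, h2, by linarith [hp.1], by linarith [hp.2.1]⟩) hp ⟨0, 0, by simp; rfl⟩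
  induction n with
  | zero => rfl
  | succ n ih => exact ⟨p, ih, p, hstep, hstep⟩

theorem stepRel_interior_F2 {p r : ℝ × ℝ} (hp : p ∉ F2 s) (h : StepRel s p r) :
    r ∈ F2 s ∧ r - p ∈ L2 s ∧ -s < r.1 ∧ r.1 < s ∧ -1 < r.1 + r.2 ∧ r.1 + r.2 < 1 := by
  obtain ⟨j, hj, ⟨v, -, hv⟩, hq, hr⟩ := h
  fin_cases j
  swap
  · exact absurd hj hp
  change r - p ∈ L2 s at hq
  change r ∈ F2 s at hr
  obtain ⟨m, n, hmn⟩ := hq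
  have e1 := congrArg Prod.fst hmn
  have e2 := congrArg Prod.snd hmn
  simp only [Prod.fst_sub, Prod.snd_sub] at e1 e2
  obtain ⟨c1, c2, c3, c4⟩ := (mem_F2_iff h0).1 hr
  have hu : ∀ m' n' : ℤ, -s ≤ r.1 + 2 * m' + 2 * s * n' → r.1 + 2 * m' + 2 * s * n' ≤ s →
      -1 ≤ r.1 + r.2 + 2 * m' → r.1 + r.2 + 2 * m' ≤ 1 → 2 * m' + 2 * s * n' = 0 ∧ n' = 0 := by
    intro m' n' d1 d2 d3 d4
    have t1 := hv (r - p) ⟨⟨m, n, hmn⟩, by rw [add_sub_cancel]; exact hr⟩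
    have t2 := hv (r - p + (2 * m' + 2 * s * n', -(2 * s * n')))
      ⟨⟨m + m', n + n', by rw [hmn]; ext <;> simp only [Prod.mk_add_mk] <;> push_cast <;> ring⟩, by
        rw [← add_assoc, add_sub_cancel]
        refine (mem_F2_iff h0).2 ⟨?_, ?_, ?_, ?_⟩ <;>
          simp only [Prod.fst_add, Prod.snd_add] <;> linarith⟩
    have t3 := t2.trans t1.symm
    rw [add_eq_left] at t3
    obtain ⟨t4, t5⟩ := Prod.mk.inj t3
    refine ⟨t4, ?_⟩
    have : (n' : ℝ) = 0 := by
      have hne : 2 * s ≠ 0 := by positivity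
      exact (mul_eq_zero.1 (neg_eq_zero.1 t5)).resolve_left hne
    exact_mod_cast this
  refine ⟨hr, ⟨m, n, hmn⟩, c1.lt_of_ne ?_, c2.lt_of_ne ?_, c3.lt_of_ne ?_, c4.lt_of_ne ?_⟩
  · intro hc
    simpa using (hu 0 1 (by push_cast; linarith) (by push_cast; linarith) (by push_cast; linarith)
      (by push_cast; linarith)).2
  · intro hc
    simpa using (hu 0 (-1) (by push_cast; linarith) (by push_cast; linarith)
      (by push_cast; linarith) (by push_cast; linarith)).2
  · intro hc
    obtain ⟨b, b1, b2⟩ := exists_int_translate h0 (r.1 + 2)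
    obtain ⟨t1, rfl⟩ := hu 1 b (by push_cast; linarith) (by push_cast; linarith)
      (by push_cast; linarith) (by push_cast; linarith)
    norm_num at t1
  · intro hc
    obtain ⟨b, b1, b2⟩ := exists_int_translate h0 (r.1 - 2)
    obtain ⟨t1, rfl⟩ := hu (-1) b (by push_cast; linarith) (by push_cast; linarith)
      (by push_cast; linarith) (by push_cast; linarith)
    norm_num at t1

theorem stepRel_interior_F1 {p r : ℝ × ℝ} (hp : p ∉ F1 s) (h : StepRel s p r) :
    r - p ∈ L1 s ∧ r ∈ octInt s := by
  obtain ⟨j, hj, ⟨v, -, hv⟩, hq, hr⟩ := h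
  fin_cases j
  · exact absurd hj hp
  change r - p ∈ L1 s at hq
  change r ∈ F1 s at hr
  obtain ⟨m, n, hmn⟩ := hq
  have e1 := congrArg Prod.fst hmn
  have e2 := congrArg Prod.snd hmn
  simp only [Prod.fst_sub, Prod.snd_sub] at e1 e2
  obtain ⟨c1, c2, c3, c4⟩ := (mem_F1_iff h0).1 hr
  have hu : ∀ m' n' : ℤ, -s ≤ r.2 + 2 * m' + 2 * s * n' → r.2 + 2 * m' + 2 * s * n' ≤ s →
      -1 ≤ r.1 - r.2 - 2 * m' → r.1 - r.2 - 2 * m' ≤ 1 → 2 * m' + 2 * s * n' = 0 ∧ n' = 0 := by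
    intro m' n' d1 d2 d3 d4
    have t1 := hv (r - p) ⟨⟨m, n, hmn⟩, by rw [add_sub_cancel]; exact hr⟩
    have t2 := hv (r - p + (2 * s * n', 2 * m' + 2 * s * n'))
      ⟨⟨m + m', n + n', by rw [hmn]; ext <;> simp only [Prod.mk_add_mk] <;> push_cast <;> ring⟩, by
        rw [← add_assoc, add_sub_cancel]
        refine (mem_F1_iff h0).2 ⟨?_, ?_, ?_, ?_⟩ <;>
          simp only [Prod.fst_add, Prod.snd_add] <;> linarith⟩
    have t3 := t2.trans t1.symm
    rw [add_eq_left] at t3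
    obtain ⟨t4, t5⟩ := Prod.mk.inj t3
    refine ⟨t5, ?_⟩
    have : (n' : ℝ) = 0 := by
      have hne : 2 * s ≠ 0 := by positivity
      exact (mul_eq_zero.1 t4).resolve_left hne
    exact_mod_cast this
  refine ⟨⟨m, n, hmn⟩, c1.lt_of_ne ?_, c2.lt_of_ne ?_, c3.lt_of_ne ?_, c4.lt_of_ne ?_⟩
  · intro hc
    simpa using (hu 0 1 (by push_cast; linarith) (by push_cast; linarith) (by push_cast; linarith)
      (by push_cast; linarith)).2
  · intro hc
    simpa using (hu 0 (-1) (by push_cast; linarith) (by push_cast; linarith)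
      (by push_cast; linarith) (by push_cast; linarith)).2
  · intro hc
    obtain ⟨b, b1, b2⟩ := exists_int_translate h0 (r.2 - 2)
    obtain ⟨t1, rfl⟩ := hu (-1) b (by push_cast; linarith) (by push_cast; linarith)
      (by push_cast; linarith) (by push_cast; linarith)
    norm_num at t1
  · intro hc
    obtain ⟨b, b1, b2⟩ := exists_int_translate h0 (r.2 + 2)
    obtain ⟨t1, rfl⟩ := hu 1 b (by push_cast; linarith) (by push_cast; linarith)
      (by push_cast; linarith) (by push_cast; linarith)
    norm_num at t1

theorem immortal_of_iterRel_of_notMem {p : ℝ × ℝ} (hp : p ∈ octInt s) (hp' : p ∉ F2 s) {n : ℕ}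
    (hn : 0 < n) (h : IterRel s n p p) : Immortal (HalfRel s) p := by
  let S : Set (ℝ × ℝ) :=
    {x | x ∈ octInt s ∧ x ∉ F2 s ∧ ∃ n, 0 < n ∧ relIter (MapRel s) n x x}
  have hS : ∀ x ∈ S, ∃ g, HalfRel s x g ∧ ∃ w ∈ S, HalfRel s g (-w) := by
    rintro x ⟨hx, hx', n, hn, h⟩
    obtain ⟨n, rfl⟩ := Nat.exists_eq_succ_of_ne_zero hn.ne'
    obtain ⟨w, ⟨r, hr, hw⟩, hwx⟩ := relIter_head.1 h
    obtain ⟨hr2, ⟨m, b, hv⟩, r1, r2, r3, r4⟩ := stepRel_interior_F2 h0 hx' hr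
    have hr1 : r ∉ F1 s := fun hr1 => by
      obtain rfl := hw.eq_of_mem hr1 hr2
      obtain rfl := eq_of_relIter_mapRel hr1 hr2 hwx
      exact hx' hr2
    obtain ⟨⟨m', b', hv'⟩, hw1⟩ := stepRel_interior_F1 h0 hr1 hw
    have hw2 : w ∉ F2 s := fun hw2 => by
      obtain rfl := eq_of_relIter_mapRel (octInt_subset_F1 h0 hw1) hw2 hwx
      exact hx' hw2
    have hg : (r.2, -r.1) ∈ octInt s := by
      refine ⟨?_, ?_, ?_, ?_⟩ <;> simp only <;> linarith
    have e1 := congrArg Prod.fst hv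
    have e2 := congrArg Prod.snd hv
    have e1' := congrArg Prod.fst hv'
    have e2' := congrArg Prod.snd hv'
    simp only [Prod.fst_sub, Prod.snd_sub] at e1 e2 e1' e2'
    refine ⟨(r.2, -r.1), ⟨hx, hg, -m, -b, ?_, ?_⟩, w,
      ⟨hw1, hw2, n + 1, n.succ_pos, relIter_rotate ⟨r, hr, hw⟩ hwx⟩,
      ⟨hg, neg_mem_octInt hw1, -m', -b', ?_, ?_⟩⟩ <;>
      simp only [Prod.fst_neg, Prod.snd_neg] <;> push_cast <;> linarith
  refine ⟨{x | (x ∈ S ∨ -x ∈ S) ∨ ∃ z, HalfRel s x z ∧ (z ∈ S ∨ -z ∈ S)},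
    Or.inl (Or.inl ⟨hp, hp', n, hn, iterRel_iff.1 h⟩), ?_⟩
  rintro x ((hx | hx) | ⟨z, hxz, hz⟩)
  · obtain ⟨g, hg, w, hw, hgw⟩ := hS x hx
    exact ⟨g, Or.inr ⟨-w, hgw, Or.inr (by simpa using hw)⟩, hg⟩
  · obtain ⟨g, hg, w, hw, hgw⟩ := hS _ hx
    exact ⟨-g, Or.inr ⟨w, by simpa using hgw.neg, Or.inl hw⟩, by simpa using hg.neg⟩
  · exact ⟨z, Or.inl hz, hxz⟩

end Steps

theorem immortal_of_iterRel {s t : ℝ} {k : ℕ} (h0 : 0 < s) (ht : 0 < t)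
    (hst : 2 * (s * (k + t)) = 1) (hk : 1 ≤ k) {p : ℝ × ℝ} (hp : p ∈ octInt s)
    (hp1 : p.1 ≠ -s) (hp2 : p.1 ≠ s) {n : ℕ} (hn : 0 < n) (h : IterRel s n p p) :
    Immortal (HalfRel s) p := by
  by_cases hF : p ∈ F2 s
  · obtain ⟨c1, c2, -, -⟩ := (mem_F2_iff h0).1 hF
    have := halfIter_central h0 ht hst (m := 0) (by omega) le_rfl (lt_of_le_of_ne c1 hp1.symm)
      (lt_of_le_of_ne c2 hp2) hp.1 hp.2.1
    simp only [Int.cast_zero, mul_zero, zero_add] at this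
    exact PeriodicWithin.immortal (K := 4) ⟨4, by norm_num, le_rfl, this⟩
  · exact immortal_of_iterRel_of_notMem h0 hp hF hn h

/-! ### Closed and open squares -/

/-- The closed box or diamond with centre `c` and radius `r`. -/
def sqClosed (i : Bool) (c : ℝ × ℝ) (r : ℝ) : Set (ℝ × ℝ) := {p | sqNorm i (p - c) ≤ r}

/-- The open box or diamond with centre `c` and radius `r`. -/
def sqOpen (i : Bool) (c : ℝ × ℝ) (r : ℝ) : Set (ℝ × ℝ) := {p | sqNorm i (p - c) < r}

theorem mem_sqClosed_true {c p : ℝ × ℝ} {r : ℝ} : p ∈ sqClosed true c r ↔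
    c.1 - r ≤ p.1 ∧ p.1 ≤ c.1 + r ∧ c.2 - r ≤ p.2 ∧ p.2 ≤ c.2 + r := by
  simp only [sqClosed, sqNorm, mem_ofPred_eq, max_le_iff, abs_le, Prod.fst_sub, Prod.snd_sub]
  constructor
  · rintro ⟨⟨h1, h2⟩, h3, h4⟩
    refine ⟨?_, ?_, ?_, ?_⟩ <;> linarith
  · rintro ⟨h1, h2, h3, h4⟩
    refine ⟨⟨?_, ?_⟩, ?_, ?_⟩ <;> linarith

theorem mem_sqOpen_true {c p : ℝ × ℝ} {r : ℝ} : p ∈ sqOpen true c r ↔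
    c.1 - r < p.1 ∧ p.1 < c.1 + r ∧ c.2 - r < p.2 ∧ p.2 < c.2 + r := by
  simp only [sqOpen, sqNorm, mem_ofPred_eq, max_lt_iff, abs_lt, Prod.fst_sub, Prod.snd_sub]
  constructor
  · rintro ⟨⟨h1, h2⟩, h3, h4⟩
    refine ⟨?_, ?_, ?_, ?_⟩ <;> linarith
  · rintro ⟨h1, h2, h3, h4⟩
    refine ⟨⟨?_, ?_⟩, ?_, ?_⟩ <;> linarith

theorem mem_sqClosed_false {c p : ℝ × ℝ} {r : ℝ} : p ∈ sqClosed false c r ↔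
    |p.1 - c.1| + |p.2 - c.2| ≤ r := Iff.rfl

theorem continuous_sqNorm (i : Bool) : Continuous (sqNorm i) := by
  cases i
  · exact continuous_fst.abs.add continuous_snd.abs
  · exact continuous_fst.abs.max continuous_snd.abs

theorem sqNorm_smul (i : Bool) {a : ℝ} (ha : 0 ≤ a) (p : ℝ × ℝ) :
    sqNorm i (a • p) = a * sqNorm i p := by
  cases i <;> simp only [sqNorm, Prod.smul_fst, Prod.smul_snd, smul_eq_mul, abs_mul,
    abs_of_nonneg ha, mul_add, mul_max_of_nonneg _ _ ha]

theorem sqNorm_add_le (i : Bool) (p q : ℝ × ℝ) : sqNorm i (p + q) ≤ sqNorm i p + sqNorm i q := by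
  cases i
  · have h1 := abs_add_le p.1 q.1
    have h2 := abs_add_le p.2 q.2
    simp only [sqNorm, Prod.fst_add, Prod.snd_add]
    linarith
  · exact max_le ((abs_add_le _ _).trans (add_le_add (le_max_left _ _) (le_max_left _ _)))
      ((abs_add_le _ _).trans (add_le_add (le_max_right _ _) (le_max_right _ _)))

theorem sqNorm_zero (i : Bool) : sqNorm i 0 = 0 := by
  cases i <;> simp [sqNorm]

theorem convexOn_sqNorm_sub (i : Bool) (c : ℝ × ℝ) :
    ConvexOn ℝ univ (fun p => sqNorm i (p - c)) := by
  refine ⟨convex_univ, fun x _ y _ a b ha hb hab => ?_⟩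
  have e : a • x + b • y - c = a • (x - c) + b • (y - c) := by
    rw [smul_sub, smul_sub, sub_add_sub_comm, ← add_smul, hab, one_smul]
  simp only [e, smul_eq_mul, ← sqNorm_smul i ha, ← sqNorm_smul i hb]
  exact sqNorm_add_le _ _ _

section Squares

variable {i : Bool} {c : ℝ × ℝ} {r : ℝ}

theorem convex_sqClosed : Convex ℝ (sqClosed i c r) := by
  simpa [sqClosed] using (convexOn_sqNorm_sub i c).convex_le r

theorem convex_sqOpen : Convex ℝ (sqOpen i c r) := by
  simpa [sqOpen] using (convexOn_sqNorm_sub i c).convex_lt r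

theorem isOpen_sqOpen : IsOpen (sqOpen i c r) :=
  isOpen_lt ((continuous_sqNorm i).comp (continuous_sub_right c)) continuous_const

theorem isClosed_sqClosed : IsClosed (sqClosed i c r) :=
  isClosed_le ((continuous_sqNorm i).comp (continuous_sub_right c)) continuous_const

theorem sqOpen_subset_sqClosed : sqOpen i c r ⊆ sqClosed i c r := fun p h =>
  (show sqNorm i (p - c) < r from h).le

theorem center_mem_sqOpen (hr : 0 < r) : c ∈ sqOpen i c r := by
  simpa [sqOpen, sqNorm_zero] using hr

theorem interior_sqClosed (hr : 0 < r) : interior (sqClosed i c r) = sqOpen i c r := by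
  refine Subset.antisymm (fun p hp => ?_)
    (interior_maximal sqOpen_subset_sqClosed isOpen_sqOpen)
  have hp1 : p ∈ sqClosed i c r := interior_subset hp
  rcases (show sqNorm i (p - c) ≤ r from hp1).lt_or_eq with h | h
  · exact h
  have hcont : Tendsto (fun a : ℝ => c + (1 + a) • (p - c)) (𝓝[>] 0) (𝓝 p) := by
    refine tendsto_nhdsWithin_of_tendsto_nhds ?_
    have : Continuous fun a : ℝ => c + (1 + a) • (p - c) := by fun_prop
    simpa using this.tendsto 0
  obtain ⟨a, h1, h2⟩ := ((hcont.eventually (mem_interior_iff_mem_nhds.1 hp)).and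
    self_mem_nhdsWithin).exists
  replace h1 : sqNorm i (c + (1 + a) • (p - c) - c) ≤ r := h1
  rw [add_sub_cancel_left, sqNorm_smul i (by linarith), h] at h1
  nlinarith

theorem closure_sqOpen (hr : 0 < r) : closure (sqOpen i c r) = sqClosed i c r := by
  rw [← interior_sqClosed hr, convex_sqClosed.closure_interior_eq_closure_of_nonempty_interior,
    isClosed_sqClosed.closure_eq]
  exact ⟨c, interior_sqClosed hr ▸ center_mem_sqOpen hr⟩

end Squares

theorem sqClosed_true_eq_Icc (c : ℝ × ℝ) (r : ℝ) :
    sqClosed true c r = Icc (c - (r, r)) (c + (r, r)) := by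
  ext p
  rw [mem_sqClosed_true, mem_Icc, Prod.le_def, Prod.le_def]
  simp only [Prod.fst_sub, Prod.snd_sub, Prod.fst_add, Prod.snd_add]
  tauto

theorem IsBox.exists_sqClosed {P : Set (ℝ × ℝ)} (h : IsBox P) :
    ∃ c r, 0 < r ∧ P = sqClosed true c r := by
  obtain ⟨p, a, ha, rfl⟩ := h
  refine ⟨p + (a / 2, a / 2), a / 2, by linarith, ?_⟩
  rw [sqClosed_true_eq_Icc]
  congr 1
  · simp
  · rw [add_assoc]; simp

theorem convexHull_tips {c : ℝ × ℝ} {r : ℝ} (hr : 0 < r) :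
    convexHull ℝ {c + (r, 0), c - (r, 0), c + (0, r), c - (0, r)} = sqClosed false c r := by
  refine Subset.antisymm (convexHull_min ?_ convex_sqClosed) fun p hp => ?_
  · simp only [insert_subset_iff, singleton_subset_iff, mem_sqClosed_false]
    simp [abs_of_pos hr]
  · set T : Set (ℝ × ℝ) := {c + (r, 0), c - (r, 0), c + (0, r), c - (0, r)}
    have hT : ∀ x ∈ T, x ∈ convexHull ℝ T := fun x hx => subset_convexHull ℝ T hx
    have hc := convex_convexHull ℝ T
    have hcen : c ∈ convexHull ℝ T := by
      have := hc (hT (c + (r, 0)) (by simp [T])) (hT (c - (r, 0)) (by simp [T]))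
        (a := 1 / 2) (b := 1 / 2) (by norm_num) (by norm_num) (by norm_num)
      convert this using 1
      ext <;> simp <;> ring
    rw [mem_sqClosed_false] at hp
    have key : ∀ u ∈ T, ∀ v ∈ T, ∀ a b : ℝ, 0 ≤ a → 0 ≤ b → a + b ≤ r →
        p = c + (a / r) • (u - c) + (b / r) • (v - c) → p ∈ convexHull ℝ T := by
      intro u hu v hv a b ha hb hab hp
      have h1 := hc.sum_mem (t := Finset.univ) (w := ![1 - a / r - b / r, a / r, b / r])
        (z := ![c, u, v]) ?_ ?_ ?_
      · convert h1 using 1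
        rw [hp, Fin.sum_univ_three]
        simp only [Matrix.cons_val]
        module
      · intro j _
        have : a / r + b / r ≤ 1 := by rw [← add_div, div_le_one hr]; exact hab
        fin_cases j
        · simp only [Fin.zero_eta, Matrix.cons_val]; linarith
        · simp only [Fin.mk_one, Matrix.cons_val]; positivity
        · simp only [Fin.reduceFinMk, Matrix.cons_val]; positivity
      · rw [Fin.sum_univ_three]; simp only [Matrix.cons_val]; ring
      · intro j _
        fin_cases j
        · exact hcen
        · exact hT u hu
        · exact hT v hv
    have hr' := hr.ne'
    rcases abs_cases (p.1 - c.1) with ⟨e1, l1⟩ | ⟨e1, l1⟩ <;>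
      rcases abs_cases (p.2 - c.2) with ⟨e2, l2⟩ | ⟨e2, l2⟩ <;> rw [e1, e2] at hp
    · refine key (c + (r, 0)) (by simp [T]) (c + (0, r)) (by simp [T]) _ _ l1 l2 hp ?_
      ext <;> simp [hr']
    · refine key (c + (r, 0)) (by simp [T]) (c - (0, r)) (by simp [T]) _ _ l1 (by linarith) hp ?_
      ext <;> simp [hr']
    · refine key (c - (r, 0)) (by simp [T]) (c + (0, r)) (by simp [T]) _ _ (by linarith) l2 hp ?_
      ext <;> simp [hr']
    · refine key (c - (r, 0)) (by simp [T]) (c - (0, r)) (by simp [T]) _ _ (by linarith)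
        (by linarith) hp ?_
      ext <;> simp [hr']

theorem IsDiamond.exists_sqClosed {P : Set (ℝ × ℝ)} (h : IsDiamond P) :
    ∃ c r, 0 < r ∧ P = sqClosed false c r := by
  obtain ⟨p, a, ha, rfl⟩ := h
  exact ⟨p, a, ha, convexHull_tips ha⟩

theorem isConvexPolygon_sqClosed {i : Bool} {c : ℝ × ℝ} {r : ℝ} (hr : 0 < r) :
    IsConvexPolygon (sqClosed i c r) := by
  classical
  refine ⟨?_, c, interior_sqClosed hr ▸ center_mem_sqOpen hr⟩
  cases i
  · refine ⟨{c + (r, 0), c - (r, 0), c + (0, r), c - (0, r)}, ?_⟩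
    rw [← convexHull_tips hr]
    push_cast
    rfl
  · refine ⟨{c.1 - r, c.1 + r} ×ˢ {c.2 - r, c.2 + r}, ?_⟩
    rw [sqClosed_true_eq_Icc, Finset.coe_product, convexHull_prod]
    push_cast
    rw [convexHull_pair, convexHull_pair, segment_eq_Icc (by linarith),
      segment_eq_Icc (by linarith), Icc_prod_Icc]
    rfl

theorem sqClosed_inj_type {i j : Bool} {c d : ℝ × ℝ} {r q : ℝ} (hr : 0 < r) (hq : 0 < q)
    (h : sqClosed i c r = sqClosed j d q) : i = j := by
  have key : ∀ {c d : ℝ × ℝ} {r q : ℝ}, 0 < r → 0 < q →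
      sqClosed true c r ≠ sqClosed false d q := by
    intro c d r q hr hq h
    have h1 : (c.1 + r, c.2 + r) ∈ sqClosed false d q := by
      rw [← h, mem_sqClosed_true]; refine ⟨?_, ?_, ?_, ?_⟩ <;> simp only <;> linarith
    have h2 : (c.1 - r, c.2 - r) ∈ sqClosed false d q := by
      rw [← h, mem_sqClosed_true]; refine ⟨?_, ?_, ?_, ?_⟩ <;> simp only <;> linarith
    have h3 : (d.1 + q, d.2) ∈ sqClosed true c r := by
      rw [h, mem_sqClosed_false]; simp [abs_of_pos hq]
    have h4 : (d.1 - q, d.2) ∈ sqClosed true c r := by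
      rw [h, mem_sqClosed_false]; simp [abs_of_pos hq]
    rw [mem_sqClosed_false] at h1 h2
    rw [mem_sqClosed_true] at h3 h4
    obtain ⟨-, h3, -⟩ := h3
    obtain ⟨h4, -⟩ := h4
    simp only at *
    linarith [le_abs_self (c.1 + r - d.1), le_abs_self (c.2 + r - d.2),
      neg_abs_le (c.1 - r - d.1), neg_abs_le (c.2 - r - d.2)]
  cases i <;> cases j
  · rfl
  · exact absurd h.symm (key hq hr)
  · exact absurd h (key hr hq)
  · rfl

/-! ### Periodic polygons -/

/-- A convex polygon in `X_s` whose interior consists of points with a common period. -/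
def PeriodicPolygon (s : ℝ) (Q : Set (ℝ × ℝ)) : Prop :=
  IsConvexPolygon Q ∧ Q ⊆ F1 s ∧ ∃ n, 0 < n ∧ ∀ p ∈ interior Q, IterRel s n p p

section Polygons

variable {Q : Set (ℝ × ℝ)}

theorem IsConvexPolygon.convex (h : IsConvexPolygon Q) : Convex ℝ Q := by
  obtain ⟨⟨V, rfl⟩, -⟩ := h
  exact convex_convexHull ℝ _

theorem IsConvexPolygon.isClosed (h : IsConvexPolygon Q) : IsClosed Q := by
  obtain ⟨⟨V, rfl⟩, -⟩ := h
  exact V.finite_toSet.isClosed_convexHull ℝ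

theorem IsConvexPolygon.closure_interior (h : IsConvexPolygon Q) : closure (interior Q) = Q := by
  rw [h.convex.closure_interior_eq_closure_of_nonempty_interior h.2, h.isClosed.closure_eq]

theorem IsConvexPolygon.mem_closure_inter (h : IsConvexPolygon Q) (f : ℝ × ℝ →L[ℝ] ℝ) {a : ℝ}
    {v q : ℝ × ℝ} (hv : v ∈ Q) (hq : q ∈ Q) (hfv : a ≤ f v) (hfq : a < f q) :
    v ∈ closure (interior Q ∩ {x | a < f x}) := by
  have hopen : IsOpen {x | a < f x} := isOpen_lt continuous_const f.continuous
  have hmem : ∀ᶠ b in 𝓝[>] (0 : ℝ), v + b • (q - v) ∈ closure (interior Q ∩ {x | a < f x}) := by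
    filter_upwards [Ioc_mem_nhdsGT one_pos] with b hb
    refine hopen.closure_inter ⟨?_, ?_⟩
    · rw [h.closure_interior]
      exact h.convex.add_smul_sub_mem hv hq ⟨hb.1.le, hb.2⟩
    · simp only [mem_ofPred_eq, map_add, map_smul, map_sub, smul_eq_mul]
      nlinarith [hb.1, hb.2]
  have hcont : Tendsto (fun b : ℝ => v + b • (q - v)) (𝓝[>] 0) (𝓝 v) := by
    refine tendsto_nhdsWithin_of_tendsto_nhds ?_
    have : Continuous fun b : ℝ => v + b • (q - v) := by fun_prop
    simpa using this.tendsto 0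
  exact isClosed_closure.mem_of_tendsto hcont hmem

end Polygons

theorem interior_F1_subset {s : ℝ} (h0 : 0 < s) : interior (F1 s) ⊆ octInt s := by
  intro p hp
  have h1 := isOpenMap_snd.mapsTo_interior (s := F1 s) (t := Icc (-s) s)
    (fun q hq => ⟨((mem_F1_iff h0).1 hq).1, ((mem_F1_iff h0).1 hq).2.1⟩) hp
  let f : ℝ × ℝ →L[ℝ] ℝ := ContinuousLinearMap.fst ℝ ℝ ℝ - ContinuousLinearMap.snd ℝ ℝ ℝ
  have hf : Function.Surjective f := fun x => ⟨(x, 0), by simp [f]⟩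
  have h2 := (f.isOpenMap hf).mapsTo_interior (s := F1 s) (t := Icc (-1) 1)
    (fun q hq => ⟨((mem_F1_iff h0).1 hq).2.2.1, ((mem_F1_iff h0).1 hq).2.2.2⟩) hp
  rw [interior_Icc] at h1 h2
  exact ⟨h1.1, h1.2, h2.1, h2.2⟩

section SquareTiles

variable {R : ℝ × ℝ → ℝ × ℝ → Prop} {Z : Set (ℝ × ℝ)} {i j : Bool} {c d : ℝ × ℝ} {r q : ℝ}

theorem SquareTile.subset_sqOpen (h : SquareTile R Z i c r) {S : Set (ℝ × ℝ)}
    (hS : IsPreconnected S) (hi : ∀ p ∈ S, Immortal R p) (hm : (S ∩ sqOpen i c r).Nonempty) :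
    S ⊆ sqOpen i c r := by
  have ho : IsOpen {p | r < sqNorm i (p - c)} :=
    isOpen_lt continuous_const ((continuous_sqNorm i).comp (continuous_sub_right c))
  refine hS.subset_left_of_subset_union isOpen_sqOpen ho ?_ (fun p hp => ?_) hm
  · rw [Set.disjoint_left]
    intro p (h1 : sqNorm i (p - c) < r) (h2 : r < sqNorm i (p - c))
    exact lt_asymm h1 h2
  · rcases lt_trichotomy (sqNorm i (p - c)) r with h1 | h1 | h1
    · exact Or.inl h1
    · exact absurd (hi p hp) (h.bdry p h1)
    · exact Or.inr h1

theorem SquareTile.immortal (h : SquareTile R Z i c r) {p : ℝ × ℝ} (hp : p ∈ sqOpen i c r) :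
    Immortal R p := by
  obtain ⟨K, hK⟩ := h.per
  exact (hK p hp).immortal

theorem SquareTile.sqOpen_subset (h : SquareTile R Z i c r) (h' : SquareTile R Z j d q)
    (hm : (sqOpen i c r ∩ sqOpen j d q).Nonempty) : sqOpen i c r ⊆ sqOpen j d q :=
  h'.subset_sqOpen convex_sqOpen.isPreconnected (fun _ hp => h.immortal hp) hm

theorem SquareTile.sqClosed_eq (h : SquareTile R Z i c r) (h' : SquareTile R Z j d q)
    (hm : (sqOpen i c r ∩ sqOpen j d q).Nonempty) : sqClosed i c r = sqClosed j d q := by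
  rw [← closure_sqOpen h.pos, ← closure_sqOpen h'.pos, (h.sqOpen_subset h' hm).antisymm
    (h'.sqOpen_subset h (by rwa [inter_comm]))]

theorem SquareTile.type_eq (h : SquareTile R Z i c r) (h' : SquareTile R Z j d q)
    (hm : (sqOpen i c r ∩ sqOpen j d q).Nonempty) : i = j :=
  sqClosed_inj_type h.pos h'.pos (h.sqClosed_eq h' hm)

theorem TileDense.exists_mem {O : Set (ℝ × ℝ)} (hd : ∀ ε > 0, TileDense R Z ε) (hO : IsOpen O)
    {p : ℝ × ℝ} (hp : p ∈ O) (hpZ : p ∈ Z) :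
    ∃ i c r, SquareTile R Z i c r ∧ (O ∩ sqOpen i c r).Nonempty := by
  obtain ⟨ε, hε, hb⟩ := Metric.isOpen_iff.1 hO p hp
  obtain ⟨i, c, r, x, ht, hx, hxp⟩ := hd (ε ^ 2 / 2) (by positivity) p hpZ
  refine ⟨i, c, r, ht, ?_⟩
  have hxO : x ∈ O := hb (by
    rw [Metric.mem_ball, Prod.dist_eq, Real.dist_eq, Real.dist_eq]
    simp only [sqDist] at hxp
    refine max_lt (abs_lt_of_sq_lt_sq ?_ hε.le) (abs_lt_of_sq_lt_sq ?_ hε.le) <;> nlinarith [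
      sq_nonneg (x.1 - p.1), sq_nonneg (x.2 - p.2), pow_pos hε 2])
  have hx' : x ∈ closure (sqOpen i c r) := by rw [closure_sqOpen ht.pos]; exact hx
  exact mem_closure_iff.1 hx' O hO hxO

end SquareTiles

section Tiles

variable {s t : ℝ} {k : ℕ} (h0 : 0 < s)

include h0

theorem SquareTile.exists_iterRel {Z : Set (ℝ × ℝ)} {i : Bool} {c : ℝ × ℝ} {r : ℝ}
    (h : SquareTile (HalfRel s) Z i c r) :
    ∃ n, 0 < n ∧ ∀ p ∈ sqOpen i c r, IterRel s n p p := by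
  obtain ⟨K, hK⟩ := h.per
  exact ⟨2 * K.factorial, by have := K.factorial_pos; omega, fun p hp =>
    iterRel_of_relIter_halfRel h0 (hK p hp).factorial⟩

theorem SquareTile.periodicPolygon {i : Bool} {c : ℝ × ℝ} {r : ℝ}
    (h : SquareTile (HalfRel s) (leftOct s) i c r) : PeriodicPolygon s (sqClosed i c r) := by
  obtain ⟨n, hn, hp⟩ := h.exists_iterRel h0
  refine ⟨isConvexPolygon_sqClosed h.pos, fun p hp => (h.sub p hp).1, n, hn, ?_⟩
  rwa [interior_sqClosed h.pos]

theorem PeriodicPolygon.interior_subset_octInt {Q : Set (ℝ × ℝ)} (hQ : PeriodicPolygon s Q) :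
    interior Q ⊆ octInt s :=
  (interior_mono hQ.2.1).trans (interior_F1_subset h0)

variable (ht : GoodParam t) (hst : 2 * (s * (k + t)) = 1) (hk : 1 ≤ k)

include ht hst hk

theorem PeriodicPolygon.immortal {Q : Set (ℝ × ℝ)} (hQ : PeriodicPolygon s Q) {p : ℝ × ℝ}
    (hp : p ∈ interior Q) (h1 : p.1 ≠ -s) (h2 : p.1 ≠ s) : Immortal (HalfRel s) p := by
  obtain ⟨n, hn, h⟩ := hQ.2.2
  exact immortal_of_iterRel h0 ht.bounds.1 hst hk (hQ.interior_subset_octInt h0 hp) h1 h2 hn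
    (h p hp)

/-- The part of a periodic polygon to the left of the central square lies in the square tile
which it meets. -/
theorem PeriodicPolygon.left_subset {Q : Set (ℝ × ℝ)} (hQ : PeriodicPolygon s Q) {i : Bool}
    {c : ℝ × ℝ} {r : ℝ} (h : SquareTile (HalfRel s) (leftOct s) i c r)
    (hm : ((interior Q ∩ {p | p.1 < -s}) ∩ sqOpen i c r).Nonempty) :
    interior Q ∩ {p | p.1 < -s} ⊆ sqOpen i c r := by
  refine h.subset_sqOpen ?_ (fun p hp => ?_) hm
  · exact (hQ.1.convex.interior.inter
      (convex_halfSpace_lt (LinearMap.fst ℝ ℝ ℝ).isLinear (-s))).isPreconnected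
  · have h1 : p.1 < -s := hp.2
    exact hQ.immortal h0 ht hst hk hp.1 h1.ne (by linarith)

theorem PeriodicPolygon.exists_squareTile {Q : Set (ℝ × ℝ)} (hQ : PeriodicPolygon s Q)
    {x : ℝ × ℝ} (hx : x ∈ Q) (hxs : x.1 < -s) :
    ∃ i c r, SquareTile (HalfRel s) (leftOct s) i c r ∧
      (interior Q ∩ {p | p.1 < -s}).Nonempty ∧ interior Q ∩ {p | p.1 < -s} ⊆ sqOpen i c r := by
  have ho : IsOpen {p : ℝ × ℝ | p.1 < -s} := isOpen_lt continuous_fst continuous_const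
  obtain ⟨y, hy, hyQ⟩ : (interior Q ∩ {p : ℝ × ℝ | p.1 < -s}).Nonempty := by
    rw [← hQ.1.closure_interior] at hx
    rw [inter_comm]
    exact mem_closure_iff.1 hx _ ho hxs
  have hyL : y ∈ leftOct s := ⟨hQ.2.1 (interior_subset hy), le_of_lt hyQ⟩
  obtain ⟨i, c, r, h, hm⟩ := TileDense.exists_mem
    (fun ε hε => tileDense_leftOct h0 ht.bounds.1 hst hk ht hε) (isOpen_interior.inter ho)
    ⟨hy, hyQ⟩ hyL
  exact ⟨i, c, r, h, ⟨y, hy, hyQ⟩, hQ.left_subset h0 ht hst hk h hm⟩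

end Tiles

/-! ### Square tiles and periodic tiles -/

theorem mem_tiles_iff {s : ℝ} {P : Set (ℝ × ℝ)} : P ∈ tiles s ↔
    PeriodicPolygon s P ∧ ∀ Q, PeriodicPolygon s Q → P ⊆ Q → P = Q :=
  ⟨fun h => ⟨⟨h.1, h.2.1, h.2.2.1⟩, fun Q hQ => h.2.2.2 Q hQ.1 hQ.2.1 hQ.2.2⟩,
    fun h => ⟨h.1.1, h.1.2.1, h.1.2.2, fun Q h1 h2 h3 => h.2 Q ⟨h1, h2, h3⟩⟩⟩

theorem IsOpen.exists_square_subset {O : Set (ℝ × ℝ)} (hO : IsOpen O) {p : ℝ × ℝ} (hp : p ∈ O) :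
    ∃ ε > 0, ∀ x y : ℝ, |x - p.1| < ε → |y - p.2| < ε → (x, y) ∈ O := by
  obtain ⟨ε, hε, h⟩ := Metric.isOpen_iff.1 hO p hp
  exact ⟨ε, hε, fun x y hx hy => h (max_lt hx hy)⟩

section LeftTiles

variable {s : ℝ} {i : Bool} {c : ℝ × ℝ} {r : ℝ}

theorem SquareTile.right_le (h : SquareTile (HalfRel s) (leftOct s) i c r) : c.1 + r ≤ -s := by
  refine (h.sub (c.1 + r, c.2) ?_).2
  cases i <;> simp [sqNorm, abs_of_pos h.pos, h.pos.le]

theorem SquareTile.interior_subset_or (h : SquareTile (HalfRel s) (leftOct s) i c r)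
    {Q : Set (ℝ × ℝ)} (hQ : Convex ℝ Q) (hne : (interior Q ∩ {p | p.1 < -s}).Nonempty)
    (hsub : interior Q ∩ {p | p.1 < -s} ⊆ sqOpen i c r) :
    interior Q ⊆ sqOpen i c r ∨ i = true ∧ c.1 + r = -s := by
  by_cases hz : ∃ z ∈ interior Q, -s ≤ z.1
  swap
  · push Not at hz
    exact Or.inl fun p hp => hsub ⟨hp, hz p hp⟩
  right
  obtain ⟨z, hz, hzs⟩ := hz
  obtain ⟨y, hy, hys⟩ := hne
  obtain ⟨w, hw, hws⟩ := hQ.interior.isPreconnected.intermediate_value hy hz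
    continuous_fst.continuousOn ⟨le_of_lt hys, hzs⟩
  obtain ⟨ε, hε, hb⟩ := isOpen_interior.exists_square_subset hw
  have key : ∀ δ y, 0 < δ → δ < ε → |y - w.2| < ε → (-s - δ, y) ∈ sqOpen i c r := by
    intro δ y h1 h2 h3
    refine hsub ⟨hb _ _ ?_ h3, show -s - δ < -s by linarith⟩
    rw [hws, sub_sub_cancel_left, abs_neg, abs_of_pos h1]
    exact h2
  have hle := h.right_le
  cases i
  · exfalso
    have k1 := key (ε / 4) w.2 (by linarith) (by linarith) (by simpa using hε)
    have k2 := key (ε / 4) (w.2 + ε / 2) (by linarith) (by linarith)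
      (by rw [add_sub_cancel_left, abs_of_pos] <;> linarith)
    simp only [sqOpen, sqNorm, mem_ofPred_eq, abs_add_abs_lt_iff, Prod.fst_sub, Prod.snd_sub] at k1 k2
    obtain ⟨a1, a2, a3, a4⟩ := k1
    obtain ⟨b1, b2, b3, b4⟩ := k2
    linarith
  · refine ⟨rfl, le_antisymm hle (le_of_forall_pos_sub_le fun δ hδ => ?_)⟩
    have k1 := mem_sqOpen_true.1 (key (min δ (ε / 2)) w.2 (by positivity)
      ((min_le_right _ _).trans_lt (by linarith)) (by simpa using hε))
    linarith [k1.2.1, min_le_left δ (ε / 2)]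

theorem SquareTile.periodicPolygon_of_left (h : SquareTile (HalfRel s) (leftOct s) i c r)
    (h0 : 0 < s) (hs : s < 1 / 2) {Q : Set (ℝ × ℝ)} (hQ : IsConvexPolygon Q) (hF : Q ⊆ F1 s)
    (hright : ∀ p ∈ Q, p.1 ≤ s) (hleft : ∀ p ∈ Q, p.1 < -s → p ∈ sqClosed i c r) :
    PeriodicPolygon s Q := by
  obtain ⟨n, hn, hper⟩ := h.exists_iterRel h0
  refine ⟨hQ, hF, n, hn, fun p hp => ?_⟩
  rcases lt_or_ge p.1 (-s) with hps | hps
  · have ho : IsOpen {p : ℝ × ℝ | p.1 < -s} := isOpen_lt continuous_fst continuous_const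
    refine hper p ?_
    rw [← interior_sqClosed h.pos]
    exact interior_maximal (fun y hy => hleft y (interior_subset hy.1) hy.2)
      (isOpen_interior.inter ho) ⟨hp, hps⟩
  · exact iterRel_of_abs_le h0 (interior_F1_subset h0 (interior_mono hF hp)) hs hps
      (hright p (interior_subset hp)) n

end LeftTiles

section MaximalTiles

variable {s t : ℝ} {k : ℕ} (h0 : 0 < s) (ht : GoodParam t) (hst : 2 * (s * (k + t)) = 1)
  (hk : 1 ≤ k)

include h0 ht hst hk

theorem SquareTile.mem_tiles {i : Bool} {c : ℝ × ℝ} {r : ℝ}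
    (h : SquareTile (HalfRel s) (leftOct s) i c r) (hc : i = true → c.1 + r ≠ -s) :
    sqClosed i c r ∈ tiles s := by
  refine mem_tiles_iff.2 ⟨h.periodicPolygon h0, fun Q hQ hPQ => hPQ.antisymm ?_⟩
  have hcQ : c ∈ interior Q :=
    interior_mono hPQ (by rw [interior_sqClosed h.pos]; exact center_mem_sqOpen h.pos)
  have hcs : c.1 < -s := by linarith [h.right_le, h.pos]
  have hsub := hQ.left_subset h0 ht hst hk h ⟨c, ⟨hcQ, hcs⟩, center_mem_sqOpen h.pos⟩
  rcases h.interior_subset_or hQ.1.convex ⟨c, hcQ, hcs⟩ hsub with h' | ⟨h1, h2⟩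
  · rw [← hQ.1.closure_interior, ← closure_sqOpen h.pos]
    exact closure_mono h'
  · exact absurd h2 (hc h1)

open scoped Pointwise in
theorem exists_squareTile_of_mem_tiles (hs : s < 1 / 2) {i : Bool} {c : ℝ × ℝ} {r : ℝ}
    (hr : 0 < r) (hP : sqClosed i c r ∈ tiles s) {x : ℝ × ℝ} (hx : x ∈ sqClosed i c r)
    (hxs : x.1 < -s) :
    ∃ d q, SquareTile (HalfRel s) (leftOct s) i d q ∧ x ∈ sqClosed i d q := by
  obtain ⟨hP, hmax⟩ := mem_tiles_iff.1 hP
  obtain ⟨j, d, q, h, hne, hsub⟩ := hP.exists_squareTile h0 ht hst hk hx hxs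
  have hleft : ∀ y ∈ sqClosed i c r, y.1 < -s → y ∈ sqClosed j d q := by
    intro y hy hys
    have ho : IsOpen {p : ℝ × ℝ | p.1 < -s} := isOpen_lt continuous_fst continuous_const
    rw [← closure_sqOpen h.pos]
    refine closure_mono hsub (ho.closure_inter ⟨?_, hys⟩)
    rwa [hP.1.closure_interior]
  rcases h.interior_subset_or hP.1.convex hne hsub with h' | ⟨rfl, hd⟩
  · have e := hmax _ (h.periodicPolygon h0) (by
      rw [← hP.1.closure_interior, ← closure_sqOpen h.pos]
      exact closure_mono h')
    obtain rfl := sqClosed_inj_type hr h.pos e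
    exact ⟨d, q, h, e ▸ hx⟩
  cases i
  swap
  · exact ⟨d, q, h, hleft x hx hxs⟩
  exfalso
  have htip : ∀ a b : ℝ, |a| + |b| ≤ r → (c.1 + a, c.2 + b) ∈ sqClosed false c r := by
    intro a b hab
    simpa [mem_sqClosed_false] using hab
  have htop := ((mem_F1_iff h0).1 (hP.2.1 (htip 0 r (by simp [abs_of_pos hr])))).2.1
  have hbot := ((mem_F1_iff h0).1 (hP.2.1 (htip 0 (-r) (by simp [abs_of_pos hr])))).1
  have hx1 : c.1 - r ≤ x.1 := by
    have := mem_sqClosed_false.1 hx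
    rw [abs_add_abs_le_iff] at this
    linarith
  set ε := s - (c.1 + r) with hε
  have hε0 : 0 < ε := by simp only at htop hbot; linarith
  set Q := sqClosed false c r + segment ℝ 0 ((ε, 0) : ℝ × ℝ) with hQ
  have hmem : ∀ p ∈ Q, ∃ u, p.1 - u ≤ c.1 + r ∧ 0 ≤ u ∧ u ≤ ε ∧
      (p.1 - u, p.2) ∈ sqClosed false c r := by
    rintro _ ⟨a, ha, _, ⟨b, b', hb, hb', hbb, rfl⟩, rfl⟩
    have := mem_sqClosed_false.1 ha
    rw [abs_add_abs_le_iff] at this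
    refine ⟨b' * ε, ?_, by positivity, ?_, ?_⟩
    · simp; linarith
    · nlinarith
    · simpa using ha
  have hPQ : sqClosed false c r ⊆ Q := fun p hp =>
    ⟨p, hp, 0, left_mem_segment ℝ _ _, add_zero p⟩
  have hQF : Q ⊆ F1 s := by
    intro p hp
    obtain ⟨u, h1, h2, h3, h4⟩ := hmem p hp
    obtain ⟨f1, f2, f3, f4⟩ := (mem_F1_iff h0).1 (hP.2.1 h4)
    refine (mem_F1_iff h0).2 ⟨f1, f2, ?_, ?_⟩ <;> simp only at * <;> linarith
  have hpoly : IsConvexPolygon Q := by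
    classical
    obtain ⟨⟨V, hV⟩, hi⟩ := hP.1
    refine ⟨⟨V + {0, (ε, 0)}, ?_⟩, hi.mono (interior_mono hPQ)⟩
    rw [Finset.coe_add, convexHull_add, ← hV, Finset.coe_pair, convexHull_pair]
  have hper : PeriodicPolygon s Q := by
    refine h.periodicPolygon_of_left h0 hs hpoly hQF (fun p hp => ?_) (fun p hp hps => ?_) <;>
      obtain ⟨u, h1, h2, h3, h4⟩ := hmem p hp
    · linarith
    · have := mem_sqClosed_true.1 (hleft _ h4 (by simp only; linarith))
      simp only at this
      exact mem_sqClosed_true.2 ⟨by linarith, by linarith, this.2.2⟩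
  have hmem' : c + (r, 0) + (ε, 0) ∈ sqClosed false c r := by
    rw [hmax Q hper hPQ]
    refine ⟨c + (r, 0), ?_, _, right_mem_segment ℝ _ _, rfl⟩
    simp [mem_sqClosed_false, abs_of_pos hr]
  rw [mem_sqClosed_false, abs_add_abs_le_iff] at hmem'
  simp at hmem'
  linarith

end MaximalTiles

/-! ### Square tiles near a point outside the limit set -/

section Finiteness

variable {s t : ℝ} {k : ℕ} (h0 : 0 < s)

include h0

theorem finite_large_touching_boxes {δ : ℝ} (hδ : 0 < δ) :
    {S | ∃ c r, SquareTile (HalfRel s) (leftOct s) true c r ∧ c.1 + r = -s ∧ δ < r ∧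
      S = sqClosed true c r}.Finite := by
  let z : ℤ → ℝ × ℝ := fun n => (-s - δ, δ * n)
  refine ((finite_Icc ⌊-s / δ⌋ ⌊s / δ⌋).biUnion (t := fun n => {S | ∃ c r,
    SquareTile (HalfRel s) (leftOct s) true c r ∧ z n ∈ sqOpen true c r ∧
      S = sqClosed true c r}) fun n _ => Set.Subsingleton.finite ?_).subset ?_
  · rintro _ ⟨c, r, h, hz, rfl⟩ _ ⟨c', r', h', hz', rfl⟩
    exact h.sqClosed_eq h' ⟨z n, hz, hz'⟩
  · rintro _ ⟨c, r, h, hc, hr, rfl⟩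
    obtain ⟨f1, f2, -, -⟩ := (mem_F1_iff h0).1
      (h.sub c (sqOpen_subset_sqClosed (center_mem_sqOpen h.pos))).1
    have e : δ * (c.2 / δ) = c.2 := by field_simp
    have l1 := mul_le_mul_of_nonneg_left (Int.floor_le (c.2 / δ)) hδ.le
    have l2 := mul_lt_mul_of_pos_left (Int.lt_floor_add_one (c.2 / δ)) hδ
    refine mem_iUnion₂.2 ⟨⌊c.2 / δ⌋, ⟨Int.floor_mono (by gcongr), Int.floor_mono (by gcongr)⟩,
      c, r, h, mem_sqOpen_true.2 ?_, rfl⟩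
    simp only [z]
    refine ⟨?_, ?_, ?_, ?_⟩ <;> linarith

variable (ht : GoodParam t) (hst : 2 * (s * (k + t)) = 1) (hk : 1 ≤ k)

include ht hst hk

theorem finite_squareTiles_near {p : ℝ × ℝ} (hp : p ∈ F1 s) (hps : p.1 < -s)
    (hl : p ∉ limitSet s) :
    ∃ ε > 0, {S | (∃ i c r, SquareTile (HalfRel s) (leftOct s) i c r ∧ S = sqClosed i c r) ∧
      (Metric.ball p ε ∩ S).Nonempty}.Finite := by
  obtain ⟨U, hU, hfin⟩ : ∃ U ∈ 𝓝 p, {P ∈ tiles s | (U ∩ P).Nonempty}.Finite := by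
    by_contra! h
    exact hl ⟨hp, h⟩
  obtain ⟨ε, hε, hb⟩ := Metric.mem_nhds_iff.1 hU
  set δ := (-s - p.1) / 4 with hδ
  have hδ0 : 0 < δ := by linarith
  refine ⟨min ε δ, lt_min hε hδ0, (hfin.union (finite_large_touching_boxes h0 hδ0)).subset ?_⟩
  rintro _ ⟨⟨i, c, r, h, rfl⟩, x, hx, hxS⟩
  by_cases hc : i = true ∧ c.1 + r = -s
  · obtain ⟨rfl, hc⟩ := hc
    refine Or.inr ⟨c, r, h, hc, ?_, rfl⟩
    have h1 : dist x.1 p.1 < min ε δ := (le_max_left _ _).trans_lt hx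
    rw [Real.dist_eq] at h1
    have h2 := (abs_lt.1 (h1.trans_le (min_le_right _ _))).2
    linarith [(mem_sqClosed_true.1 hxS).1]
  · exact Or.inl ⟨h.mem_tiles h0 ht hst hk fun h1 h2 => hc ⟨h1, h2⟩, x,
      hb (Metric.ball_subset_ball (min_le_left _ _) hx), hxS⟩

end Finiteness

/-! ### The right edge of the left half when the central row is a single square -/

theorem exists_corner_squareTile {s t : ℝ} (h0 : 0 < s) (ht : GoodParam t)
    (hst : 2 * (s * ((1 : ℕ) + t)) = 1) :
    ∃ r, 0 < r ∧ r < s ∧ SquareTile (HalfRel s) (leftOct s) true (-s - r, -s + r) r := by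
  obtain ⟨ht0, ht1⟩ := ht.bounds
  obtain ⟨κ, hκ⟩ := exists_recip ht0
  obtain ⟨k, hk, hk'⟩ := exists_eq_nat_add_Rmap ht0 ht1 hκ
  set t' := Rmap t
  obtain ⟨h0', h1'⟩ := ht.next.bounds
  obtain ⟨κ', hκ'⟩ := exists_recip h0'
  obtain ⟨j, rfl⟩ := Nat.exists_eq_succ_of_ne_zero (Nat.one_le_iff_ne_zero.1 hk)
  have hc := (((carries_trapToOct_leftOct h0 ht0 hst le_rfl ht1).restrict
    (Z₀ := trapLow t) (Z₁ := leftOct s) (fun p hp => hp.1) (fun p hp =>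
      (carries_trapToOct_leftOct h0 ht0 hst le_rfl ht1).maps p hp.1)).comp
    (carries_triSide_rot ht0 ht1 hκ)).comp (carries_trapLow_triSide h0' h1' hk hk')
  have hs := ((squareSim_trapToOct h0 1).comp
    (squareSim_rotBack.comp (squareSim_triToTrap ht0))).comp (squareSim_trapToTri t' j)
  have hl : 0 < 2 * s * t := by positivity
  have h := (squareTile_trapLow h0' h1').map hc hs.surj (j := true) hl (fun p q => ?_)
  · refine ⟨2 * s * t * t', by positivity, ?_, ?_⟩
    · nlinarith [mul_lt_mul'' ht1 h1' ht0.le h0'.le]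
    · convert h using 1
      ext <;> simp [trapToOct, rotBack, triToTrap, trapToTri]
      · ring
      · push_cast at hk'
        subst hk'
        linear_combination (2 * s) * hκ
  · have e : ∀ x : ℝ, |2 * s * t * x| = 2 * s * t * |x| := fun x => by
      rw [abs_mul, abs_of_pos hl]
    simp only [sqNorm, Prod.fst_sub, Prod.snd_sub]
    rw [abs_add_abs_eq_max, mul_max_of_nonneg _ _ hl.le, ← e, ← e]
    congr 2 <;> simp [trapToOct, rotBack, triToTrap, trapToTri] <;> ring

/-- The central square enlarged by a thin triangle. -/
def fan (s r m : ℝ) : Set (ℝ × ℝ) :=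
  {p | -s ≤ p.2 ∧ p.2 ≤ s ∧ p.1 ≤ s ∧ p.2 ≤ -s + 2 * r + m * (p.1 + s)}

section Fan

variable {s r m : ℝ} (h0 : 0 < s) (hs : s < 1 / 2) (hr : 0 < r) (hrs : r < s) (hm : 1 ≤ m)

theorem convex_fan : Convex ℝ (fan s r m) := by
  rintro p ⟨a1, a2, a3, a4⟩ q ⟨b1, b2, b3, b4⟩ a b ha hb hab
  obtain rfl : b = 1 - a := by linarith
  refine ⟨?_, ?_, ?_, ?_⟩ <;> simp only [Prod.fst_add, Prod.snd_add, Prod.smul_fst,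
    Prod.smul_snd, smul_eq_mul] <;> nlinarith

include hm

theorem fan_left_subset {p : ℝ × ℝ} (hp : p ∈ fan s r m) (hps : p.1 < -s) :
    p ∈ sqClosed true (-s - r, -s + r) r := by
  obtain ⟨h1, h2, h3, h4⟩ := hp
  refine mem_sqClosed_true.2 ⟨?_, ?_, ?_, ?_⟩ <;> simp only <;> nlinarith

include hr hrs

theorem fan_bottom_mem : (-s - 2 * r / m, -s) ∈ fan s r m := by
  have h : m * (2 * r / m) = 2 * r := by field_simp
  have : 0 < 2 * r / m := by positivity
  refine ⟨le_rfl, by simp only; linarith, by simp only; linarith, ?_⟩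
  simp only
  linarith

theorem fan_top_mem : (-s + (2 * s - 2 * r) / m, s) ∈ fan s r m := by
  have h : m * ((2 * s - 2 * r) / m) = 2 * s - 2 * r := by field_simp
  have h' : (2 * s - 2 * r) / m ≤ 2 * s - 2 * r := div_le_self (by linarith) hm
  refine ⟨by simp only; linarith, le_rfl, by simp only; linarith, ?_⟩
  simp only
  linarith

include h0

theorem fan_mem_of_le {y : ℝ} (h1 : -s ≤ y) (h2 : y ≤ s) : (-s + 2 * s / m, y) ∈ fan s r m := by
  have h : m * (2 * s / m) = 2 * s := by field_simp
  have h' : 2 * s / m ≤ 2 * s := div_le_self (by linarith) hm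
  refine ⟨h1, h2, by simp only; linarith, ?_⟩
  simp only
  linarith

theorem isConvexPolygon_fan : IsConvexPolygon (fan s r m) := by
  classical
  have hA := fan_bottom_mem hr hrs hm
  have hB := fan_top_mem hr hrs hm
  set A : ℝ × ℝ := (-s - 2 * r / m, -s) with hA'
  set B : ℝ × ℝ := (-s + (2 * s - 2 * r) / m, s) with hB'
  have hC : ((s, -s) : ℝ × ℝ) ∈ fan s r m :=
    ⟨le_rfl, by simp only; linarith, le_rfl, by simp only; nlinarith⟩
  have hD : ((s, s) : ℝ × ℝ) ∈ fan s r m :=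
    ⟨by simp only; linarith, le_rfl, le_rfl, by simp only; nlinarith⟩
  refine ⟨⟨{A, B, (s, -s), (s, s)}, Subset.antisymm (fun p hp => ?_) ?_⟩, 0, ?_⟩
  · obtain ⟨h1, h2, h3, h4⟩ := hp
    set H := convexHull ℝ (({A, B, (s, -s), (s, s)} : Finset (ℝ × ℝ)) : Set (ℝ × ℝ))
    have hH : Convex ℝ H := convex_convexHull ℝ _
    have hv : ∀ v ∈ ({A, B, (s, -s), (s, s)} : Finset (ℝ × ℝ)), v ∈ H := fun v hv =>
      subset_convexHull ℝ _ hv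
    set b := (p.2 + s) / (2 * s)
    have hb : 2 * s * b = p.2 + s := by simp only [b]; field_simp
    have hb0 : 0 ≤ b := div_nonneg (by linarith) (by linarith)
    have hb1 : b ≤ 1 := (div_le_one (by linarith)).2 (by linarith)
    have hL := hH (hv A (by simp)) (hv B (by simp)) (sub_nonneg.2 hb1) hb0 (by ring)
    have hR := hH (hv (s, -s) (by simp)) (hv (s, s) (by simp)) (sub_nonneg.2 hb1) hb0 (by ring)
    have eL : (1 - b) • A + b • B = (-s + (p.2 + s - 2 * r) / m, p.2) := by
      ext
      · simp only [hA', hB', Prod.fst_add, Prod.smul_fst, smul_eq_mul]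
        field_simp
        linear_combination hb
      · simp only [hA', hB', Prod.snd_add, Prod.smul_snd, smul_eq_mul]
        linear_combination hb
    have eR : (1 - b) • ((s, -s) : ℝ × ℝ) + b • (s, s) = (s, p.2) := by
      ext
      · simp only [Prod.fst_add, Prod.smul_fst, smul_eq_mul]
        ring
      · simp only [Prod.snd_add, Prod.smul_snd, smul_eq_mul]
        linear_combination hb
    rw [eL] at hL
    rw [eR] at hR
    set x := -s + (p.2 + s - 2 * r) / m
    have hx : m * (x + s) = p.2 + s - 2 * r := by simp only [x]; field_simp; ring
    have hx1 : x ≤ p.1 := by nlinarith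
    have hx2 : x < s := by nlinarith
    have hx3 : 0 < s - x := by linarith
    have := hH hL hR (a := (s - p.1) / (s - x)) (b := (p.1 - x) / (s - x))
      (div_nonneg (by linarith) hx3.le) (div_nonneg (by linarith) hx3.le) (by field_simp; ring)
    convert this using 1
    ext
    · simp only [Prod.fst_add, Prod.smul_fst, smul_eq_mul]
      field_simp
      ring
    · simp only [Prod.snd_add, Prod.smul_snd, smul_eq_mul]
      field_simp
      ring
  · refine convexHull_min ?_ convex_fan
    intro v hv
    simp only [Finset.coe_insert, Finset.coe_singleton, mem_insert_iff, mem_singleton_iff] at hv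
    rcases hv with rfl | rfl | rfl | rfl <;> assumption
  · refine mem_interior.2 ⟨{p | -s < p.2 ∧ p.2 < s ∧ p.1 < s ∧
      p.2 < -s + 2 * r + m * (p.1 + s)}, ?_, ?_, ?_⟩
    · rintro p ⟨a1, a2, a3, a4⟩
      exact ⟨a1.le, a2.le, a3.le, a4.le⟩
    · exact (isOpen_lt continuous_const continuous_snd).inter <|
        (isOpen_lt continuous_snd continuous_const).inter <|
        (isOpen_lt continuous_fst continuous_const).inter <|
        isOpen_lt continuous_snd <| continuous_const.add <| continuous_const.mul <|
          continuous_fst.add continuous_const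
    · refine ⟨?_, ?_, ?_, ?_⟩ <;> simp only [Prod.fst_zero, Prod.snd_zero] <;> nlinarith

include hs

theorem periodicPolygon_fan
    (hV : SquareTile (HalfRel s) (leftOct s) true (-s - r, -s + r) r) :
    PeriodicPolygon s (fan s r m) := by
  refine hV.periodicPolygon_of_left h0 hs (isConvexPolygon_fan h0 hr hrs hm) (fun p hp => ?_)
    (fun p hp => hp.2.2.1) (fun p hp hps => fan_left_subset hm hp hps)
  obtain ⟨h1, h2, h3, h4⟩ := hp
  refine (mem_F1_iff h0).2 ⟨h1, h2, ?_, by linarith⟩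
  rcases lt_or_ge p.1 (-s) with hps | hps
  · nlinarith
  · linarith

end Fan

theorem fan_injective {s r : ℝ} (hr : 0 < r) (hrs : r < s) {m n : ℝ} (hm : 1 ≤ m)
    (hn : 1 ≤ n) (h : fan s r m = fan s r n) : m = n := by
  have key : ∀ m n : ℝ, 1 ≤ m → 1 ≤ n → fan s r m ⊆ fan s r n → n ≤ m := by
    intro m n hm hn h
    have h1 := (h (fan_bottom_mem hr hrs hm)).2.2.2
    simp only at h1
    have e : m * (2 * r / m) = 2 * r := by field_simp
    have : 0 < 2 * r / m := by positivity
    nlinarith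
  exact (key n m hn hm h.ge).antisymm (key m n hm hn h.le)

theorem Convex.exists_crossing {Q : Set (ℝ × ℝ)} (hQ : Convex ℝ Q) {u v : ℝ × ℝ} {a : ℝ}
    (hu : u ∈ Q) (hv : v ∈ Q) (hua : u.1 ≤ a) (hav : a ≤ v.1) (huv : u.1 < v.1) :
    ∃ w ∈ Q, w.1 = a ∧ (v.1 - u.1) * w.2 = (v.1 - a) * u.2 + (a - u.1) * v.2 := by
  have h : 0 < v.1 - u.1 := sub_pos.2 huv
  refine ⟨_, hQ hu hv (a := (v.1 - a) / (v.1 - u.1)) (b := (a - u.1) / (v.1 - u.1))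
    (div_nonneg (by linarith) h.le) (div_nonneg (by linarith) h.le) (by field_simp; ring), ?_, ?_⟩
  · simp only [Prod.fst_add, Prod.smul_fst, smul_eq_mul]
    field_simp
    ring
  · simp only [Prod.snd_add, Prod.smul_snd, smul_eq_mul]
    field_simp

theorem fan_mem_tiles {s t r m : ℝ} (h0 : 0 < s) (hs : s < 1 / 2) (ht : GoodParam t)
    (hst : 2 * (s * ((1 : ℕ) + t)) = 1) (hr : 0 < r) (hrs : r < s)
    (hV : SquareTile (HalfRel s) (leftOct s) true (-s - r, -s + r) r) (hm : 1 ≤ m) :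
    fan s r m ∈ tiles s := by
  have hT := periodicPolygon_fan h0 hs hr hrs hm hV
  refine mem_tiles_iff.2 ⟨hT, fun Q hQ hTQ => hTQ.antisymm fun q hq => ?_⟩
  have hA := hTQ (fan_bottom_mem hr hrs hm)
  have hB := hTQ (fan_top_mem hr hrs hm)
  have eA : m * (2 * r / m) = 2 * r := by field_simp
  have eB : m * ((2 * s - 2 * r) / m) = 2 * s - 2 * r := by field_simp
  have pA : 0 < 2 * r / m := by positivity
  have pB : 0 < (2 * s - 2 * r) / m := div_pos (by linarith) (by linarith)
  set A : ℝ × ℝ := (-s - 2 * r / m, -s) with hA'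
  set B : ℝ × ℝ := (-s + (2 * s - 2 * r) / m, s) with hB'
  have ho : IsOpen {p : ℝ × ℝ | p.1 < -s} := isOpen_lt continuous_fst continuous_const
  have hsub : interior Q ∩ {p | p.1 < -s} ⊆ sqOpen true (-s - r, -s + r) r := by
    refine hQ.left_subset h0 ht hst le_rfl hV ?_
    obtain ⟨x, hxs, hx⟩ : ({p : ℝ × ℝ | p.1 < -s} ∩ interior (fan s r m)).Nonempty := by
      refine mem_closure_iff.1 ?_ _ ho (show A.1 < -s by simp only [hA']; linarith)
      rw [hT.1.closure_interior]
      exact fan_bottom_mem hr hrs hm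
    refine ⟨x, ⟨interior_mono hTQ hx, hxs⟩, ?_⟩
    rw [← interior_sqClosed hr]
    exact interior_maximal (fun y hy =>
      fan_left_subset hm (interior_subset hy.1) hy.2) (isOpen_interior.inter ho) ⟨hx, hxs⟩
  have hleft : ∀ v ∈ Q, v.1 ≤ -s → v ∈ sqClosed true (-s - r, -s + r) r := by
    intro v hv hvs
    have := hQ.1.mem_closure_inter (-ContinuousLinearMap.fst ℝ ℝ ℝ) (a := s) hv hA
      (by simp; linarith) (by simp [hA']; linarith)
    rw [← closure_sqOpen hr]
    refine closure_mono (fun y hy => hsub ⟨hy.1, ?_⟩) this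
    have h1 : s < -y.1 := hy.2
    exact show y.1 < -s by linarith
  obtain ⟨f1, f2, -, -⟩ := (mem_F1_iff h0).1 (hQ.2.1 hq)
  refine ⟨f1, f2, ?_, ?_⟩
  · by_contra! hqs
    set G := interior Q ∩ {p : ℝ × ℝ | s < p.1}
    have hcl : ∀ v ∈ Q, s ≤ v.1 → v ∈ closure G := fun v hv hvs =>
      hQ.1.mem_closure_inter (ContinuousLinearMap.fst ℝ ℝ ℝ) hv hq hvs hqs
    have hGV : (-·) '' G ⊆ sqOpen true (-s - r, -s + r) r := by
      refine hV.subset_sqOpen ?_ ?_ ?_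
      · refine IsPreconnected.image ?_ _ continuous_neg.continuousOn
        exact (hQ.1.convex.interior.inter
          (convex_halfSpace_gt (LinearMap.fst ℝ ℝ ℝ).isLinear s)).isPreconnected
      · rintro _ ⟨p, ⟨hp, hps⟩, rfl⟩
        have hps' : s < p.1 := hps
        exact (hQ.immortal h0 ht hst le_rfl hp (by linarith) hps'.ne').neg
      · have hc : ((s, -s + 2 * s) : ℝ × ℝ) ∈ Q := hTQ ⟨by simp only; linarith,
          by simp only; linarith, le_rfl, by simp only; nlinarith⟩
        have hO : IsOpen {p : ℝ × ℝ | p.1 < s + r ∧ s - r < p.2} :=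
          (isOpen_lt continuous_fst continuous_const).inter (isOpen_lt continuous_const continuous_snd)
        obtain ⟨p, ⟨h1, h2⟩, hp, h3⟩ := mem_closure_iff.1 (hcl _ hc le_rfl) _ hO
          (by constructor <;> simp only <;> linarith)
        have h4 := (hQ.interior_subset_octInt h0 hp).2.1
        have h5 : s < p.1 := h3
        refine ⟨-p, ⟨p, ⟨hp, h3⟩, rfl⟩, mem_sqOpen_true.2 ?_⟩
        simp only [Prod.fst_neg, Prod.snd_neg]
        refine ⟨?_, ?_, ?_, ?_⟩ <;> linarith
    have hc : ((s, -s) : ℝ × ℝ) ∈ Q := hTQ ⟨le_rfl, by simp only; linarith, le_rfl,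
      by simp only; nlinarith⟩
    have h1 : (-(s, -s) : ℝ × ℝ) ∈ closure ((-·) '' G) :=
      image_closure_subset_closure_image continuous_neg ⟨_, hcl _ hc le_rfl, rfl⟩
    have h2 := closure_mono hGV h1
    rw [closure_sqOpen hr] at h2
    have h3 := (mem_sqClosed_true.1 h2).2.2.2
    simp only [Prod.snd_neg, neg_neg] at h3
    linarith
  · by_contra! hlt
    rcases lt_or_ge q.1 (-s) with hqs | hqs
    · obtain ⟨w, hw, hw1, hw2⟩ := hQ.1.convex.exists_crossing (a := -s) hq hB hqs.le
        (by simp only [hB']; linarith) (by simp only [hB']; linarith)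
      have hw3 := (mem_sqClosed_true.1 (hleft w hw hw1.le)).2.2.2
      simp only [hB'] at hw2 hw3
      set β := (2 * s - 2 * r) / m
      have e1 : β * (-s + 2 * r + m * (q.1 + s)) < β * q.2 := mul_lt_mul_of_pos_left hlt pB
      have e2 : (-s + β - q.1) * w.2 ≤ (-s + β - q.1) * (-s + r + r) :=
        mul_le_mul_of_nonneg_left hw3 (by linarith)
      nlinarith
    · obtain ⟨w, hw, hw1, hw2⟩ := hQ.1.convex.exists_crossing (a := -s) hA hq
        (by simp only [hA']; linarith) hqs (by simp only [hA']; linarith)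
      have hw3 := (mem_sqClosed_true.1 (hleft w hw hw1.le)).2.2.2
      simp only [hA'] at hw2 hw3
      set α := 2 * r / m
      have e1 : α * (-s + 2 * r + m * (q.1 + s)) < α * q.2 := mul_lt_mul_of_pos_left hlt pA
      have e2 : (q.1 - (-s - α)) * w.2 ≤ (q.1 - (-s - α)) * (-s + r + r) :=
        mul_le_mul_of_nonneg_left hw3 (by linarith)
      nlinarith

theorem mem_limitSet_of_fst_eq {s t : ℝ} (h0 : 0 < s) (hs : s < 1 / 2) (ht : GoodParam t)
    (hst : 2 * (s * ((1 : ℕ) + t)) = 1) {p : ℝ × ℝ} (hp : p ∈ F1 s) (hps : p.1 = -s) :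
    p ∈ limitSet s := by
  obtain ⟨r, hr, hrs, hV⟩ := exists_corner_squareTile h0 ht hst
  obtain ⟨f1, f2, -, -⟩ := (mem_F1_iff h0).1 hp
  refine ⟨hp, fun U hU => ?_⟩
  have hlim : Tendsto (fun n : ℕ => ((-s + 2 * s / ((n : ℝ) + 1), p.2) : ℝ × ℝ)) atTop (𝓝 p) := by
    have h1 : Tendsto (fun n : ℕ => -s + 2 * s * (1 / ((n : ℝ) + 1))) atTop
        (𝓝 (-s + 2 * s * 0)) :=
      (tendsto_one_div_add_atTop_nhds_zero_nat.const_mul _).const_add _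
    have h2 : p = (-s + 2 * s * 0, p.2) := by ext <;> simp [hps]
    rw [h2]
    simp only [mul_one_div] at h1
    exact h1.prodMk_nhds tendsto_const_nhds
  have hm : ∀ n : ℕ, (1 : ℝ) ≤ (n : ℝ) + 1 := fun n => by
    linarith [(n.cast_nonneg : (0 : ℝ) ≤ n)]
  obtain ⟨N, hN⟩ := eventually_atTop.1 (hlim.eventually hU)
  refine infinite_of_injective_forall_mem (f := fun n : ℕ => fan s r (((n + N : ℕ) : ℝ) + 1))
    (fun a b hab => ?_) fun n => ⟨fan_mem_tiles h0 hs ht hst hr hrs hV (hm _), _,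
      hN (n + N) (by omega), fan_mem_of_le h0 hr hrs (hm _) f1 f2⟩
  have := fan_injective hr hrs (hm _) (hm _) hab
  push_cast at this
  exact_mod_cast (by linarith : (a : ℝ) = b)

theorem isClosed_F1 {s : ℝ} (h0 : 0 < s) : IsClosed (F1 s) := by
  have : F1 s = {p | -s ≤ p.2} ∩ ({p | p.2 ≤ s} ∩ ({p | -1 ≤ p.1 - p.2} ∩
      {p | p.1 - p.2 ≤ 1})) := by
    ext p
    exact mem_F1_iff h0
  rw [this]
  exact (isClosed_le continuous_const continuous_snd).inter <|
    (isClosed_le continuous_snd continuous_const).inter <|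
    (isClosed_le continuous_const (continuous_fst.sub continuous_snd)).inter <|
    isClosed_le (continuous_fst.sub continuous_snd) continuous_const

theorem Xzero_subset {s : ℝ} (h0 : 0 < s) {T : Set (ℝ × ℝ)} (hT : T ∈ centralTiles s)
    {q : ℝ × ℝ} (hq : q ∈ T) : Xzero s ⊆ F1 s ∩ {p | p.1 ≤ q.1} :=
  closure_minimal (fun _ hp => ⟨hp.1, (hp.2 T hT q hq).le⟩)
    ((isClosed_F1 h0).inter (isClosed_le continuous_fst continuous_const))

/-! ### Boxes and diamonds away from their vertices -/

/-- The vertices of a box or diamond. -/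
def sqVertices : Bool → ℝ × ℝ → ℝ → Set (ℝ × ℝ)
  | true, c, r => {(c.1 - r, c.2 - r), (c.1 - r, c.2 + r), (c.1 + r, c.2 - r), (c.1 + r, c.2 + r)}
  | false, c, r => {(c.1 - r, c.2), (c.1 + r, c.2), (c.1, c.2 - r), (c.1, c.2 + r)}

theorem finite_sqVertices (i : Bool) (c : ℝ × ℝ) (r : ℝ) : (sqVertices i c r).Finite := by
  cases i <;> simp [sqVertices]

theorem eventually_add_mul_mem_Ioo {x v l u : ℝ} (hl : l ≤ x) (hu : x ≤ u)
    (hl' : l = x → x < v) (hu' : x = u → v < x) :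
    ∀ᶠ a in 𝓝[>] (0 : ℝ), l < x + a * (v - x) ∧ x + a * (v - x) < u := by
  have hlim : Tendsto (fun a : ℝ => x + a * (v - x)) (𝓝[>] 0) (𝓝 x) := by
    refine tendsto_nhdsWithin_of_tendsto_nhds ?_
    have : Continuous fun a : ℝ => x + a * (v - x) := by fun_prop
    simpa using this.tendsto 0
  refine Eventually.and ?_ ?_
  · rcases hl.lt_or_eq with h | h
    · exact hlim.eventually_const_lt h
    · filter_upwards [self_mem_nhdsWithin] with a ha
      rw [h]
      exact lt_add_of_pos_right _ (mul_pos ha (sub_pos.2 (hl' h)))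
  · rcases hu.lt_or_eq with h | h
    · exact hlim.eventually_lt_const h
    · filter_upwards [self_mem_nhdsWithin] with a ha
      rw [← h]
      exact add_lt_of_neg_right _ (mul_neg_of_pos_of_neg ha (sub_neg.2 (hu' h)))

theorem sqOpen_inter_nonempty {c d x : ℝ × ℝ} {r q : ℝ} (hr : 0 < r) (hq : 0 < q)
    (h1 : x ∈ sqClosed true c r) (h2 : x ∈ sqClosed false d q) (h1' : x ∉ sqVertices true c r)
    (h2' : x ∉ sqVertices false d q) : (sqOpen true c r ∩ sqOpen false d q).Nonempty := by
  have hbox := mem_sqClosed_true.1 h1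
  have hdia := h2
  rw [mem_sqClosed_false, abs_add_abs_le_iff] at hdia
  obtain ⟨a1, a2, a3, a4⟩ := hbox
  obtain ⟨b1, b2, b3, b4⟩ := hdia
  simp only [sqVertices, mem_insert_iff, mem_singleton_iff, Prod.ext_iff, not_or, not_and]
    at h1' h2'
  obtain ⟨c1, c2, c3, c4⟩ := h1'
  obtain ⟨d1, d2, d3, d4⟩ := h2'
  obtain ⟨v, hv, e1, e2, e3, e4⟩ : ∃ v ∈ sqClosed false d q, (c.1 - r = x.1 → x.1 < v.1) ∧
      (x.1 = c.1 + r → v.1 < x.1) ∧ (c.2 - r = x.2 → x.2 < v.2) ∧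
      (x.2 = c.2 + r → v.2 < x.2) := by
    have hne : ∀ {a b : ℝ}, a ≤ b → (a = b → False) → a < b := fun h h' => lt_of_le_of_ne h h'
    by_cases f1 : c.1 - r = x.1
    · refine ⟨(d.1 + q, d.2), by simp [mem_sqClosed_false, abs_of_pos hq], fun _ => ?_,
        fun h => by linarith, fun h => absurd h.symm (c1 f1.symm), fun h => absurd h (c2 f1.symm)⟩
      exact hne (by simp only; linarith) fun h => d2 h (by linarith)
    by_cases f2 : x.1 = c.1 + r
    · refine ⟨(d.1 - q, d.2), by simp [mem_sqClosed_false, abs_of_pos hq], fun h => by linarith,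
        fun _ => ?_, fun h => absurd h.symm (c3 f2), fun h => absurd h (c4 f2)⟩
      exact hne (by simp only; linarith) fun h => d1 h.symm (by simp only at h; linarith)
    by_cases f3 : c.2 - r = x.2
    · refine ⟨(d.1, d.2 + q), by simp [mem_sqClosed_false, abs_of_pos hq],
        fun h => absurd h f1, fun h => absurd h f2, fun _ => ?_, fun h => by linarith⟩
      exact hne (by simp only; linarith) fun h => d4 (by simp only at h; linarith) h
    · refine ⟨(d.1, d.2 - q), by simp [mem_sqClosed_false, abs_of_pos hq],
        fun h => absurd h f1, fun h => absurd h f2, fun h => absurd h f3, fun _ => ?_⟩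
      exact hne (by simp only; linarith) fun h => d3 (by simp only at h; linarith) h.symm
  obtain ⟨a, ⟨g1, g2⟩, ⟨g3, g4⟩, ha0, ha1⟩ :=
    ((eventually_add_mul_mem_Ioo a1 a2 e1 e2).and <| (eventually_add_mul_mem_Ioo a3 a4 e3 e4).and
      (Ioc_mem_nhdsGT one_pos)).exists
  have hm : x + a • (v - x) ∈ sqClosed false d q :=
    convex_sqClosed.add_smul_sub_mem h2 hv ⟨ha0.le, ha1⟩
  rw [← closure_sqOpen hq] at hm
  exact mem_closure_iff.1 hm _ isOpen_sqOpen (mem_sqOpen_true.2 ⟨g1, g2, g3, g4⟩)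

theorem exists_segment_disjoint {F W W' : Set (ℝ × ℝ)} (hF : F.Finite) (hW : IsOpen W)
    (hW' : IsOpen W') (hne : W.Nonempty) (hne' : W'.Nonempty) (hd : Disjoint W W') :
    ∃ a ∈ W, ∃ b ∈ W', Disjoint (segment ℝ a b) F := by
  obtain ⟨a, haW, haF⟩ := (hF.countable.dense_compl ℝ).exists_mem_open hW hne |>.imp
    fun _ h => h.symm
  obtain ⟨b, hb⟩ := hne'
  refine ⟨a, haW, ?_⟩
  by_contra! hcon
  set e := b - a with he
  have he0 : 0 < e.1 ^ 2 + e.2 ^ 2 := by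
    have : e ≠ 0 := sub_ne_zero.2 fun h => hd.ne_of_mem haW hb h.symm
    by_contra! h
    exact this (Prod.ext (by simp only [Prod.fst_zero]; nlinarith [sq_nonneg e.1, sq_nonneg e.2])
      (by simp only [Prod.snd_zero]; nlinarith [sq_nonneg e.1, sq_nonneg e.2]))
  have hcont : Continuous fun τ : ℝ => b + τ • ((-e.2, e.1) : ℝ × ℝ) := by fun_prop
  have hev : ∀ᶠ τ in 𝓝 (0 : ℝ), b + τ • ((-e.2, e.1) : ℝ × ℝ) ∈ W' :=
    hcont.continuousAt.eventually_mem (hW'.mem_nhds (by simpa using hb))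
  have hinf : {τ : ℝ | b + τ • ((-e.2, e.1) : ℝ × ℝ) ∈ W'}.Infinite := infinite_of_mem_nhds 0 hev
  have hmeet : ∀ τ : ℝ, ∃ y, b + τ • ((-e.2, e.1) : ℝ × ℝ) ∈ W' →
      y ∈ F ∧ ∃ l : ℝ, y = a + l • (e + τ • ((-e.2, e.1) : ℝ × ℝ)) := by
    intro τ
    by_cases h : b + τ • ((-e.2, e.1) : ℝ × ℝ) ∈ W'
    · obtain ⟨y, hy, hyF⟩ := Set.not_disjoint_iff.1 (hcon _ h)
      rw [segment_eq_image'] at hy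
      obtain ⟨l, -, rfl⟩ := hy
      exact ⟨_, fun _ => ⟨hyF, l, by simp only [he]; module⟩⟩
    · exact ⟨0, fun h' => absurd h' h⟩
  choose y hy using hmeet
  obtain ⟨τ, hτ, τ', hτ', hne, heq⟩ := hinf.exists_ne_map_eq_of_mapsTo (f := y)
    (fun τ hτ => (hy τ hτ).1) hF
  obtain ⟨hyF, l, hl⟩ := hy τ hτ
  obtain ⟨-, l', hl'⟩ := hy τ' hτ'
  have h12 := hl.symm.trans (heq.trans hl')
  have h1 := congrArg Prod.fst h12
  have h2 := congrArg Prod.snd h12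
  simp only [Prod.fst_add, Prod.snd_add, Prod.smul_fst, Prod.smul_snd, smul_eq_mul] at h1 h2
  have hll : l = l' := by
    have : (l - l') * (e.1 ^ 2 + e.2 ^ 2) = 0 := by linear_combination e.1 * h1 + e.2 * h2
    exact sub_eq_zero.1 ((mul_eq_zero.1 this).resolve_right he0.ne')
  subst hll
  have : l * (τ - τ') * (e.1 ^ 2 + e.2 ^ 2) = 0 := by linear_combination -e.2 * h1 + e.1 * h2
  rcases mul_eq_zero.1 ((mul_eq_zero.1 this).resolve_right he0.ne') with h | h
  · rw [h, zero_smul, add_zero] at hl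
    exact haF (hl ▸ hyF)
  · exact hne (sub_eq_zero.1 h)

theorem convex_leftOct {s : ℝ} (h0 : 0 < s) : Convex ℝ (leftOct s) := by
  rintro p ⟨hp, hp'⟩ q ⟨hq, hq'⟩ a b ha hb hab
  obtain ⟨a1, a2, a3, a4⟩ := (mem_F1_iff h0).1 hp
  obtain ⟨b1, b2, b3, b4⟩ := (mem_F1_iff h0).1 hq
  obtain rfl : b = 1 - a := by linarith
  refine ⟨(mem_F1_iff h0).2 ⟨?_, ?_, ?_, ?_⟩, ?_⟩ <;> simp only [Prod.fst_add, Prod.snd_add,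
    Prod.smul_fst, Prod.smul_snd, smul_eq_mul] <;> nlinarith

section Main

variable {s t : ℝ} {k : ℕ} (h0 : 0 < s) (ht : GoodParam t)
  (hst : 2 * (s * (k + t)) = 1) (hk : 1 ≤ k)

include h0 ht hst hk

theorem fst_lt_of_mem_Xzero (hs : s < 1 / 2) {p : ℝ × ℝ} (hp : p ∈ Xzero s)
    (hl : p ∉ limitSet s) : p ∈ F1 s ∧ p.1 < -s := by
  have ht0 := ht.bounds.1
  have hmem : ∀ {q : ℝ × ℝ}, q ∈ F1 s ∩ F2 s ↔ (-s ≤ q.1 ∧ q.1 ≤ s) ∧ -s ≤ q.2 ∧ q.2 ≤ s := by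
    intro q
    rw [mem_inter_iff, mem_F1_iff h0, mem_F2_iff h0]
    constructor
    · rintro ⟨⟨a1, a2, -, -⟩, b1, b2, -, -⟩
      exact ⟨⟨b1, b2⟩, a1, a2⟩
    · rintro ⟨⟨b1, b2⟩, a1, a2⟩
      refine ⟨⟨a1, a2, ?_, ?_⟩, b1, b2, ?_, ?_⟩ <;> linarith
  have hct : ∀ T, T ∈ centralTiles s ↔ (∃ m n : ℤ,
      T = (fun p : ℝ × ℝ => (p.1 + 2 * s * m, p.2 + 2 * s * n)) '' (F1 s ∩ F2 s)) ∧
      T ⊆ F1 s := by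
    intro T
    rw [centralTiles, if_neg (not_lt.2 hs.le)]
    rfl
  have hm : ∀ m : ℤ, (fun p : ℝ × ℝ => (p.1 + 2 * s * m, p.2 + 2 * s * (0 : ℤ))) ''
      (F1 s ∩ F2 s) ⊆ F1 s → p ∈ F1 s ∧ p.1 ≤ -s + 2 * s * m := fun m h =>
    Xzero_subset h0 ((hct _).2 ⟨⟨m, 0, rfl⟩, h⟩) (mem_image_of_mem _ (hmem.2
      (show (-s ≤ ((-s, 0) : ℝ × ℝ).1 ∧ _) ∧ _ by simp [h0.le]))) hp
  rcases hk.eq_or_lt with rfl | hk2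
  · obtain ⟨hF, hps⟩ := hm 0 (by
      rintro _ ⟨q, hq, rfl⟩
      simpa using hq.1)
    simp only [Int.cast_zero, mul_zero, add_zero] at hps
    exact ⟨hF, lt_of_le_of_ne hps fun h => hl (mem_limitSet_of_fst_eq h0 hs ht hst hF h)⟩
  · have hk3 : (2 : ℝ) ≤ k := by exact_mod_cast hk2
    have hs4 : s ≤ 1 / 4 := by nlinarith
    obtain ⟨hF, hps⟩ := hm (-1) (by
      rintro _ ⟨q, hq, rfl⟩
      obtain ⟨⟨a1, a2⟩, a3, a4⟩ := hmem.1 hq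
      refine (mem_F1_iff h0).2 ?_
      push_cast
      refine ⟨?_, ?_, ?_, ?_⟩ <;> linarith)
    push_cast at hps
    exact ⟨hF, by linarith⟩

theorem false_of_mem_closure_boxes_diamonds {p : ℝ × ℝ} (hp : p ∈ F1 s) (hps : p.1 < -s)
    (hl : p ∉ limitSet s)
    (hcl : ∀ i, p ∈ closure {x | ∃ c r, SquareTile (HalfRel s) (leftOct s) i c r ∧
      x ∈ sqClosed i c r}) : False := by
  obtain ⟨ε, hε, hfin⟩ := finite_squareTiles_near h0 ht hst hk hp hps hl
  set D := {S | (∃ i c r, SquareTile (HalfRel s) (leftOct s) i c r ∧ S = sqClosed i c r) ∧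
    (Metric.ball p ε ∩ S).Nonempty} with hD
  have hrep : ∀ S ∈ D, ∃ i c r, SquareTile (HalfRel s) (leftOct s) i c r ∧ S = sqClosed i c r :=
    fun S hS => hS.1
  choose! i c r htile hS using hrep
  set F := ⋃ S ∈ D, sqVertices (i S) (c S) (r S)
  have hF : F.Finite := hfin.biUnion fun S _ => finite_sqVertices _ _ _
  set O := Metric.ball p ε ∩ interior (leftOct s)
  have hO : IsOpen O := Metric.isOpen_ball.inter isOpen_interior
  have hOc : Convex ℝ O := (convex_ball p ε).inter (convex_leftOct h0).interior
  have hmeet : ∀ j, ∃ d q, SquareTile (HalfRel s) (leftOct s) j d q ∧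
      (O ∩ sqOpen j d q).Nonempty := by
    intro j
    obtain ⟨x, hx, d, q, h, hxd⟩ := mem_closure_iff.1 (hcl j) _ Metric.isOpen_ball
      (Metric.mem_ball_self hε)
    rw [← closure_sqOpen h.pos] at hxd
    obtain ⟨y, hy, hyd⟩ := mem_closure_iff.1 hxd _ Metric.isOpen_ball hx
    exact ⟨d, q, h, y, ⟨hy, interior_maximal (fun z hz => h.sub z (sqOpen_subset_sqClosed hz))
      isOpen_sqOpen hyd⟩, hyd⟩
  obtain ⟨d₁, q₁, ht₁, hne₁⟩ := hmeet true
  obtain ⟨d₂, q₂, ht₂, hne₂⟩ := hmeet false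
  obtain ⟨a, ha, b, hb, hab⟩ := exists_segment_disjoint hF (hO.inter isOpen_sqOpen)
    (hO.inter isOpen_sqOpen) hne₁ hne₂ (Set.disjoint_left.2 fun x hx hx' =>
      Bool.noConfusion (ht₁.type_eq ht₂ ⟨x, hx.2, hx'.2⟩))
  let K : Bool → Set (ℝ × ℝ) := fun j => ⋃ S ∈ {S ∈ D | i S = j}, S
  have hK : ∀ j, IsClosed (K j) := fun j =>
    (hfin.subset (sep_subset _ _)).isClosed_biUnion fun S hSD => by
      rw [hS S hSD.1]
      exact isClosed_sqClosed
  have hend : ∀ {j d q x}, SquareTile (HalfRel s) (leftOct s) j d q → x ∈ O ∩ sqOpen j d q →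
      x ∈ K j := by
    intro j d q x h hx
    have hxd := sqOpen_subset_sqClosed hx.2
    have hmem : sqClosed j d q ∈ D := ⟨⟨j, d, q, h, rfl⟩, x, hx.1.1, hxd⟩
    exact mem_biUnion (show sqClosed j d q ∈ {S ∈ D | i S = j} from
      ⟨hmem, (sqClosed_inj_type h.pos (htile _ hmem).pos (hS _ hmem)).symm⟩) hxd
  have hcover : segment ℝ a b ⊆ K true ∪ K false := by
    intro x hx
    have hxO : x ∈ O := hOc.segment_subset ha.1 hb.1 hx
    have hclosed : IsClosed (K true ∪ K false) := (hK true).union (hK false)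
    rw [← hclosed.closure_eq]
    refine mem_closure_iff.2 fun U hU hxU => ?_
    obtain ⟨j, d, q, h, y, hy, hyd⟩ := TileDense.exists_mem
      (fun ε hε => tileDense_leftOct h0 ht.bounds.1 hst hk ht hε) (hU.inter hO) ⟨hxU, hxO⟩
      (interior_subset hxO.2)
    refine ⟨y, hy.1, ?_⟩
    have := hend h ⟨hy.2, hyd⟩
    cases j
    exacts [Or.inr this, Or.inl this]
  obtain ⟨x, hx, hx1, hx2⟩ := isPreconnected_closed_iff.1 (convex_segment a b).isPreconnected _ _
    (hK true) (hK false) hcover ⟨a, left_mem_segment ℝ a b, hend ht₁ ha⟩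
    ⟨b, right_mem_segment ℝ a b, hend ht₂ hb⟩
  obtain ⟨S₁, ⟨hS₁, hi₁⟩, hx1⟩ := mem_iUnion₂.1 hx1
  obtain ⟨S₂, ⟨hS₂, hi₂⟩, hx2⟩ := mem_iUnion₂.1 hx2
  have hxF : x ∉ F := Set.disjoint_left.1 hab hx
  have hv : ∀ S ∈ D, x ∉ sqVertices (i S) (c S) (r S) := fun S hSD h =>
    hxF (mem_biUnion hSD h)
  have t₁ := htile S₁ hS₁
  have t₂ := htile S₂ hS₂
  have v₁ := hv S₁ hS₁
  have v₂ := hv S₂ hS₂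
  rw [hS S₁ hS₁] at hx1
  rw [hS S₂ hS₂] at hx2
  rw [hi₁] at t₁ v₁ hx1
  rw [hi₂] at t₂ v₂ hx2
  exact Bool.noConfusion (t₁.type_eq t₂ (sqOpen_inter_nonempty t₁.pos t₂.pos hx1 hx2 v₁ v₂))

end Main

theorem goodParam_of_irrational {s : ℝ} (h0 : 0 < s) (hirr : Irrational s)
    (h : ∀ n : ℕ, Rmap^[n] s < 1 / 2) : GoodParam s := by
  suffices H : ∀ n : ℕ, 0 < Rmap^[n] s ∧ Irrational (Rmap^[n] s) from fun n => ⟨(H n).1, h n⟩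
  intro n
  induction n with
  | zero => exact ⟨h0, hirr⟩
  | succ n ih =>
    have hn := h n
    rw [Function.iterate_succ_apply']
    set x := Rmap^[n] s
    have hx : Irrational (Rmap x) := by
      rw [Rmap, if_pos hn, one_div]
      exact ((by exact_mod_cast ih.2.natCast_mul (two_ne_zero : (2 : ℕ) ≠ 0) :
        Irrational (2 * x)).inv).sub_intCast _
    refine ⟨lt_of_le_of_ne ?_ fun h => hx.ne_zero h.symm, hx⟩
    rw [Rmap, if_pos hn]
    exact sub_nonneg.2 (Int.floor_le _)

/-- For an oddly even irrational `s`, a compact arc in `X_s⁰` joining a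
point of a box tile to a point of a diamond tile meets the limit set. -/
theorem arc_box_to_diamond_meets_limitSet (s : ℝ) (hs : s ∈ Ioo (0:ℝ) 1)
    (hirr : Irrational s) (h : ∀ n : ℕ, Rmap^[n] s < 1 / 2)
    (g : ℝ → ℝ × ℝ) (hg : ContinuousOn g (Icc 0 1)) (hinj : Set.InjOn g (Icc 0 1))
    (hsub : g '' Icc 0 1 ⊆ Xzero s)
    (P : Set (ℝ × ℝ)) (hP : P ∈ tiles s) (hPbox : IsBox P) (h0 : g 0 ∈ P)
    (Q : Set (ℝ × ℝ)) (hQ : Q ∈ tiles s) (hQdia : IsDiamond Q) (h1 : g 1 ∈ Q) :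
    ∃ x ∈ Icc (0:ℝ) 1, g x ∈ limitSet s := by
  obtain ⟨hs0, -⟩ := hs
  have hgood := goodParam_of_irrational hs0 hirr h
  have hs2 := hgood.bounds.2
  obtain ⟨κ, hκ⟩ := exists_recip hs0
  obtain ⟨k, hk, rfl⟩ := exists_eq_nat_add_Rmap hs0 hs2 hκ
  have ht := hgood.next
  by_contra! hlim
  have hF : ∀ x ∈ Icc (0 : ℝ) 1, g x ∈ F1 s ∧ (g x).1 < -s := fun x hx =>
    fst_lt_of_mem_Xzero hs0 ht hκ hk hs2 (hsub ⟨x, hx, rfl⟩) (hlim x hx)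
  let A : Bool → Set (ℝ × ℝ) := fun i => {x | ∃ c r,
    SquareTile (HalfRel s) (leftOct s) i c r ∧ x ∈ sqClosed i c r}
  have hcover : g '' Icc 0 1 ⊆ closure (A true) ∪ closure (A false) := by
    rintro _ ⟨x, hx, rfl⟩
    rw [← closure_union]
    refine mem_closure_iff.2 fun U hU hxU => ?_
    obtain ⟨i, c, r, hi, y, hyU, hy⟩ := TileDense.exists_mem
      (fun ε hε => tileDense_leftOct hs0 ht.bounds.1 hκ hk ht hε) hU hxU
      ⟨(hF x hx).1, (hF x hx).2.le⟩
    refine ⟨y, hyU, ?_⟩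
    have : y ∈ A i := ⟨c, r, hi, sqOpen_subset_sqClosed hy⟩
    cases i
    exacts [Or.inr this, Or.inl this]
  have m0 : (0 : ℝ) ∈ Icc (0 : ℝ) 1 := by simp
  have m1 : (1 : ℝ) ∈ Icc (0 : ℝ) 1 := by simp
  obtain ⟨c, r, hr, rfl⟩ := hPbox.exists_sqClosed
  obtain ⟨d, q, hq, rfl⟩ := hQdia.exists_sqClosed
  obtain ⟨_, ⟨x, hx, rfl⟩, hx1, hx2⟩ := isPreconnected_closed_iff.1
    (isPreconnected_Icc.image g hg) _ _ isClosed_closure isClosed_closure hcover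
    ⟨g 0, ⟨0, m0, rfl⟩, subset_closure
      (exists_squareTile_of_mem_tiles hs0 ht hκ hk hs2 hr hP h0 (hF 0 m0).2)⟩
    ⟨g 1, ⟨1, m1, rfl⟩, subset_closure
      (exists_squareTile_of_mem_tiles hs0 ht hκ hk hs2 hq hQ h1 (hF 1 m1).2)⟩
  refine false_of_mem_closure_boxes_diamonds hs0 ht hκ hk (hF x hx).1 (hF x hx).2 (hlim x hx)
    fun i => ?_
  cases i
  exacts [hx2, hx1]

end
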